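/- Let S be a noncompact surface with nonempty boundary and no boundary isolating curve. Then there exists a compact exhaustion K₁ ⊆ K₂ ⊆ ⋯ of S (each Kᵢ compact, Kᵢ contained in the interior of Kᵢ₊₁, and ⋃ᵢ Kᵢ = S) such that for every i, every connected component of S∖Kᵢ intersects ∂S, and every connected component of Kᵢ₊₁ ∖ interior(Kᵢ) intersects ∂S. -/

import Mathlib

open Set Topology unitInterval

noncomputable section

/-- A map is proper-continuous: continuous and the preimage of every compact set is compact. -/
def ProperCont {X Y : Type*} [TopologicalSpace X] [TopologicalSpace Y] (f : X → Y) : Prop :=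
  Continuous f ∧ ∀ K : Set Y, IsCompact K → IsCompact (f ⁻¹' K)

/-- `f` and `g` are homotopic. -/
def Htpc {X Y : Type*} [TopologicalSpace X] [TopologicalSpace Y] (f g : X → Y) : Prop :=
  ∃ H : X × I → Y, Continuous H ∧ (∀ x, H (x, 0) = f x) ∧ (∀ x, H (x, 1) = g x)

/-- `f` and `g` are properly homotopic: joined by a homotopy which is itself a proper map. -/
def PHtpc {X Y : Type*} [TopologicalSpace X] [TopologicalSpace Y] (f g : X → Y) : Prop :=
  ∃ H : X × I → Y, ProperCont H ∧ (∀ x, H (x, 0) = f x) ∧ (∀ x, H (x, 1) = g x)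

/-- `φ` is a proper homotopy equivalence with proper homotopy inverse `ψ`. -/
def IsPHEPair {X Y : Type*} [TopologicalSpace X] [TopologicalSpace Y]
    (φ : X → Y) (ψ : Y → X) : Prop :=
  ProperCont φ ∧ ProperCont ψ ∧ PHtpc (ψ ∘ φ) id ∧ PHtpc (φ ∘ ψ) id

/-- `φ` is a proper homotopy equivalence (admitting some proper homotopy inverse). -/
def IsPHE {X Y : Type*} [TopologicalSpace X] [TopologicalSpace Y] (φ : X → Y) : Prop :=
  ∃ ψ : Y → X, IsPHEPair φ ψ

/-- `X` and `Y` are properly homotopy equivalent. -/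
def PHEquivalent (X Y : Type*) [TopologicalSpace X] [TopologicalSpace Y] : Prop :=
  ∃ φ : X → Y, IsPHE φ

/-- The standard Möbius band, realized as a subset of `ℝ³`. -/
def MobiusBand : Set (ℝ × ℝ × ℝ) :=
  {p | ∃ u v : ℝ, |v| ≤ 1 / 2 ∧
    p = ((1 + v * Real.cos (u / 2)) * Real.cos u,
         (1 + v * Real.cos (u / 2)) * Real.sin u,
         v * Real.sin (u / 2))}

/-- A surface: a connected, orientable (no embedded Möbius band), second-countable, Hausdorff
topological 2-manifold, possibly with boundary (locally modeled on the closed half-plane). -/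
structure IsSurface (S : Type*) [TopologicalSpace S] : Prop where
  connected : ConnectedSpace S
  t2 : T2Space S
  secondCountable : SecondCountableTopology S
  locallyHalfPlane : ∀ x : S, ∃ (U : Set S) (V : Set {p : ℝ × ℝ // 0 ≤ p.2}),
    IsOpen U ∧ x ∈ U ∧ IsOpen V ∧ Nonempty (↥U ≃ₜ ↥V)
  orientable : ¬ ∃ f : ↥MobiusBand → S, IsEmbedding f

/-- The boundary of a surface: the set of points having no open neighborhood
homeomorphic to `ℝ²`. -/
def Bd (S : Type*) [TopologicalSpace S] : Set S :=
  {x | ¬ ∃ U : Set S, IsOpen U ∧ x ∈ U ∧ Nonempty (↥U ≃ₜ (ℝ × ℝ))}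

/-- The unit circle in the plane. -/
def Circ : Set (ℝ × ℝ) := {p | p.1 ^ 2 + p.2 ^ 2 = 1}

/-- A simple closed curve in `S`: the image of a topological embedding of the circle. -/
def IsSimpleClosedCurve {S : Type*} [TopologicalSpace S] (α : Set S) : Prop :=
  ∃ f : ↥Circ → S, IsEmbedding f ∧ range f = α

/-- A boundary isolating curve: a simple closed curve `α ⊆ S ∖ ∂S` such that `S ∖ α` has
exactly two connected components `Y` and `Z` with `Y ∩ ∂S ≠ ∅`, `Z ∩ ∂S = ∅`, and
`Z ∪ α` noncompact. -/
def IsBoundaryIsolating {S : Type*} [TopologicalSpace S] (α : Set S) : Prop :=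
  IsSimpleClosedCurve α ∧ α ∩ Bd S = ∅ ∧
  ∃ Y Z : Set S, Y ≠ Z ∧
    (∀ C : Set S, (∃ x ∈ αᶜ, C = connectedComponentIn αᶜ x) ↔ (C = Y ∨ C = Z)) ∧
    (Y ∩ Bd S).Nonempty ∧ Z ∩ Bd S = ∅ ∧ ¬ IsCompact (Z ∪ α)

/-- The open part of the parametrizing interval of an edge. -/
def edgeInt : Set I := {t : I | 0 < (t : ℝ) ∧ (t : ℝ) < 1}

/-- A graph: a connected, locally finite, Hausdorff, 1-dimensional CW complex, presented by a
closed discrete vertex set and a set of characteristic maps of edges. -/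
structure IsGraph (Γ : Type*) [TopologicalSpace Γ] : Prop where
  connected : ConnectedSpace Γ
  t2 : T2Space Γ
  cell_structure : ∃ (V : Set Γ) (E : Set C(I, Γ)),
    IsClosed V ∧ DiscreteTopology ↥V ∧
    (∀ e ∈ E, e 0 ∈ V ∧ e 1 ∈ V) ∧
    (∀ e ∈ E, IsEmbedding (fun t : ↥edgeInt => e t.1)) ∧
    (∀ e ∈ E, (⇑e '' edgeInt) ∩ V = ∅) ∧
    (∀ e ∈ E, ∀ e' ∈ E, e ≠ e' → (⇑e '' edgeInt) ∩ (⇑e' '' edgeInt) = ∅) ∧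
    (V ∪ ⋃ e ∈ E, ⇑e '' edgeInt) = univ ∧
    (∀ x : Γ, ∃ U : Set Γ, IsOpen U ∧ x ∈ U ∧ {e ∈ E | (range ⇑e ∩ U).Nonempty}.Finite) ∧
    (∀ A : Set Γ, (∀ e ∈ E, IsClosed (⇑e ⁻¹' A)) → IsClosed (A ∩ ⋃ e ∈ E, range ⇑e)) ∧
    (∀ v ∈ V, (∃ e ∈ E, v ∈ range ⇑e) ∨ (univ : Set Γ) = {v})

/-- A finite graph: a graph with finitely many cells, equivalently a compact graph. -/
def IsFiniteGraph (Γ : Type*) [TopologicalSpace Γ] : Prop :=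
  IsGraph Γ ∧ CompactSpace Γ

/-- A deformation retraction of `S` onto the subspace `A`. -/
def IsDeformationRetraction {S : Type*} [TopologicalSpace S] (H : S × I → S) (A : Set S) :
    Prop :=
  Continuous H ∧ (∀ x, H (x, 0) = x) ∧ (∀ x, H (x, 1) ∈ A) ∧ (∀ a ∈ A, H (a, 1) = a)

/-- A proper deformation retraction of `S` onto the subspace `A`. -/
def IsProperDeformationRetraction {S : Type*} [TopologicalSpace S] (H : S × I → S)
    (A : Set S) : Prop :=
  ProperCont H ∧ (∀ x, H (x, 0) = x) ∧ (∀ x, H (x, 1) ∈ A) ∧ (∀ a ∈ A, H (a, 1) = a)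

/-- An end of a space, recorded as a compatible choice of a connected component of the
complement of each compact set. -/
def IsEndFn {Γ : Type*} [TopologicalSpace Γ] (s : Set Γ → Set Γ) : Prop :=
  (∀ K : Set Γ, IsCompact K → ∃ x ∈ Kᶜ, s K = connectedComponentIn Kᶜ x) ∧
  (∀ K K' : Set Γ, IsCompact K → IsCompact K' → K ⊆ K' → s K' ⊆ s K)

/-- A proper map induces the identity on the space of ends. -/
def InducesIdOnEnds {Γ : Type*} [TopologicalSpace Γ] (g : Γ → Γ) : Prop :=
  ∀ s : Set Γ → Set Γ, IsEndFn s → ∀ K : Set Γ, IsCompact K →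
    ∃ K' : Set Γ, IsCompact K' ∧ K ⊆ K' ∧ g '' s K' ⊆ s K

/-- An isotopy between `f` and `g` relative to the set `B`: a homotopy each of whose time
slices is a homeomorphism fixing `B` pointwise. -/
def IsotopicRel {S : Type*} [TopologicalSpace S] (B : Set S) (f g : S → S) : Prop :=
  ∃ H : S × I → S, Continuous H ∧ (∀ x, H (x, 0) = f x) ∧ (∀ x, H (x, 1) = g x) ∧
    ∀ t : I, IsHomeomorph (fun x => H (x, t)) ∧ ∀ x ∈ B, H (x, t) = x

/-- An isotopy between `f` and `g`: a homotopy each of whose time slices is a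
homeomorphism. -/
def Isotopic {S : Type*} [TopologicalSpace S] (f g : S → S) : Prop :=
  ∃ H : S × I → S, Continuous H ∧ (∀ x, H (x, 0) = f x) ∧ (∀ x, H (x, 1) = g x) ∧
    ∀ t : I, IsHomeomorph (fun x => H (x, t))

/-- Representatives for the mapping class group of a surface: homeomorphisms fixing the
boundary pointwise, with the compact-open topology. -/
abbrev MCGRep (S : Type*) [TopologicalSpace S] :=
  {f : C(S, S) // IsHomeomorph ⇑f ∧ ∀ x ∈ Bd S, f x = x}

/-- The isotopy-rel-boundary relation on representatives. -/
def mcgRel (S : Type*) [TopologicalSpace S] (f g : MCGRep S) : Prop :=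
  IsotopicRel (Bd S) ⇑f.1 ⇑g.1

/-- The mapping class group `Map(S)` of a surface as a topological space: homeomorphisms
fixing the boundary pointwise, modulo isotopy rel boundary, with the quotient of the
compact-open topology. -/
abbrev MCG (S : Type*) [TopologicalSpace S] := Quot (mcgRel S)

/-- Representatives for the extended mapping class group: all homeomorphisms. -/
abbrev ExRep (S : Type*) [TopologicalSpace S] := {f : C(S, S) // IsHomeomorph ⇑f}

/-- The (free) isotopy relation on representatives. -/
def exRel (S : Type*) [TopologicalSpace S] (f g : ExRep S) : Prop :=
  Isotopic ⇑f.1 ⇑g.1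

/-- The extended mapping class group `ExMap(S)` as a topological space. -/
abbrev ExMCG (S : Type*) [TopologicalSpace S] := Quot (exRel S)

/-- Representatives for the mapping class group of a graph: proper homotopy equivalences
admitting a proper homotopy inverse, with the compact-open topology. -/
abbrev GphRep (Γ : Type*) [TopologicalSpace Γ] := {g : C(Γ, Γ) // IsPHE ⇑g}

/-- The proper homotopy relation on representatives. -/
def gphRel (Γ : Type*) [TopologicalSpace Γ] (g h : GphRep Γ) : Prop :=
  PHtpc ⇑g.1 ⇑h.1

/-- The mapping class group `Map(Γ)` of a graph as a topological space. -/
abbrev GphMCG (Γ : Type*) [TopologicalSpace Γ] := Quot (gphRel Γ)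

/-- Rotation of the unit circle by angle `a`. -/
def rotC (a : ℝ) (p : ↥Circ) : ↥Circ :=
  ⟨(p.1.1 * Real.cos a - p.1.2 * Real.sin a, p.1.1 * Real.sin a + p.1.2 * Real.cos a), by
    have h : p.1.1 ^ 2 + p.1.2 ^ 2 = 1 := p.2
    have h2 := Real.sin_sq_add_cos_sq a
    simp only [Circ, Set.mem_setOf_eq]
    nlinarith [h, h2]⟩

/-- Reflection of the unit circle (the standard orientation-reversing involution). -/
def circConj (p : ↥Circ) : ↥Circ :=
  ⟨(p.1.1, -p.1.2), by
    have h : p.1.1 ^ 2 + p.1.2 ^ 2 = 1 := p.2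
    simp only [Circ, Set.mem_setOf_eq]
    nlinarith [h]⟩

/-- The midpoint of the unit interval. -/
def ihalf : I := ⟨1 / 2, by norm_num [Set.mem_Icc]⟩

/-- `f` is the twist map determined by an embedded annular collar `e`:
`e(θ,t) ↦ e(θ + 2πt, t)` on the image of `e` and the identity elsewhere. -/
def IsTwistMap {S : Type*} [TopologicalSpace S] (e : ↥Circ × I → S) (f : S → S) : Prop :=
  IsEmbedding e ∧
  (∀ (θ : ↥Circ) (t : I), f (e (θ, t)) = e (rotC (2 * Real.pi * (t : ℝ)) θ, t)) ∧
  (∀ x, x ∉ range e → f x = x)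

/-- A Dehn twist about a compact boundary component of `S`. -/
def IsCptBdTwist {S : Type*} [TopologicalSpace S] (f : S → S) : Prop :=
  ∃ e : ↥Circ × I → S, IsTwistMap e f ∧
    (∃ x ∈ Bd S, range (fun θ : ↥Circ => e (θ, 0)) = connectedComponentIn (Bd S) x ∧
      IsCompact (connectedComponentIn (Bd S) x)) ∧
    (∀ (θ : ↥Circ) (t : I), (t : ℝ) ≠ 0 → e (θ, t) ∉ Bd S)

/-- The closed unit disk in the plane. -/
def ClosedDisk : Set (ℝ × ℝ) := {p | p.1 ^ 2 + p.2 ^ 2 ≤ 1}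

/-- A Dehn twist about a degenerate boundary chain: a twist supported in an annulus disjoint
from `∂S` whose core curve cuts off a piece homeomorphic to a closed disk with a nonempty
proper closed subset removed from its boundary circle. -/
def IsDegChainTwist {S : Type*} [TopologicalSpace S] (f : S → S) : Prop :=
  ∃ e : ↥Circ × I → S, IsTwistMap e f ∧ range e ∩ Bd S = ∅ ∧
    ∃ x ∈ (range fun θ : ↥Circ => e (θ, ihalf))ᶜ,
      ∃ J : Set (ℝ × ℝ), J ⊆ Circ ∧ IsClosed J ∧ J.Nonempty ∧ J ≠ Circ ∧
        Nonempty
          (↥(closure (connectedComponentIn (range fun θ : ↥Circ => e (θ, ihalf))ᶜ x)) ≃ₜ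
            ↥(ClosedDisk \ J))

/-- `f` is a finite composition of maps satisfying the predicate `P`. -/
def IsProductOf {S : Type*} [TopologicalSpace S] (P : (S → S) → Prop) (f : S → S) : Prop :=
  ∃ L : List (S → S), (∀ g ∈ L, P g) ∧ f = L.foldr (· ∘ ·) id

/-- The closed half-strip `[0,∞) × [0,1]`. -/
def HalfStrip : Set (ℝ × ℝ) := {p | 0 ≤ p.1 ∧ 0 ≤ p.2 ∧ p.2 ≤ 1}

/-- The closed strip `ℝ × [0,1]`. -/
def FullStrip : Set (ℝ × ℝ) := {p | 0 ≤ p.2 ∧ p.2 ≤ 1}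

/-- A closed annulus in the plane. -/
def AnnulusSet : Set (ℝ × ℝ) := {p | 1 ≤ p.1 ^ 2 + p.2 ^ 2 ∧ p.1 ^ 2 + p.2 ^ 2 ≤ 4}

/-- A surface is sporadic if it is homeomorphic to the closed disk, the half-strip, the
strip, or the annulus. -/
def IsSporadic (S : Type*) [TopologicalSpace S] : Prop :=
  Nonempty (S ≃ₜ ↥ClosedDisk) ∨ Nonempty (S ≃ₜ ↥HalfStrip) ∨
    Nonempty (S ≃ₜ ↥FullStrip) ∨ Nonempty (S ≃ₜ ↥AnnulusSet)

/-- A parametrization of a compact boundary component of `S` by the circle. -/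
def IsCptBdParam {S : Type*} [TopologicalSpace S] (β : ↥Circ → S) : Prop :=
  IsEmbedding β ∧ ∃ x ∈ Bd S, range β = connectedComponentIn (Bd S) x ∧
    IsCompact (range β)

/-- A proper parametrization of a noncompact boundary component of `S` by the line. -/
def IsNcptBdParam {S : Type*} [TopologicalSpace S] (β : ℝ → S) : Prop :=
  IsEmbedding β ∧ ProperCont β ∧ ∃ x ∈ Bd S, range β = connectedComponentIn (Bd S) x ∧
    ¬ IsCompact (range β)

/-- `g` fixes (up to homotopy, resp. proper homotopy, and preserving orientations) each
curve and line of the collection `B` of `φ'`-images of boundary components: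
membership in `Map(Γ, B)`. -/
def FixesBdryImages {S : Type*} [TopologicalSpace S] (G : Set S) (φ' : S → ↥G)
    (g : ↥G → ↥G) : Prop :=
  (∀ β : ↥Circ → S, IsCptBdParam β → Htpc (g ∘ φ' ∘ β) (φ' ∘ β)) ∧
  (∀ β : ℝ → S, IsNcptBdParam β → PHtpc (g ∘ φ' ∘ β) (φ' ∘ β))

/-- `g` preserves the collection `B` of `φ'`-images of boundary components, possibly
permuting its members and reversing orientations: membership in `Map*(Γ, B)`. -/
def PermutesBdryImages {S : Type*} [TopologicalSpace S] (G : Set S) (φ' : S → ↥G)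
    (g : ↥G → ↥G) : Prop :=
  (∀ β : ↥Circ → S, IsCptBdParam β → ∃ β' : ↥Circ → S, IsCptBdParam β' ∧
    (Htpc (g ∘ φ' ∘ β) (φ' ∘ β') ∨ Htpc (g ∘ φ' ∘ β) (φ' ∘ β' ∘ circConj))) ∧
  (∀ β : ℝ → S, IsNcptBdParam β → ∃ β' : ℝ → S, IsNcptBdParam β' ∧
    (PHtpc (g ∘ φ' ∘ β) (φ' ∘ β') ∨ PHtpc (g ∘ φ' ∘ β) (φ' ∘ β' ∘ (fun r : ℝ => -r))))

end

/-- `A` is an arc with endpoints `x` and `y`. -/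
def IsArc {S : Type*} [TopologicalSpace S] (A : Set S) (x y : S) : Prop :=
  ∃ (a b : ℝ) (γ : ℝ → S), a < b ∧ ContinuousOn γ (Icc a b) ∧ InjOn γ (Icc a b) ∧
    γ a = x ∧ γ b = y ∧ γ '' Icc a b = A

namespace IsArc

variable {S S' : Type*} [TopologicalSpace S] [TopologicalSpace S'] {A B : Set S} {x y z : S}

theorem symm (h : IsArc A x y) : IsArc A y x := by
  obtain ⟨a, b, γ, hab, hc, hi, rfl, rfl, rfl⟩ := h
  have hm : MapsTo (fun t : ℝ => -t) (Icc (-b) (-a)) (Icc a b) := by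
    intro t ht; simp only [mem_Icc] at *; constructor <;> linarith
  refine ⟨-b, -a, fun t => γ (-t), by linarith, hc.comp continuous_neg.continuousOn hm,
    hi.comp neg_injective.injOn hm, by simp, by simp, ?_⟩
  rw [show (fun t => γ (-t)) = γ ∘ fun t : ℝ => -t from rfl, image_comp, image_neg_eq_neg]
  simp

theorem left_mem (h : IsArc A x y) : x ∈ A := by
  obtain ⟨a, b, γ, hab, hc, hi, rfl, rfl, rfl⟩ := h
  exact mem_image_of_mem _ (left_mem_Icc.2 hab.le)

theorem right_mem (h : IsArc A x y) : y ∈ A := h.symm.left_mem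

theorem ne (h : IsArc A x y) : x ≠ y := by
  obtain ⟨a, b, γ, hab, hc, hi, rfl, rfl, rfl⟩ := h
  intro e
  exact hab.ne (hi (left_mem_Icc.2 hab.le) (right_mem_Icc.2 hab.le) e)

theorem isCompact (h : IsArc A x y) : IsCompact A := by
  obtain ⟨a, b, γ, hab, hc, hi, rfl, rfl, rfl⟩ := h
  exact isCompact_Icc.image_of_continuousOn hc

theorem isClosed [T2Space S] (h : IsArc A x y) : IsClosed A := h.isCompact.isClosed

theorem isPreconnected (h : IsArc A x y) : IsPreconnected A := by
  obtain ⟨a, b, γ, hab, hc, hi, rfl, rfl, rfl⟩ := h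
  exact isPreconnected_Icc.image _ hc

theorem image (h : IsArc A x y) {f : S → S'} (hf : ContinuousOn f A) (hfi : InjOn f A) :
    IsArc (f '' A) (f x) (f y) := by
  obtain ⟨a, b, γ, hab, hc, hi, rfl, rfl, rfl⟩ := h
  exact ⟨a, b, f ∘ γ, hab, hf.comp hc (mapsTo_image _ _), hfi.comp hi (mapsTo_image _ _), rfl, rfl,
    image_comp _ _ _⟩

theorem exists_unit (h : IsArc A x y) (a b : ℝ) (hab : a < b) :
    ∃ γ : ℝ → S, ContinuousOn γ (Icc a b) ∧ InjOn γ (Icc a b) ∧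
    γ a = x ∧ γ b = y ∧ γ '' Icc a b = A := by
  obtain ⟨c, d, γ, hcd, hc, hi, rfl, rfl, rfl⟩ := h
  have h1 : 0 < b - a := sub_pos.2 hab
  have h2 : 0 < d - c := sub_pos.2 hcd
  have himg : (fun t : ℝ => c + (t - a) * ((d - c) / (b - a))) '' Icc a b = Icc c d := by
    ext t
    simp only [mem_image, mem_Icc]
    constructor
    · rintro ⟨s, ⟨hs1, hs2⟩, rfl⟩
      have h3 : 0 < (d - c) / (b - a) := by positivity
      constructor
      · nlinarith
      · have : (s - a) * ((d - c) / (b - a)) ≤ (b - a) * ((d - c) / (b - a)) := by gcongr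
        have h4 : (b - a) * ((d - c) / (b - a)) = d - c := by field_simp
        linarith
    · rintro ⟨ht1, ht2⟩
      have h3 : 0 < (b - a) / (d - c) := by positivity
      refine ⟨a + (t - c) * ((b - a) / (d - c)), ⟨by nlinarith, ?_⟩, by field_simp; ring⟩
      have : (t - c) * ((b - a) / (d - c)) ≤ (d - c) * ((b - a) / (d - c)) := by gcongr
      have h4 : (d - c) * ((b - a) / (d - c)) = b - a := by field_simp
      linarith
  have hm : MapsTo (fun t : ℝ => c + (t - a) * ((d - c) / (b - a))) (Icc a b) (Icc c d) := by
    rw [← himg]; exact mapsTo_image _ _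
  refine ⟨fun t => γ (c + (t - a) * ((d - c) / (b - a))), hc.comp (by fun_prop) hm, hi.comp ?_ hm,
    by simp, ?_, ?_⟩
  · intro s _ t _ hst
    have h3 : 0 < (d - c) / (b - a) := by positivity
    simp only [add_right_inj, mul_eq_mul_right_iff, h3.ne', or_false] at hst
    linarith
  · have : c + (b - a) * ((d - c) / (b - a)) = d := by field_simp; ring
    simp only [this]
  · rw [← himg, ← image_comp]; rfl

theorem of_Icc {γ : ℝ → S} {a b : ℝ} (hab : a < b) (hc : ContinuousOn γ (Icc a b))
    (hi : InjOn γ (Icc a b)) : IsArc (γ '' Icc a b) (γ a) (γ b) :=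
  ⟨a, b, γ, hab, hc, hi, rfl, rfl, rfl⟩

theorem split (h : IsArc A x y) (hz : z ∈ A) (hzx : z ≠ x) (hzy : z ≠ y) :
    ∃ A₁ A₂, IsArc A₁ x z ∧ IsArc A₂ z y ∧ A₁ ∪ A₂ = A ∧ A₁ ∩ A₂ = {z} := by
  obtain ⟨a, b, γ, hab, hc, hi, rfl, rfl, rfl⟩ := h
  obtain ⟨t, ht, rfl⟩ := hz
  have h1 : a < t := lt_of_le_of_ne ht.1 (fun e => hzx (by rw [e]))
  have h2 : t < b := lt_of_le_of_ne ht.2 (fun e => hzy (by rw [e]))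
  have s1 : Icc a t ⊆ Icc a b := Icc_subset_Icc le_rfl h2.le
  have s2 : Icc t b ⊆ Icc a b := Icc_subset_Icc h1.le le_rfl
  refine ⟨γ '' Icc a t, γ '' Icc t b, of_Icc h1 (hc.mono s1) (hi.mono s1),
    of_Icc h2 (hc.mono s2) (hi.mono s2), ?_, ?_⟩
  · rw [← image_union, Icc_union_Icc_eq_Icc h1.le h2.le]
  · rw [← hi.image_inter s1 s2, Icc_inter_Icc_eq_singleton h1.le h2.le, image_singleton]

theorem trans (hA : IsArc A x y) (hB : IsArc B y z) (h : A ∩ B ⊆ {y}) : IsArc (A ∪ B) x z := by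
  obtain ⟨γ, hc, hi, rfl, rfl, rfl⟩ := hA.exists_unit 0 1 one_pos
  obtain ⟨δ, hc', hi', h0, rfl, rfl⟩ := hB.exists_unit 1 2 one_lt_two
  let ε : ℝ → S := fun t => if t ≤ 1 then γ t else δ t
  have e1 : EqOn ε γ (Icc 0 1) := fun t ht => by simp [ε, ht.2]
  have e2 : EqOn ε δ (Icc 1 2) := fun t ht => by
    rcases ht.1.eq_or_lt with rfl | h1
    · simp [ε, h0]
    · simp [ε, not_le.2 h1]
  have hu : Icc (0:ℝ) 2 = Icc 0 1 ∪ Icc 1 2 := (Icc_union_Icc_eq_Icc zero_le_one one_le_two).symm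
  refine ⟨0, 2, ε, two_pos, ?_, ?_, e1 (by simp), e2 (by simp), ?_⟩
  · rw [hu]
    exact (hc.congr e1).union_of_isClosed (hc'.congr e2) isClosed_Icc isClosed_Icc
  · have key : ∀ s ∈ Icc (0:ℝ) 1, ∀ t ∈ Icc (1:ℝ) 2, γ s = δ t → s = t := by
      intro s hs t ht hst
      have h1 : γ s = γ 1 := h ⟨mem_image_of_mem _ hs, hst ▸ mem_image_of_mem _ ht⟩
      have h2 := hi hs (by simp) h1
      have h3 := hi' (show (1:ℝ) ∈ Icc (1:ℝ) 2 by simp) ht (by rw [h0, ← hst, h1])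
      linarith
    rw [hu]
    rintro s (hs | hs) t (ht | ht) hst
    · rw [e1 hs, e1 ht] at hst; exact hi hs ht hst
    · rw [e1 hs, e2 ht] at hst; exact key s hs t ht hst
    · rw [e2 hs, e1 ht] at hst; exact (key t ht s hs hst.symm).symm
    · rw [e2 hs, e2 ht] at hst; exact hi' hs ht hst
  · rw [hu, image_union, e1.image_eq, e2.image_eq]

/-- Initial subarcs get arbitrarily small. -/
theorem shrink [T2Space S] (h : IsArc A x y) {V : Set S} (hV : V ∈ 𝓝 x) :
    ∃ V' ∈ 𝓝 x, ∀ z ∈ A ∩ V', z ≠ x → z ≠ y ∧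
      ∃ A₁ A₂, IsArc A₁ x z ∧ IsArc A₂ z y ∧ A₁ ∪ A₂ = A ∧ A₁ ∩ A₂ = {z} ∧ A₁ ⊆ V := by
  obtain ⟨a, b, γ, hab, hc, hi, rfl, rfl, rfl⟩ := h
  obtain ⟨c, hca, hcV⟩ : ∃ c ∈ Ioc a b, γ '' Icc a c ⊆ V := by
    have := hc a (left_mem_Icc.2 hab.le) hV
    rw [Filter.mem_map, nhdsWithin_Icc_eq_nhdsGE hab, mem_nhdsGE_iff_exists_Icc_subset] at this
    obtain ⟨u, hu, huV⟩ := this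
    refine ⟨min u b, ⟨lt_min hu hab, min_le_right _ _⟩, ?_⟩
    rintro _ ⟨t, ht, rfl⟩
    exact huV ⟨ht.1, ht.2.trans (min_le_left _ _)⟩
  have hcl : IsClosed (γ '' Icc c b) :=
    (isCompact_Icc.image_of_continuousOn (hc.mono (Icc_subset_Icc hca.1.le le_rfl))).isClosed
  refine ⟨(γ '' Icc c b)ᶜ, hcl.isOpen_compl.mem_nhds ?_, ?_⟩
  · rintro ⟨t, ht, hta⟩
    have := hi ⟨hca.1.le.trans ht.1, ht.2⟩ (left_mem_Icc.2 hab.le) hta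
    linarith [hca.1, ht.1]
  · rintro _ ⟨⟨t, ht, rfl⟩, htV⟩ hne
    have htc : t < c := by
      by_contra! hh
      exact htV (mem_image_of_mem _ ⟨hh, ht.2⟩)
    have h1 : a < t := lt_of_le_of_ne ht.1 (fun e => hne (by rw [e]))
    have h2 : t < b := htc.trans_le hca.2
    have s1 : Icc a t ⊆ Icc a b := Icc_subset_Icc le_rfl h2.le
    have s2 : Icc t b ⊆ Icc a b := Icc_subset_Icc h1.le le_rfl
    refine ⟨fun e => h2.ne (hi ht (right_mem_Icc.2 hab.le) e),
      γ '' Icc a t, γ '' Icc t b, of_Icc h1 (hc.mono s1) (hi.mono s1),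
      of_Icc h2 (hc.mono s2) (hi.mono s2), ?_, ?_, ?_⟩
    · rw [← image_union, Icc_union_Icc_eq_Icc h1.le h2.le]
    · rw [← hi.image_inter s1 s2, Icc_inter_Icc_eq_singleton h1.le h2.le, image_singleton]
    · exact (image_mono (Icc_subset_Icc le_rfl htc.le)).trans hcV

theorem interior_eq {X : Type*} {a b : ℝ} {γ : ℝ → X} (hab : a < b) (hi : InjOn γ (Icc a b)) :
    γ '' Icc a b \ {γ a, γ b} = γ '' Ioo a b := by
  rw [← Icc_sdiff_both]
  ext z
  simp only [mem_sdiff, mem_image, mem_insert_iff, mem_singleton_iff, not_or]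
  constructor
  · rintro ⟨⟨t, ht, rfl⟩, h1, h2⟩
    exact ⟨t, ⟨ht, fun e => h1 (by rw [e]), fun e => h2 (by rw [e])⟩, rfl⟩
  · rintro ⟨t, ⟨ht, h1, h2⟩, rfl⟩
    exact ⟨⟨t, ht, rfl⟩, fun e => h1 (hi ht (left_mem_Icc.2 hab.le) e),
      fun e => h2 (hi ht (right_mem_Icc.2 hab.le) e)⟩

theorem interior_isPreconnected (h : IsArc A x y) : IsPreconnected (A \ {x, y}) := by
  obtain ⟨a, b, γ, hab, hc, hi, rfl, rfl, rfl⟩ := h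
  rw [interior_eq hab hi]
  exact isPreconnected_Ioo.image _ (hc.mono Ioo_subset_Icc_self)

theorem interior_nonempty (h : IsArc A x y) : (A \ {x, y}).Nonempty := by
  obtain ⟨a, b, γ, hab, hc, hi, rfl, rfl, rfl⟩ := h
  rw [interior_eq hab hi]
  exact (nonempty_Ioo.2 hab).image _

theorem subset_closure_interior (h : IsArc A x y) : A ⊆ closure (A \ {x, y}) := by
  obtain ⟨a, b, γ, hab, hc, hi, rfl, rfl, rfl⟩ := h
  rw [interior_eq hab hi, ← closure_Ioo hab.ne]
  exact ContinuousOn.image_closure (by rwa [closure_Ioo hab.ne])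

/-- The first point of an arc on a closed set. -/
theorem first_hit [T2Space S] (h : IsArc A x y) {F : Set S} (hF : IsClosed F) (hx : x ∉ F)
    (hy : (A ∩ F).Nonempty) :
    ∃ z ∈ F, ∃ A₁ ⊆ A, IsArc A₁ x z ∧ A₁ ∩ F = {z} := by
  obtain ⟨a, b, γ, hab, hc, hi, rfl, rfl, rfl⟩ := h
  have hT : IsCompact (Icc a b ∩ γ ⁻¹' F) :=
    isCompact_Icc.of_isClosed_subset (hc.preimage_isClosed_of_isClosed isClosed_Icc hF)
      inter_subset_left
  have hne : (Icc a b ∩ γ ⁻¹' F).Nonempty := by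
    obtain ⟨_, ⟨t, ht, rfl⟩, htF⟩ := hy
    exact ⟨t, ht, htF⟩
  obtain ⟨t, ⟨htm, htF⟩, hmin⟩ := hT.exists_isLeast hne
  have h1 : a < t := lt_of_le_of_ne htm.1 (fun e => hx (by rw [e]; exact htF))
  have s1 : Icc a t ⊆ Icc a b := Icc_subset_Icc le_rfl htm.2
  refine ⟨γ t, htF, γ '' Icc a t, image_mono s1, of_Icc h1 (hc.mono s1) (hi.mono s1), ?_⟩
  ext z
  constructor
  · rintro ⟨⟨s, hs, rfl⟩, hsF⟩
    rw [le_antisymm hs.2 (hmin ⟨s1 hs, hsF⟩)]; rfl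
  · rintro rfl
    exact ⟨mem_image_of_mem _ (right_mem_Icc.2 h1.le), htF⟩

theorem segment {E : Type*} [NormedAddCommGroup E] [NormedSpace ℝ E] {u v : E} (h : u ≠ v) :
    IsArc (segment ℝ u v) u v := by
  refine ⟨0, 1, AffineMap.lineMap u v, one_pos, AffineMap.lineMap_continuous.continuousOn,
    (AffineMap.lineMap_injective ℝ h).injOn, by simp, by simp, ?_⟩
  rw [segment_eq_image_lineMap]

end IsArc

/-- `x` and `y` are joined by an arc in `M` (or are equal). -/
def ArcIn {S : Type*} [TopologicalSpace S] (M : Set S) (x y : S) : Prop :=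
  x = y ∨ ∃ A ⊆ M, IsArc A x y

theorem ArcIn.symm {S : Type*} [TopologicalSpace S] {M : Set S} {x y : S} (h : ArcIn M x y) :
    ArcIn M y x := by
  rcases h with rfl | ⟨A, hA, h⟩
  · exact Or.inl rfl
  · exact Or.inr ⟨A, hA, h.symm⟩

theorem ArcIn.trans {S : Type*} [TopologicalSpace S] [T2Space S] {M : Set S} {x y z : S}
    (h : ArcIn M x y) (h' : ArcIn M y z) : ArcIn M x z := by
  rcases h with rfl | ⟨A, hA, h⟩
  · exact h'
  rcases h' with rfl | ⟨B, hB, h'⟩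
  · exact Or.inr ⟨A, hA, h⟩
  by_cases hx : x ∈ B
  · by_cases hxz : x = z
    · exact Or.inl hxz
    obtain ⟨B₁, B₂, -, h2, h3, -⟩ := h'.split hx h.ne hxz
    exact Or.inr ⟨B₂, (h3 ▸ subset_union_right).trans hB, h2⟩
  · obtain ⟨w, hw, A₁, hA₁, hA₁', hi⟩ := h.first_hit h'.isClosed hx ⟨y, h.right_mem, h'.left_mem⟩
    by_cases hwz : w = z
    · exact Or.inr ⟨A₁, hA₁.trans hA, hwz ▸ hA₁'⟩
    by_cases hwy : w = y
    · exact Or.inr ⟨A₁ ∪ B, union_subset (hA₁.trans hA) hB, (hwy ▸ hA₁').trans h' (by rw [hi, hwy])⟩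
    obtain ⟨B₁, B₂, -, h2, h3, -⟩ := h'.split hw hwy hwz
    have hB₂ : B₂ ⊆ B := h3 ▸ subset_union_right
    exact Or.inr ⟨A₁ ∪ B₂, union_subset (hA₁.trans hA) (hB₂.trans hB), hA₁'.trans h2
      ((inter_subset_inter_right _ hB₂).trans hi.subset)⟩

theorem ArcIn.mono {S : Type*} [TopologicalSpace S] {M N : Set S} {x y : S}
    (h : ArcIn M x y) (hMN : M ⊆ N) : ArcIn N x y :=
  h.imp_right fun ⟨A, hA, h⟩ => ⟨A, hA.trans hMN, h⟩

theorem ArcIn.of_segment {E : Type*} [NormedAddCommGroup E] [NormedSpace ℝ E] {u v : E} {M : Set E}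
    (h : segment ℝ u v ⊆ M) : ArcIn M u v :=
  or_iff_not_imp_left.2 fun hne => ⟨_, h, IsArc.segment hne⟩

/-- Connected open-class induction: an equivalence relation with open classes on a preconnected
set is trivial. -/
theorem IsPreconnected.rel_of_open_classes {X : Type*} [TopologicalSpace X] {s : Set X}
    (hs : IsPreconnected s) (r : X → X → Prop)
    (htrans : ∀ x ∈ s, ∀ y ∈ s, ∀ z ∈ s, r x y → r y z → r x z)
    (hloc : ∀ x ∈ s, ∀ᶠ y in 𝓝[s] x, r x y ∧ r y x) {x y : X} (hx : x ∈ s) (hy : y ∈ s) :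
    r x y := by
  have := hs.induction₂ (fun x y => r x y ∧ r y x)
    (fun x hx => (hloc x hx).mono fun y h => h)
    (fun x y z hx hy hz h h' => ⟨htrans x hx y hy z hz h.1 h'.1, htrans z hz y hy x hx h'.2 h.2⟩)
    (fun x y _ _ h => ⟨h.2, h.1⟩) hx hy
  exact this.1

theorem arcIn_of_isOpen {E : Type*} [NormedAddCommGroup E] [NormedSpace ℝ E] {O : Set E}
    (hO : IsOpen O) (hc : IsPreconnected O) {u v : E} (hu : u ∈ O) (hv : v ∈ O) : ArcIn O u v := by
  refine hc.rel_of_open_classes (ArcIn O)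
    (fun x _ y _ z _ h h' => h.trans h') ?_ hu hv
  intro x hx
  obtain ⟨r, hr, hb⟩ := Metric.isOpen_iff.1 hO x hx
  filter_upwards [mem_nhdsWithin_of_mem_nhds (Metric.ball_mem_nhds x hr)] with y hy
  have : ArcIn O x y := ArcIn.of_segment
    (((convex_ball x r).segment_subset (Metric.mem_ball_self hr) hy).trans hb)
  exact ⟨this, this.symm⟩

/-- A simple closed curve, presented as a union of two arcs with common endpoints. -/
def IsLoop {S : Type*} [TopologicalSpace S] (J : Set S) : Prop :=
  ∃ x y A B, IsArc A x y ∧ IsArc B x y ∧ A ∩ B = {x, y} ∧ A ∪ B = J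

namespace IsLoop

variable {S S' : Type*} [TopologicalSpace S] [TopologicalSpace S'] {J : Set S} {p q : S}

theorem of_arcs {A B : Set S} (hA : IsArc A p q) (hB : IsArc B p q) (h : A ∩ B ⊆ {p, q}) :
    IsLoop (A ∪ B) := by
  refine ⟨p, q, A, B, hA, hB, h.antisymm ?_, rfl⟩
  rintro _ (rfl | rfl)
  exacts [⟨hA.left_mem, hB.left_mem⟩, ⟨hA.right_mem, hB.right_mem⟩]

theorem isCompact (h : IsLoop J) : IsCompact J := by
  obtain ⟨x, y, A, B, hA, hB, -, rfl⟩ := h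
  exact hA.isCompact.union hB.isCompact

theorem isClosed [T2Space S] (h : IsLoop J) : IsClosed J := h.isCompact.isClosed

theorem isPreconnected (h : IsLoop J) : IsPreconnected J := by
  obtain ⟨x, y, A, B, hA, hB, -, rfl⟩ := h
  exact hA.isPreconnected.union x hA.left_mem hB.left_mem hB.isPreconnected

theorem nonempty (h : IsLoop J) : J.Nonempty := by
  obtain ⟨x, y, A, B, hA, hB, -, rfl⟩ := h
  exact ⟨x, Or.inl hA.left_mem⟩

theorem image (h : IsLoop J) {f : S → S'} (hf : ContinuousOn f J) (hi : InjOn f J) :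
    IsLoop (f '' J) := by
  obtain ⟨x, y, A, B, hA, hB, h, rfl⟩ := h
  rw [image_union]
  refine of_arcs (hA.image (hf.mono subset_union_left) (hi.mono subset_union_left))
    (hB.image (hf.mono subset_union_right) (hi.mono subset_union_right)) ?_
  rw [← hi.image_inter subset_union_left subset_union_right, h, image_pair]

theorem recut {A B : Set S} {x y : S} (hA : IsArc A x y) (hB : IsArc B x y)
    (h : A ∩ B = {x, y}) (hq : q ∈ A) (hqx : q ≠ x) :
    ∃ A' B', IsArc A' x q ∧ IsArc B' x q ∧ A' ∩ B' = {x, q} ∧ A' ∪ B' = A ∪ B := by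
  by_cases hqy : q = y
  · exact ⟨A, B, hqy ▸ hA, hqy ▸ hB, hqy ▸ h, rfl⟩
  obtain ⟨A₁, A₂, h1, h2, h3, h4⟩ := hA.split hq hqx hqy
  have hsub : A₂ ⊆ A := h3 ▸ subset_union_right
  have hsub' : A₁ ⊆ A := h3 ▸ subset_union_left
  have hx : x ∉ A₂ := fun hx => hqx (h4.subset ⟨h1.left_mem, hx⟩).symm
  have hy : y ∉ A₁ := fun hy => hqy (h4.subset ⟨hy, h2.right_mem⟩).symm
  have hBA : B ∩ A₂ ⊆ {y} := by
    rintro z ⟨hz, hz'⟩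
    rcases h.subset ⟨hsub hz', hz⟩ with rfl | hzy
    · exact absurd hz' hx
    · exact hzy
  refine ⟨A₁, B ∪ A₂, h1, hB.trans h2.symm hBA, ?_, ?_⟩
  · apply Subset.antisymm
    · rintro z ⟨hz, hz' | hz'⟩
      · rcases h.subset ⟨hsub' hz, hz'⟩ with rfl | rfl
        · exact Or.inl rfl
        · exact absurd hz hy
      · exact Or.inr (h4.subset ⟨hz, hz'⟩)
    · rintro _ (rfl | rfl)
      exacts [⟨h1.left_mem, Or.inl hB.left_mem⟩, ⟨h1.right_mem, Or.inr h2.left_mem⟩]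
  · rw [← h3, union_comm B, union_assoc]

theorem cut (h : IsLoop J) (hp : p ∈ J) (hq : q ∈ J) (hpq : p ≠ q) :
    ∃ A B, IsArc A p q ∧ IsArc B p q ∧ A ∩ B = {p, q} ∧ A ∪ B = J := by
  obtain ⟨x, y, A, B, hA, hB, h, rfl⟩ := h
  have step : ∀ (x y p : S) (A B : Set S), IsArc A x y → IsArc B x y → A ∩ B = {x, y} →
      p ∈ A ∪ B → p ≠ x → ∃ A' B', IsArc A' p x ∧ IsArc B' p x ∧ A' ∩ B' = {p, x} ∧
        A' ∪ B' = A ∪ B := by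
    intro x y p A B hA hB h hp hne
    rcases hp with hp | hp
    · obtain ⟨A', B', h1, h2, h3, h4⟩ := recut hA hB h hp hne
      exact ⟨A', B', h1.symm, h2.symm, by rw [h3, pair_comm], h4⟩
    · obtain ⟨A', B', h1, h2, h3, h4⟩ := recut hB hA (by rw [inter_comm, h]) hp hne
      exact ⟨A', B', h1.symm, h2.symm, by rw [h3, pair_comm], by rw [h4, union_comm]⟩
  have key : ∃ z A' B', IsArc A' p z ∧ IsArc B' p z ∧ A' ∩ B' = {p, z} ∧ A' ∪ B' = A ∪ B := by
    by_cases hpx : p = x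
    · exact ⟨y, A, B, hpx ▸ hA, hpx ▸ hB, hpx ▸ h, rfl⟩
    · exact ⟨x, step x y p A B hA hB h hp hpx⟩
  obtain ⟨z, A', B', h1, h2, h3, h4⟩ := key
  rw [← h4] at hq
  obtain ⟨A'', B'', k1, k2, k3, k4⟩ := step p z q A' B' h1 h2 h3 hq hpq.symm
  exact ⟨A'', B'', k1.symm, k2.symm, by rw [k3, pair_comm], by rw [k4, h4]⟩

theorem exists_ne (h : IsLoop J) (p : S) : ∃ q ∈ J, q ≠ p := by
  obtain ⟨x, y, A, B, hA, hB, -, rfl⟩ := h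
  by_cases hx : x = p
  · exact ⟨y, Or.inl hA.right_mem, fun e => hA.ne (hx.trans e.symm)⟩
  · exact ⟨x, Or.inl hA.left_mem, hx⟩

/-- A loop is the union of a small arc around a given point and a complementary arc. -/
theorem exists_small_arc [T2Space S] (h : IsLoop J) (hp : p ∈ J) {V : Set S} (hV : V ∈ 𝓝 p) :
    ∃ s t Γ Γ', IsArc Γ s t ∧ IsArc Γ' s t ∧ Γ ∩ Γ' = {s, t} ∧ Γ ∪ Γ' = J ∧ p ∈ Γ ∧ p ≠ s ∧
      p ≠ t ∧ Γ ⊆ V := by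
  obtain ⟨q, hq, hqp⟩ := h.exists_ne p
  obtain ⟨A, B, hA, hB, h3, h4⟩ := h.cut hp hq hqp.symm
  have key : ∀ A, IsArc A p q → ∃ z ∈ A, z ≠ p ∧ z ≠ q ∧ ∃ A₁ A₂, IsArc A₁ p z ∧ IsArc A₂ z q ∧
      A₁ ∪ A₂ = A ∧ A₁ ∩ A₂ = {z} ∧ A₁ ⊆ V := by
    intro A hA
    obtain ⟨V', hV', h'⟩ := hA.shrink hV
    obtain ⟨z, hz, hzA, hz'⟩ := mem_closure_iff_nhds.1 (hA.subset_closure_interior hA.left_mem) V' hV'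
    have hzp : z ≠ p := fun e => hz' (Or.inl e)
    obtain ⟨h1, h2⟩ := h' z ⟨hzA, hz⟩ hzp
    exact ⟨z, hzA, hzp, h1, h2⟩
  obtain ⟨s, hsA, hsp, hsq, A₁, A₂, a1, a2, a3, a4, a5⟩ := key A hA
  obtain ⟨t, htB, htp, htq, B₁, B₂, b1, b2, b3, b4, b5⟩ := key B hB
  have hA₁ : A₁ ⊆ A := a3 ▸ subset_union_left
  have hA₂ : A₂ ⊆ A := a3 ▸ subset_union_right
  have hB₁ : B₁ ⊆ B := b3 ▸ subset_union_left
  have hB₂ : B₂ ⊆ B := b3 ▸ subset_union_right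
  have hpA : p ∉ A₂ := fun hh => hsp (a4.subset ⟨a1.left_mem, hh⟩).symm
  have hpB : p ∉ B₂ := fun hh => htp (b4.subset ⟨b1.left_mem, hh⟩).symm
  have hqA : q ∉ A₁ := fun hh => hsq (a4.subset ⟨hh, a2.right_mem⟩).symm
  have hqB : q ∉ B₁ := fun hh => htq (b4.subset ⟨hh, b2.right_mem⟩).symm
  refine ⟨s, t, A₁ ∪ B₁, A₂ ∪ B₂, a1.symm.trans b1 ?_, a2.trans b2.symm ?_, ?_, ?_,
    Or.inl a1.left_mem, hsp.symm, htp.symm, union_subset a5 b5⟩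
  · rintro z ⟨hz, hz'⟩
    rcases h3.subset ⟨hA₁ hz, hB₁ hz'⟩ with rfl | rfl
    exacts [rfl, absurd hz hqA]
  · rintro z ⟨hz, hz'⟩
    rcases h3.subset ⟨hA₂ hz, hB₂ hz'⟩ with rfl | rfl
    exacts [absurd hz hpA, rfl]
  · apply Subset.antisymm
    · rintro z ⟨hz | hz, hz' | hz'⟩
      · exact Or.inl (a4.subset ⟨hz, hz'⟩)
      · rcases h3.subset ⟨hA₁ hz, hB₂ hz'⟩ with rfl | rfl
        exacts [absurd hz' hpB, absurd hz hqA]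
      · rcases h3.subset ⟨hA₂ hz', hB₁ hz⟩ with rfl | rfl
        exacts [absurd hz' hpA, absurd hz hqB]
      · exact Or.inr (b4.subset ⟨hz, hz'⟩)
    · rintro _ (rfl | rfl)
      exacts [⟨Or.inl a1.right_mem, Or.inl a2.left_mem⟩, ⟨Or.inr b1.right_mem, Or.inr b2.left_mem⟩]
  · rw [union_union_union_comm, a3, b3, h4]

/-- A proper closed subset of a loop is contained in an arc of the loop. -/
theorem exists_arc_of_ssubset [T2Space S] (h : IsLoop J) {F : Set S} (hF : IsClosed F)
    (hFJ : F ⊂ J) : ∃ s t A, IsArc A s t ∧ F ⊆ A ∧ A ⊆ J := by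
  obtain ⟨p, hp, hpF⟩ := exists_of_ssubset hFJ
  obtain ⟨s, t, Γ, Γ', -, h2, -, h4, -, -, -, h8⟩ := h.exists_small_arc hp (hF.isOpen_compl.mem_nhds hpF)
  refine ⟨s, t, Γ', h2, fun z hz => ?_, h4 ▸ subset_union_right⟩
  rcases h4.superset (hFJ.1 hz) with h | h
  · exact absurd hz (h8 h)
  · exact h

theorem isSimpleClosedCurve [T2Space S] (h : IsLoop J) : IsSimpleClosedCurve J := by
  obtain ⟨x, y, A, B, hA, hB, h, rfl⟩ := h
  obtain ⟨γ, hc, hi, rfl, rfl, rfl⟩ := hA.exists_unit (-1) 1 (by norm_num)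
  obtain ⟨δ, hc', hi', h0, h1, rfl⟩ := hB.exists_unit (-1) 1 (by norm_num)
  have hcirc : ∀ p : ↥Circ, p.1.1 ^ 2 + p.1.2 ^ 2 = 1 := fun p => p.2
  have hm : ∀ p : ↥Circ, p.1.1 ∈ Icc (-1 : ℝ) 1 := fun p =>
    ⟨by nlinarith [hcirc p, sq_nonneg p.1.2], by nlinarith [hcirc p, sq_nonneg p.1.2]⟩
  have hcomp : CompactSpace ↥Circ := by
    rw [← isCompact_iff_compactSpace]
    refine (isCompact_Icc (a := ((-1 : ℝ), (-1 : ℝ))) (b := (1, 1))).of_isClosed_subset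
      (isClosed_eq (by fun_prop) (by fun_prop)) ?_
    rintro p (hp : p.1 ^ 2 + p.2 ^ 2 = 1)
    refine ⟨⟨?_, ?_⟩, ⟨?_, ?_⟩⟩ <;> simp only <;> nlinarith [sq_nonneg p.1, sq_nonneg p.2]
  let f : ↥Circ → S := fun p => if 0 ≤ p.1.2 then γ p.1.1 else δ p.1.1
  have hzero : ∀ p : ↥Circ, p.1.2 = 0 → γ p.1.1 = δ p.1.1 := by
    intro p hp
    have := hcirc p
    have h2 : (p.1.1 - 1) * (p.1.1 + 1) = 0 := by rw [hp] at this; linarith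
    rcases mul_eq_zero.1 h2 with h2 | h2
    · rw [show p.1.1 = 1 by linarith, h1]
    · rw [show p.1.1 = -1 by linarith, h0]
  have e1 : EqOn f (fun p => γ p.1.1) {p | 0 ≤ p.1.2} := fun p hp => if_pos hp
  have e2 : EqOn f (fun p => δ p.1.1) {p | p.1.2 ≤ 0} := by
    intro p (hp : p.1.2 ≤ 0)
    rcases hp.eq_or_lt with hp | hp
    · simp only [f, hp, le_refl, if_true]; exact hzero p hp
    · exact if_neg (not_le.2 hp)
  have hcont : Continuous f := by
    rw [← continuousOn_univ]
    have : (univ : Set ↥Circ) = {p | 0 ≤ p.1.2} ∪ {p | p.1.2 ≤ 0} :=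
      (eq_univ_of_forall fun p : ↥Circ => (le_total 0 p.1.2 : _ ∨ _)).symm
    rw [this]
    have hfst : Continuous fun p : ↥Circ => p.1.1 := continuous_fst.comp continuous_subtype_val
    have hsnd : Continuous fun p : ↥Circ => p.1.2 := continuous_snd.comp continuous_subtype_val
    refine ContinuousOn.union_of_isClosed
      (((hc.comp hfst.continuousOn fun p _ => hm p)).congr e1)
      (((hc'.comp hfst.continuousOn fun p _ => hm p)).congr e2)
      (isClosed_le continuous_const hsnd) (isClosed_le hsnd continuous_const)
  have hend : ∀ s ∈ Icc (-1 : ℝ) 1, ∀ t ∈ Icc (-1 : ℝ) 1, γ s = δ t → s = t ∧ (s = -1 ∨ s = 1) := by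
    intro s hs t ht hst
    rcases h.subset ⟨mem_image_of_mem _ hs, hst ▸ mem_image_of_mem _ ht⟩ with h2 | h2
    · have h3 := hi hs (by norm_num) h2
      have h4 := hi' ht (show (-1 : ℝ) ∈ Icc (-1 : ℝ) 1 by norm_num) (by rw [h0, ← hst, h2])
      exact ⟨by linarith, Or.inl h3⟩
    · have h3 := hi hs (by norm_num) h2
      have h4 := hi' ht (show (1 : ℝ) ∈ Icc (-1 : ℝ) 1 by norm_num) (by rw [h1, ← hst, h2])
      exact ⟨by linarith, Or.inr h3⟩
  have hext : ∀ p q : ↥Circ, p.1.1 = q.1.1 → p.1.2 = q.1.2 → p = q := fun p q h h' =>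
    Subtype.ext (Prod.ext h h')
  have hmix : ∀ p q : ↥Circ, 0 ≤ p.1.2 → q.1.2 ≤ 0 → γ p.1.1 = δ q.1.1 → p = q := by
    intro p q hp hq hpq
    obtain ⟨k1, k2⟩ := hend _ (hm p) _ (hm q) hpq
    have k3 : p.1.1 ^ 2 = 1 := by rcases k2 with k2 | k2 <;> rw [k2] <;> norm_num
    have k4 : p.1.2 = 0 := by have := hcirc p; nlinarith
    have k5 : q.1.2 = 0 := by have := hcirc q; rw [← k1] at this; nlinarith
    exact hext p q k1 (by rw [k4, k5])
  have hinj : Function.Injective f := by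
    intro p q hpq
    rcases le_total 0 p.1.2 with hp | hp <;> rcases le_total 0 q.1.2 with hq | hq
    · rw [e1 hp, e1 hq] at hpq
      have k := hi (hm p) (hm q) hpq
      have a := hcirc p
      have b := hcirc q
      rw [k] at a
      exact hext p q k (by nlinarith)
    · rw [e1 hp, e2 hq] at hpq; exact hmix p q hp hq hpq
    · rw [e2 hp, e1 hq] at hpq; exact (hmix q p hq hp hpq.symm).symm
    · rw [e2 hp, e2 hq] at hpq
      have k := hi' (hm p) (hm q) hpq
      have a := hcirc p
      have b := hcirc q
      rw [k] at a
      exact hext p q k (by nlinarith)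
  refine ⟨f, (hcont.isClosedEmbedding hinj).isEmbedding, ?_⟩
  have hs : ∀ t ∈ Icc (-1 : ℝ) 1, 0 ≤ 1 - t ^ 2 := fun t ht => by nlinarith [ht.1, ht.2]
  apply Subset.antisymm
  · rintro _ ⟨p, rfl⟩
    rcases le_total 0 p.1.2 with hp | hp
    · rw [e1 hp]; exact Or.inl (mem_image_of_mem _ (hm p))
    · rw [e2 hp]; exact Or.inr (mem_image_of_mem _ (hm p))
  · rintro _ (⟨t, ht, rfl⟩ | ⟨t, ht, rfl⟩)
    · refine ⟨⟨(t, √(1 - t ^ 2)), ?_⟩, e1 (Real.sqrt_nonneg _)⟩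
      change t ^ 2 + √(1 - t ^ 2) ^ 2 = 1
      rw [Real.sq_sqrt (hs t ht)]; ring
    · refine ⟨⟨(t, -√(1 - t ^ 2)), ?_⟩, e2 (neg_nonpos.2 (Real.sqrt_nonneg _))⟩
      change t ^ 2 + (-√(1 - t ^ 2)) ^ 2 = 1
      rw [neg_sq, Real.sq_sqrt (hs t ht)]; ring

end IsLoop

/-- `f` admits a continuous logarithm on `X`. -/
def HasLog {T : Type*} [TopologicalSpace T] (f : T → ℂ) (X : Set T) : Prop :=
  ∃ g : T → ℂ, ContinuousOn g X ∧ ∀ z ∈ X, Complex.exp (g z) = f z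

namespace HasLog

variable {T : Type*} [TopologicalSpace T] {f g : T → ℂ} {X Y : Set T}

theorem mul (hf : HasLog f X) (hg : HasLog g X) : HasLog (fun z => f z * g z) X := by
  obtain ⟨a, ha, ha'⟩ := hf
  obtain ⟨b, hb, hb'⟩ := hg
  exact ⟨fun z => a z + b z, ha.add hb, fun z hz => by rw [Complex.exp_add, ha' z hz, hb' z hz]⟩

theorem zpow (hf : HasLog f X) (n : ℤ) : HasLog (fun z => f z ^ n) X := by
  obtain ⟨a, ha, ha'⟩ := hf
  exact ⟨fun z => n * a z, continuousOn_const.mul ha, fun z hz => by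
    rw [Complex.exp_int_mul, ha' z hz]⟩

theorem congr (hf : HasLog f X) (h : EqOn g f X) : HasLog g X := by
  obtain ⟨a, ha, ha'⟩ := hf
  exact ⟨a, ha, fun z hz => by rw [ha' z hz, h hz]⟩

theorem mono (hf : HasLog f X) (h : Y ⊆ X) : HasLog f Y := by
  obtain ⟨a, ha, ha'⟩ := hf
  exact ⟨a, ha.mono h, fun z hz => ha' z (h hz)⟩

theorem of_slitPlane (hf : ContinuousOn f X) (h : ∀ z ∈ X, f z ∈ Complex.slitPlane) :
    HasLog f X :=
  ⟨fun z => Complex.log (f z), hf.clog h, fun z hz =>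
    Complex.exp_log (Complex.slitPlane_ne_zero (h z hz))⟩

theorem of_simplyConnected [SimplyConnectedSpace T] [LocallyPathConnectedSpace T]
    (hf : Continuous f) (h0 : ∀ z, f z ≠ 0) : HasLog f univ := by
  obtain ⟨t⟩ : Nonempty T := inferInstance
  obtain ⟨F, ⟨-, hF⟩, -⟩ := Complex.isCoveringMap_exp.existsUnique_continuousMap_lifts
    (⟨fun t => ⟨f t, h0 t⟩, by fun_prop⟩ : C(T, {z : ℂ // z ≠ 0})) t (Complex.log (f t))
    (Subtype.ext (Complex.exp_log (h0 t)))
  exact ⟨F, F.continuous.continuousOn, fun z _ => congrArg Subtype.val (congrFun hF z)⟩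

theorem of_Icc {f : ℝ → ℂ} {a b : ℝ} (hab : a ≤ b) (hf : ContinuousOn f (Icc a b))
    (h0 : ∀ t ∈ Icc a b, f t ≠ 0) : HasLog f (Icc a b) := by
  have h1 : Continuous (IccExtend hab ((Icc a b).domRestrict f)) :=
    (continuousOn_iff_continuous_domRestrict.1 hf).Icc_extend'
  refine ((of_simplyConnected h1 fun t => h0 _ (projIcc a b hab t).2).mono (subset_univ _)).congr ?_
  intro t ht
  rw [IccExtend_of_mem _ _ ht]; rfl

end HasLog

/-- A continuous function with constant exponential on a preconnected set is constant. -/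
theorem eq_of_exp_eq {T : Type*} [TopologicalSpace T] {s : Set T} (hs : IsPreconnected s)
    {φ : T → ℂ} (hφ : ContinuousOn φ s) {c : ℂ} (h : ∀ t ∈ s, Complex.exp (φ t) = c) {x y : T}
    (hx : x ∈ s) (hy : y ∈ s) : φ x = φ y := by
  refine hs.rel_of_open_classes (fun x y => φ x = φ y) (fun _ _ _ _ _ _ => Eq.trans) ?_ hx hy
  intro x hx
  filter_upwards [hφ x hx (Metric.ball_mem_nhds (φ x) Real.two_pi_pos), self_mem_nhdsWithin]
    with y hy hys
  have : φ x = φ y := by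
    obtain ⟨n, hn⟩ := Complex.exp_eq_exp_iff_exists_int.1 ((h y hys).trans (h x hx).symm)
    have h1 : ‖(n : ℂ) * (2 * Real.pi * Complex.I)‖ < 2 * Real.pi := by
      have : dist (φ y) (φ x) < 2 * Real.pi := hy
      rwa [hn, dist_eq_norm, add_sub_cancel_left] at this
    rw [norm_mul, norm_mul, Complex.norm_I, mul_one, Complex.norm_intCast, norm_mul,
      Complex.norm_real, Real.norm_of_nonneg Real.pi_pos.le, Complex.norm_ofNat] at h1
    have h2 : |(n : ℝ)| < 1 := by
      by_contra! hh
      nlinarith [Real.pi_pos]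
    have h3 : n = 0 := by
      rw [← Int.abs_lt_one_iff]; exact_mod_cast h2
    rw [hn, h3]; simp
  exact ⟨this, this.symm⟩

/-- If `p` and `q` are in the same component of the complement of `X`, then `(z - p) / (z - q)`
has a logarithm on `X`. -/
theorem hasLog_div {X C : Set ℂ} (hX : IsClosed X) (hC : IsPreconnected C) (hCX : Disjoint C X)
    {p q : ℂ} (hp : p ∈ C) (hq : q ∈ C) : HasLog (fun z => (z - p) / (z - q)) X := by
  have hne : ∀ p ∈ C, ∀ z ∈ X, z - p ≠ 0 := fun p hp z hz e =>
    hCX.ne_of_mem hp hz (sub_eq_zero.1 e).symm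
  refine hC.rel_of_open_classes (fun p q => HasLog (fun z => (z - p) / (z - q)) X) ?_ ?_ hp hq
  · intro p hp q hq r hr h h'
    refine (h.mul h').congr fun z hz => ?_
    have := hne q hq z hz
    have := hne r hr z hz
    simp only
    field_simp
  · intro p hp
    obtain ⟨r, hr, hb⟩ := Metric.isOpen_iff.1 hX.isOpen_compl p (disjoint_left.1 hCX hp)
    filter_upwards [mem_nhdsWithin_of_mem_nhds (Metric.ball_mem_nhds p hr), self_mem_nhdsWithin]
      with q hq hqC
    have h1 : HasLog (fun z => (z - q) / (z - p)) X := by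
      refine HasLog.of_slitPlane (ContinuousOn.div (by fun_prop) (by fun_prop) (hne p hp)) ?_
      intro z hz
      have h2 : r ≤ ‖z - p‖ := by
        by_contra! hh
        exact hb (show z ∈ Metric.ball p r by rwa [Metric.mem_ball, dist_eq_norm]) hz
      have h3 : (z - q) / (z - p) = 1 + (p - q) / (z - p) := by
        have := hne p hp z hz
        field_simp; ring
      rw [h3]
      refine Complex.mem_slitPlane_of_norm_lt_one ?_
      rw [norm_div, div_lt_one (hr.trans_le h2), ← dist_eq_norm, dist_comm]
      exact (Metric.mem_ball.1 hq).trans_le h2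
    refine ⟨(h1.zpow (-1)).congr fun z _ => ?_, h1⟩
    simp

/-- The winding number obstruction. -/
theorem not_hasLog_of_frontier {X W : Set ℂ} (hX : IsClosed X) (hW : IsOpen W)
    (hWb : Bornology.IsBounded W) (hfr : frontier W ⊆ X) {p : ℂ} (hp : p ∈ W) {k : ℤ} (hk : k ≠ 0)
    {h : ℂ → ℂ} (hh : ContinuousOn h (closure W)) (h0 : ∀ z ∈ closure W, h z ≠ 0) :
    ¬ HasLog (fun z => (z - p) ^ k * h z) X := by
  classical
  rintro ⟨g, hg, hg'⟩
  obtain ⟨G, hG⟩ := ContinuousMap.exists_restrict_eq hX ⟨X.domRestrict g, continuousOn_iff_continuous_domRestrict.1 hg⟩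
  have hGg : ∀ z ∈ X, G z = g z := fun z hz => DFunLike.congr_fun hG (⟨z, hz⟩ : X)
  let F : ℂ → ℂ := fun z => if z ∈ closure W then Complex.exp (G z) / h z else (z - p) ^ k
  have e1 : EqOn F (fun z => Complex.exp (G z) / h z) (closure W) := fun z hz => if_pos hz
  have e2 : EqOn F (fun z => (z - p) ^ k) Wᶜ := by
    intro z hz
    by_cases hzc : z ∈ closure W
    · have hzX : z ∈ X := hfr (by rw [hW.frontier_eq]; exact ⟨hzc, hz⟩)
      rw [e1 hzc]
      simp only
      rw [hGg z hzX, hg' z hzX, mul_div_cancel_right₀ _ (h0 z hzc)]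
    · exact if_neg hzc
  have hne : ∀ z ∈ Wᶜ, z - p ≠ 0 := fun z hz e => hz (by rwa [sub_eq_zero.1 e])
  have hF : Continuous F := by
    rw [← continuousOn_univ, ← univ_subset_iff.1 (show univ ⊆ closure W ∪ Wᶜ from
      fun z _ => (em (z ∈ W)).imp (fun h => subset_closure h) id)]
    refine ContinuousOn.union_of_isClosed (ContinuousOn.congr ?_ e1) (ContinuousOn.congr ?_ e2)
      isClosed_closure hW.isClosed_compl
    · exact (by fun_prop : Continuous fun z => Complex.exp (G z)).continuousOn.div hh h0
    · exact ContinuousOn.zpow₀ (by fun_prop) k fun z hz => Or.inl (hne z hz)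
  have hF0 : ∀ z, F z ≠ 0 := by
    intro z
    by_cases hz : z ∈ W
    · rw [e1 (subset_closure hz)]
      exact div_ne_zero (Complex.exp_ne_zero _) (h0 z (subset_closure hz))
    · rw [e2 hz]
      exact zpow_ne_zero _ (hne z hz)
  obtain ⟨L, hL, hL'⟩ := HasLog.of_simplyConnected hF hF0
  rw [continuousOn_univ] at hL
  obtain ⟨R, hR, hWR⟩ := hWb.subset_ball_lt 0 p
  have hc : ∀ t : ℝ, p + R * Complex.exp (t * Complex.I) ∈ Wᶜ := by
    intro t ht
    have := hWR ht
    rw [Metric.mem_ball, dist_eq_norm, add_sub_cancel_left, norm_mul, Complex.norm_exp_ofReal_mul_I,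
      mul_one, Complex.norm_real, Real.norm_of_nonneg hR.le] at this
    exact lt_irrefl _ this
  have key := eq_of_exp_eq (s := (univ : Set ℝ)) isPreconnected_univ
    (φ := fun t : ℝ => L (p + R * Complex.exp (t * Complex.I)) - k * (t * Complex.I))
    (c := (R : ℂ) ^ k) (by fun_prop) (fun t _ => ?_) (mem_univ 0) (mem_univ (2 * Real.pi))
  · simp only [Complex.ofReal_zero, zero_mul, Complex.exp_zero, mul_zero, sub_zero] at key
    rw [show Complex.exp (((2 * Real.pi : ℝ) : ℂ) * Complex.I) = 1 by
      rw [Complex.exp_eq_one_iff]; exact ⟨1, by push_cast; ring⟩] at key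
    have : (k : ℂ) * (((2 * Real.pi : ℝ) : ℂ) * Complex.I) = 0 := by linear_combination key
    simp [hk, Real.pi_ne_zero] at this
  · rw [Complex.exp_sub, hL' _ (mem_univ _), e2 (hc t), Complex.exp_int_mul]
    simp only [add_sub_cancel_left, mul_zpow]
    have := zpow_ne_zero k (Complex.exp_ne_zero (t * Complex.I))
    field_simp

theorem isPreconnected_norm_gt (R : ℝ) (hR : 0 < R) : IsPreconnected {z : ℂ | R < ‖z‖} := by
  have : {z : ℂ | R < ‖z‖} =
      (fun q : ℝ × ℝ => (q.1 : ℂ) * Complex.exp (q.2 * Complex.I)) '' (Ioi R ×ˢ univ) := by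
    ext z
    constructor
    · intro hz
      exact ⟨(‖z‖, z.arg), ⟨hz, mem_univ _⟩, by simp⟩
    · rintro ⟨⟨r, t⟩, ⟨hr, -⟩, rfl⟩
      have hr : R < r := hr
      simp only [mem_ofPred_eq, norm_mul, Complex.norm_exp_ofReal_mul_I, mul_one, Complex.norm_real]
      rwa [Real.norm_of_nonneg (hR.trans hr).le]
  rw [this]
  exact (isPreconnected_Ioi.prod isPreconnected_univ).image _ (by fun_prop)

theorem frontier_connectedComponentIn_subset {T : Type*} [TopologicalSpace T]
    [LocallyConnectedSpace T] {X : Set T} (hX : IsClosed X) (x : T) :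
    frontier (connectedComponentIn Xᶜ x) ⊆ X := by
  intro z hz
  by_contra hzX
  rw [(hX.isOpen_compl.connectedComponentIn).frontier_eq] at hz
  obtain ⟨w, hw, hw'⟩ := mem_closure_iff.1 hz.1 _ hX.isOpen_compl.connectedComponentIn
    (mem_connectedComponentIn (F := Xᶜ) hzX)
  have h1 := connectedComponentIn_eq hw
  have h2 := connectedComponentIn_eq hw'
  rw [h2, ← h1] at hz
  exact hz.2 (mem_connectedComponentIn hzX)

/-- Two different components of the complement of a compact plane set are not both unbounded. -/
theorem bounded_or_bounded {X : Set ℂ} (hX : IsCompact X) {u v : ℂ}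
    (h : connectedComponentIn Xᶜ u ≠ connectedComponentIn Xᶜ v) :
    Bornology.IsBounded (connectedComponentIn Xᶜ u) ∨
      Bornology.IsBounded (connectedComponentIn Xᶜ v) := by
  by_contra! hh
  obtain ⟨R, hR, hXR⟩ := hX.isBounded.subset_closedBall_lt 0 0
  have hsub : {z : ℂ | R < ‖z‖} ⊆ Xᶜ := fun z hz hzX => by
    have := hXR hzX
    rw [mem_closedBall_zero_iff] at this
    exact absurd hz (not_lt.2 this)
  have key : ∀ C : Set ℂ, ¬ Bornology.IsBounded C → ∃ z ∈ C, R < ‖z‖ := by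
    intro C hC
    by_contra! h2
    exact hC (Metric.isBounded_closedBall.subset fun z hz => mem_closedBall_zero_iff.2 (h2 z hz))
  obtain ⟨a, ha, ha'⟩ := key _ hh.1
  obtain ⟨b, hb, hb'⟩ := key _ hh.2
  have h3 := (isPreconnected_norm_gt R hR).subset_connectedComponentIn (x := a) ha' hsub
  apply h
  rw [connectedComponentIn_eq ha, connectedComponentIn_eq hb, connectedComponentIn_eq (h3 hb')]

/-- A nonvanishing function has a logarithm on an arc. -/
theorem HasLog.of_arc {T : Type*} [TopologicalSpace T] [T2Space T] {A : Set T} {x y : T}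
    (hA : IsArc A x y) {f : T → ℂ} (hf : ContinuousOn f A) (h0 : ∀ z ∈ A, f z ≠ 0) :
    HasLog f A := by
  obtain ⟨a, b, γ, hab, hc, hi, rfl, rfl, rfl⟩ := hA
  obtain ⟨g, hg, hg'⟩ := HasLog.of_Icc hab.le (f := fun t => f (γ t))
    (hf.comp hc (mapsTo_image _ _)) (fun t ht => h0 _ (mem_image_of_mem _ ht))
  have hl : ∀ z ∈ γ '' Icc a b, Function.invFunOn γ (Icc a b) z ∈ Icc a b ∧
      γ (Function.invFunOn γ (Icc a b) z) = z := fun z hz =>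
    ⟨Function.invFunOn_mem hz, Function.invFunOn_eq hz⟩
  have hinv : ContinuousOn (Function.invFunOn γ (Icc a b)) (γ '' Icc a b) := by
    have h2 : IsEmbedding ((Icc a b).domRestrict γ) :=
      ((continuousOn_iff_continuous_domRestrict.1 hc).isClosedEmbedding
        (injOn_iff_injective.1 hi)).isEmbedding
    rw [continuousOn_iff_continuous_domRestrict]
    let ψ : γ '' Icc a b → Icc a b := fun z => ⟨_, (hl z z.2).1⟩
    have hψ : Continuous ψ := by
      rw [h2.continuous_iff]
      convert continuous_subtype_val using 1
      funext z
      exact (hl z z.2).2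
    exact continuous_subtype_val.comp hψ
  refine ⟨fun z => g (Function.invFunOn γ (Icc a b) z), hg.comp hinv fun z hz => (hl z hz).1, ?_⟩
  intro z hz
  rw [hg' _ (hl z hz).1]
  exact congrArg f (hl z hz).2

/-- An arc does not separate the plane. -/
theorem IsArc.isPreconnected_compl {A : Set ℂ} {x y : ℂ} (hA : IsArc A x y) :
    IsPreconnected Aᶜ := by
  have hlog : ∀ p ∉ A, HasLog (fun z => z - p) A := fun p hp =>
    HasLog.of_arc hA (by fun_prop) fun z hz e => hp (by rwa [← sub_eq_zero.1 e])
  by_contra hnc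
  have : ∃ u ∈ Aᶜ, ∃ v ∈ Aᶜ, connectedComponentIn Aᶜ u ≠ connectedComponentIn Aᶜ v := by
    by_contra! h
    apply hnc
    refine isPreconnected_of_forall_pair fun u hu v hv => ?_
    refine ⟨connectedComponentIn Aᶜ u, connectedComponentIn_subset _ _, mem_connectedComponentIn hu,
      ?_, isPreconnected_connectedComponentIn⟩
    rw [h u hu v hv]; exact mem_connectedComponentIn hv
  obtain ⟨u, hu, v, hv, huv⟩ := this
  have key : ∀ u ∈ Aᶜ, ¬ Bornology.IsBounded (connectedComponentIn Aᶜ u) := by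
    intro u hu hb
    refine not_hasLog_of_frontier hA.isClosed hA.isClosed.isOpen_compl.connectedComponentIn hb
      (frontier_connectedComponentIn_subset hA.isClosed u) (mem_connectedComponentIn hu)
      one_ne_zero (h := fun _ => 1) continuousOn_const (fun _ _ => one_ne_zero) ?_
    exact (hlog u hu).congr fun z _ => by simp
  rcases bounded_or_bounded hA.isCompact huv with h | h
  exacts [key u hu h, key v hv h]

theorem HasLog.union {T : Type*} [TopologicalSpace T] {f g₁ g₂ : T → ℂ} {X₁ X₂ : Set T} {c : ℂ}
    (h₁ : IsClosed X₁) (h₂ : IsClosed X₂) (hg₁ : ContinuousOn g₁ X₁) (hg₂ : ContinuousOn g₂ X₂)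
    (he₁ : ∀ z ∈ X₁, Complex.exp (g₁ z) = f z) (he₂ : ∀ z ∈ X₂, Complex.exp (g₂ z) = f z)
    (hne : (X₁ ∩ X₂).Nonempty) (hc : ∀ z ∈ X₁ ∩ X₂, g₁ z - g₂ z = c) : HasLog f (X₁ ∪ X₂) := by
  classical
  have hc1 : Complex.exp c = 1 := by
    obtain ⟨z, hz⟩ := hne
    rw [← hc z hz, Complex.exp_sub, he₁ z hz.1, he₂ z hz.2, div_self]
    rw [← he₁ z hz.1]; exact Complex.exp_ne_zero _
  let g : T → ℂ := fun z => if z ∈ X₁ then g₁ z - c else g₂ z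
  have e1 : EqOn g (fun z => g₁ z - c) X₁ := fun z hz => if_pos hz
  have e2 : EqOn g g₂ X₂ := fun z hz => by
    by_cases hz1 : z ∈ X₁
    · rw [e1 hz1]; simp only; rw [← hc z ⟨hz1, hz⟩]; ring
    · exact if_neg hz1
  refine ⟨g, ContinuousOn.union_of_isClosed ((hg₁.sub continuousOn_const).congr e1) (hg₂.congr e2)
    h₁ h₂, ?_⟩
  rintro z (hz | hz)
  · rw [e1 hz, Complex.exp_sub, hc1, div_one, he₁ z hz]
  · rw [e2 hz, he₂ z hz]

/-- Near an interior point, an arc in the plane has at most two sides. -/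
theorem no_three_sides {Γ : Set ℂ} {s t y : ℂ} (hΓ : IsArc Γ s t) (hy : y ∈ Γ) (hys : y ≠ s)
    (hyt : y ≠ t) {U : Set ℂ} (hU : U ∈ 𝓝 y) {V : Fin 3 → Set ℂ} (hV : ∀ i, IsOpen (V i))
    (hVy : ∀ i, y ∈ closure (V i)) (hVd : Pairwise fun i j => Disjoint (V i) (V j))
    (hVΓ : ∀ i, Disjoint (V i) Γ) (hUV : U \ Γ ⊆ ⋃ i, V i) : False := by
  obtain ⟨r, hr, hb⟩ := Metric.nhds_basis_closedBall.mem_iff.1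
    (Filter.inter_mem hU (Filter.inter_mem (isOpen_ne.mem_nhds hys) (isOpen_ne.mem_nhds hyt)))
  obtain ⟨A₁, A₂, h1, h2, h3, h4⟩ := hΓ.split hy hys hyt
  have key : ∀ A u, IsArc A y u → ∃ z A' A'', IsArc A' y z ∧ IsArc A'' z u ∧ A' ∪ A'' = A ∧
      A' ∩ A'' = {z} ∧ A' ⊆ Metric.ball y r ∧ z ≠ y := by
    intro A u hA
    obtain ⟨V', hV', h'⟩ := hA.shrink (Metric.ball_mem_nhds y hr)
    obtain ⟨z, hz, hzA, hz'⟩ := mem_closure_iff_nhds.1 (hA.subset_closure_interior hA.left_mem) V' hV'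
    have hzp : z ≠ y := fun e => hz' (Or.inl e)
    obtain ⟨-, B, C, k1, k2, k3, k4, k5⟩ := h' z ⟨hzA, hz⟩ hzp
    exact ⟨z, B, C, k1, k2, k3, k4, k5, hzp⟩
  obtain ⟨z₁, A₁₁, A₁₂, a1, a2, a3, a4, a5, a6⟩ := key A₁ s h1.symm
  obtain ⟨z₂, A₂₁, A₂₂, b1, b2, b3, b4, b5, b6⟩ := key A₂ t h2
  have hA₁₁ : A₁₁ ⊆ A₁ := a3 ▸ subset_union_left
  have hA₁₂ : A₁₂ ⊆ A₁ := a3 ▸ subset_union_right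
  have hA₂₁ : A₂₁ ⊆ A₂ := b3 ▸ subset_union_left
  have hA₂₂ : A₂₂ ⊆ A₂ := b3 ▸ subset_union_right
  have hy₁ : y ∉ A₁₂ := fun h => a6 (a4.subset ⟨a1.left_mem, h⟩).symm
  have hy₂ : y ∉ A₂₂ := fun h => b6 (b4.subset ⟨b1.left_mem, h⟩).symm
  set X₁ := A₁₁ ∪ A₂₁ with hX₁
  set X₂ := A₁₂ ∪ A₂₂ ∪ Metric.sphere y r with hX₂
  have hX₁a : IsArc X₁ z₁ z₂ := a1.symm.trans b1
    fun z hz => h4.subset ⟨hA₁₁ hz.1, hA₂₁ hz.2⟩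
  have hX₁c : IsClosed X₁ := hX₁a.isClosed
  have hX₂c : IsClosed X₂ := (a2.isClosed.union b2.isClosed).union Metric.isClosed_sphere
  have hX₁b : X₁ ⊆ Metric.ball y r := union_subset a5 b5
  have hyX₂ : y ∉ X₂ := by
    rintro ((h | h) | h)
    · exact hy₁ h
    · exact hy₂ h
    · rw [mem_sphere_iff_norm, sub_self, norm_zero] at h; exact hr.ne h
  have hX₁Γ : X₁ ⊆ Γ := h3 ▸ union_subset_union hA₁₁ hA₂₁
  have hΓX : Γ ⊆ X₁ ∪ X₂ := by
    rw [← h3, ← a3, ← b3]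
    rintro z ((h | h) | (h | h))
    exacts [Or.inl (Or.inl h), Or.inr (Or.inl (Or.inl h)), Or.inl (Or.inr h),
      Or.inr (Or.inl (Or.inr h))]
  have hinter : ∀ z ∈ X₁ ∩ X₂, z = z₁ ∨ z = z₂ := by
    rintro z ⟨h, (h' | h') | h'⟩
    · rcases h with h | h
      · exact Or.inl (a4.subset ⟨h, h'⟩)
      · have := h4.subset ⟨hA₁₂ h', hA₂₁ h⟩
        rw [mem_singleton_iff.1 this] at h'
        exact absurd h' hy₁
    · rcases h with h | h
      · have := h4.subset ⟨hA₁₁ h, hA₂₂ h'⟩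
        rw [mem_singleton_iff.1 this] at h'
        exact absurd h' hy₂
      · exact Or.inr (b4.subset ⟨h, h'⟩)
    · exact absurd (hX₁b h) (by rw [Metric.mem_ball, Metric.mem_sphere.1 h']; exact lt_irrefl r)
  have hz₁ : z₁ ∈ X₁ ∩ X₂ := ⟨hX₁a.left_mem, Or.inl (Or.inl a2.left_mem)⟩
  have hz₂ : z₂ ∈ X₁ ∩ X₂ := ⟨hX₁a.right_mem, Or.inl (Or.inr b2.left_mem)⟩
  obtain ⟨d, hd, hdX⟩ := Metric.isOpen_iff.1 hX₂c.isOpen_compl y hyX₂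
  have hp : ∀ i, ∃ p ∈ V i, p ∈ Metric.ball y (min d r) := fun i => by
    obtain ⟨p, hp, hpV⟩ := mem_closure_iff_nhds.1 (hVy i) _
      (Metric.ball_mem_nhds y (lt_min hd hr))
    exact ⟨p, hpV, hp⟩
  choose p hpV hpb using hp
  have hpX₂ : ∀ i j, HasLog (fun z => (z - p i) / (z - p j)) X₂ := fun i j =>
    hasLog_div hX₂c (convex_ball y d).isPreconnected (disjoint_left.2 fun z hz => hdX hz)
      (Metric.ball_subset_ball (min_le_left _ _) (hpb i))
      (Metric.ball_subset_ball (min_le_left _ _) (hpb j))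
  have hpΓ : ∀ i, ∀ z ∈ Γ, z - p i ≠ 0 := fun i z hz e =>
    disjoint_left.1 (hVΓ i) (hpV i) (by rwa [← sub_eq_zero.1 e])
  have hpX₁ : ∀ i j, HasLog (fun z => (z - p i) / (z - p j)) X₁ := fun i j =>
    HasLog.of_arc hX₁a
      (ContinuousOn.div (by fun_prop) (by fun_prop) fun z hz => hpΓ j z (hX₁Γ hz))
      fun z hz => div_ne_zero (hpΓ i z (hX₁Γ hz)) (hpΓ j z (hX₁Γ hz))
  -- the jump of the logarithm is an integer multiple of `2πi`
  have hjump : ∀ i, ∃ (g h : ℂ → ℂ) (n : ℤ), ContinuousOn g X₁ ∧ ContinuousOn h X₂ ∧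
      (∀ z ∈ X₁, Complex.exp (g z) = (z - p 0) / (z - p i)) ∧
      (∀ z ∈ X₂, Complex.exp (h z) = (z - p 0) / (z - p i)) ∧
      g z₂ - h z₂ = g z₁ - h z₁ + n * (2 * Real.pi * Complex.I) := by
    intro i
    obtain ⟨g, hg, hg'⟩ := hpX₁ 0 i
    obtain ⟨h, hh, hh'⟩ := hpX₂ 0 i
    have h0 : ∀ z ∈ X₁ ∩ X₂, Complex.exp (g z - h z) = 1 := fun z hz => by
      rw [Complex.exp_sub, hg' z hz.1, hh' z hz.2, div_self]
      rw [← hg' z hz.1]; exact Complex.exp_ne_zero _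
    obtain ⟨n, hn⟩ := Complex.exp_eq_exp_iff_exists_int.1 ((h0 z₂ hz₂).trans (h0 z₁ hz₁).symm)
    exact ⟨g, h, n, hg, hh, hg', hh', hn⟩
  have hcomb : ∃ k₁ k₂ : ℤ, (k₁ ≠ 0 ∨ k₂ ≠ 0) ∧
      HasLog (fun z => ((z - p 0) / (z - p 1)) ^ k₁ * ((z - p 0) / (z - p 2)) ^ k₂) (X₁ ∪ X₂) := by
    obtain ⟨g, h, n, hg, hh, hg', hh', hn⟩ := hjump 1
    obtain ⟨g', h', m, kg, kh, kg', kh', km⟩ := hjump 2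
    have : ∃ k₁ k₂ : ℤ, (k₁ ≠ 0 ∨ k₂ ≠ 0) ∧ k₁ * n + k₂ * m = 0 := by
      by_cases h0 : n = 0
      · exact ⟨1, 0, Or.inl one_ne_zero, by simp [h0]⟩
      · exact ⟨-m, n, Or.inr h0, by ring⟩
    obtain ⟨k₁, k₂, hk, hk0⟩ := this
    refine ⟨k₁, k₂, hk, HasLog.union (g₁ := fun z => k₁ * g z + k₂ * g' z)
      (g₂ := fun z => k₁ * h z + k₂ * h' z) (c := k₁ * (g z₁ - h z₁) + k₂ * (g' z₁ - h' z₁))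
      hX₁c hX₂c (by fun_prop) (by fun_prop) ?_ ?_ ⟨z₁, hz₁⟩ ?_⟩
    · intro z hz
      rw [Complex.exp_add, Complex.exp_int_mul, Complex.exp_int_mul, hg' z hz, kg' z hz]
    · intro z hz
      rw [Complex.exp_add, Complex.exp_int_mul, Complex.exp_int_mul, hh' z hz, kh' z hz]
    · intro z hz
      have hk1 : (k₁ : ℂ) * n + k₂ * m = 0 := by exact_mod_cast hk0
      rcases hinter z hz with rfl | rfl
      · ring
      · linear_combination k₁ * hn + k₂ * km + 2 * Real.pi * Complex.I * hk1
  obtain ⟨k₁, k₂, hk, hlog⟩ := hcomb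
  set X := X₁ ∪ X₂ with hX
  have hXc : IsClosed X := hX₁c.union hX₂c
  have hfr : ∀ i, frontier (V i ∩ Metric.ball y r) ⊆ X := by
    intro i z hz
    rw [((hV i).inter Metric.isOpen_ball).frontier_eq] at hz
    by_contra hzX
    have hzb : z ∈ Metric.closedBall y r :=
      closure_minimal (inter_subset_right.trans Metric.ball_subset_closedBall)
        Metric.isClosed_closedBall hz.1
    have hzb' : z ∈ Metric.ball y r := by
      rcases (Metric.mem_closedBall.1 hzb).lt_or_eq with h | h
      · exact h
      · exact absurd (Or.inr (Or.inr h)) hzX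
    obtain ⟨j, hj⟩ := mem_iUnion.1 (hUV ⟨(hb hzb).1, fun h => hzX (hΓX h)⟩)
    by_cases hij : i = j
    · exact hz.2 ⟨hij ▸ hj, hzb'⟩
    · obtain ⟨w, hw, hw'⟩ := mem_closure_iff.1 hz.1 _ (hV j) hj
      exact disjoint_left.1 (hVd hij) hw'.1 hw
  have hout : ∀ i j, i ≠ j → ∀ z ∈ closure (V i ∩ Metric.ball y r), z - p j ≠ 0 := by
    intro i j hij z hz e
    obtain ⟨w, hw, hw'⟩ := mem_closure_iff.1 hz _ (hV j) (by rw [sub_eq_zero.1 e]; exact hpV j)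
    exact disjoint_left.1 (hVd hij) hw'.1 hw
  have hpX : ∀ i, ∀ z ∈ X, z - p i ≠ 0 := by
    intro i z hz e
    rcases hz with hz | hz
    · exact hpΓ i z (hX₁Γ hz) e
    · exact hdX (Metric.ball_subset_ball (min_le_left d r) (hpb i)) (by rwa [← sub_eq_zero.1 e])
  have fin : ∀ i, IsOpen (V i ∩ Metric.ball y r) ∧ Bornology.IsBounded (V i ∩ Metric.ball y r) ∧
      p i ∈ V i ∩ Metric.ball y r := fun i => ⟨(hV i).inter Metric.isOpen_ball,
      Metric.isBounded_ball.subset inter_subset_right,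
      hpV i, Metric.ball_subset_ball (min_le_right d r) (hpb i)⟩
  rcases hk with hk | hk
  · refine not_hasLog_of_frontier hXc (fin 1).1 (fin 1).2.1 (hfr 1) (fin 1).2.2 (neg_ne_zero.2 hk)
      (h := fun z => (z - p 0) ^ k₁ * ((z - p 0) / (z - p 2)) ^ k₂) ?_ ?_ (hlog.congr ?_)
    · have h1 := hout 1 0 (by decide)
      have h2 := hout 1 2 (by decide)
      exact (ContinuousOn.zpow₀ (by fun_prop) _ fun z hz => Or.inl (h1 z hz)).mul
        (((ContinuousOn.div (by fun_prop) (by fun_prop) h2)).zpow₀ _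
          fun z hz => Or.inl (div_ne_zero (h1 z hz) (h2 z hz)))
    · intro z hz
      exact mul_ne_zero (zpow_ne_zero _ (hout 1 0 (by decide) z hz))
        (zpow_ne_zero _ (div_ne_zero (hout 1 0 (by decide) z hz) (hout 1 2 (by decide) z hz)))
    · intro z hz
      simp only
      rw [div_zpow (z - p 0) (z - p 1), zpow_neg, div_eq_mul_inv]
      ring
  · refine not_hasLog_of_frontier hXc (fin 2).1 (fin 2).2.1 (hfr 2) (fin 2).2.2 (neg_ne_zero.2 hk)
      (h := fun z => (z - p 0) ^ k₂ * ((z - p 0) / (z - p 1)) ^ k₁) ?_ ?_ (hlog.congr ?_)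
    · have h1 := hout 2 0 (by decide)
      have h2 := hout 2 1 (by decide)
      exact (ContinuousOn.zpow₀ (by fun_prop) _ fun z hz => Or.inl (h1 z hz)).mul
        (((ContinuousOn.div (by fun_prop) (by fun_prop) h2)).zpow₀ _
          fun z hz => Or.inl (div_ne_zero (h1 z hz) (h2 z hz)))
    · intro z hz
      exact mul_ne_zero (zpow_ne_zero _ (hout 2 0 (by decide) z hz))
        (zpow_ne_zero _ (div_ne_zero (hout 2 0 (by decide) z hz) (hout 2 1 (by decide) z hz)))
    · intro z hz
      simp only
      rw [div_zpow (z - p 0) (z - p 2), zpow_neg, div_eq_mul_inv]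
      ring

theorem mem_segment_zero_one {z : ℂ} : z ∈ segment ℝ (0 : ℂ) 1 ↔ z.im = 0 ∧ z.re ∈ Icc (0 : ℝ) 1 := by
  rw [segment_eq_image]
  constructor
  · rintro ⟨t, ht, rfl⟩
    simp only [smul_zero, zero_add]
    rw [Complex.real_smul, mul_one]
    exact ⟨Complex.ofReal_im t, by rwa [Complex.ofReal_re]⟩
  · rintro ⟨h, h'⟩
    refine ⟨z.re, h', ?_⟩
    simp only [smul_zero, zero_add]
    rw [Complex.real_smul, mul_one]
    exact Complex.ext (by simp) (by simp [h])

theorem jordan_separates {B : Set ℂ} (hB : IsArc B 0 1) (hBS : B ∩ segment ℝ 0 1 = {0, 1}) :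
    ∃ p ∉ segment ℝ 0 1 ∪ B, ∃ q ∉ segment ℝ 0 1 ∪ B,
      connectedComponentIn (segment ℝ 0 1 ∪ B)ᶜ p ≠ connectedComponentIn (segment ℝ 0 1 ∪ B)ᶜ q := by
  set e := segment ℝ (0 : ℂ) 1 with he
  have heA : IsArc e 0 1 := IsArc.segment zero_ne_one
  have hhalf : (1 / 2 : ℂ) ∉ B := by
    intro h
    have h1 : (1 / 2 : ℂ) ∈ e := mem_segment_zero_one.2 (by constructor <;> norm_num)
    rcases hBS.subset ⟨h, h1⟩ with h2 | h2
    · norm_num at h2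
    · have h2 : (1 / 2 : ℂ) = 1 := h2
      norm_num at h2
  obtain ⟨r, hr, hrB⟩ := Metric.isOpen_iff.1 hB.isClosed.isOpen_compl _ hhalf
  obtain ⟨η, hη, hηr⟩ := exists_between hr
  set p : ℂ := 1 / 2 + η * Complex.I with hp
  set q : ℂ := 1 / 2 - η * Complex.I with hq
  have hpre : p.re = 1 / 2 := by simp [hp]
  have hpim : p.im = η := by simp [hp]
  have hqre : q.re = 1 / 2 := by simp [hq]
  have hqim : q.im = -η := by simp [hq]
  have hpB : p ∉ B := fun h => hrB (by
    rw [Metric.mem_ball, dist_eq_norm, hp, add_sub_cancel_left, norm_mul, Complex.norm_I,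
      Complex.norm_real, Real.norm_of_nonneg hη.le, mul_one]; exact hηr) h
  have hqB : q ∉ B := fun h => hrB (by
    rw [Metric.mem_ball, dist_eq_norm, hq, sub_sub_cancel_left, norm_neg, norm_mul, Complex.norm_I,
      Complex.norm_real, Real.norm_of_nonneg hη.le, mul_one]; exact hηr) h
  have hpe : p ∉ e := fun h => by
    have := (mem_segment_zero_one.1 h).1
    rw [hpim] at this; exact hη.ne' this
  have hqe : q ∉ e := fun h => by
    have := (mem_segment_zero_one.1 h).1
    rw [hqim] at this; linarith
  have hpJ : p ∉ e ∪ B := fun h => h.elim hpe hpB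
  have hqJ : q ∉ e ∪ B := fun h => h.elim hqe hqB
  refine ⟨p, hpJ, q, hqJ, fun hcomp => ?_⟩
  have hJc : IsClosed (e ∪ B) := heA.isClosed.union hB.isClosed
  obtain ⟨g, hg, hg'⟩ := hasLog_div hJc isPreconnected_connectedComponentIn
    (disjoint_left.2 fun z hz => connectedComponentIn_subset _ _ hz)
    (mem_connectedComponentIn (F := (e ∪ B)ᶜ) hpJ)
    (hcomp ▸ mem_connectedComponentIn (F := (e ∪ B)ᶜ) hqJ)
  set f : ℂ → ℂ := fun z => (z - p) / (z - q) with hf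
  have hq0 : ∀ z ∈ e ∪ B, z - q ≠ 0 := fun z hz h => hqJ (by rwa [← sub_eq_zero.1 h])
  have hp0 : ∀ z ∈ e ∪ B, z - p ≠ 0 := fun z hz h => hpJ (by rwa [← sub_eq_zero.1 h])
  have hfc : ContinuousOn f (e ∪ B) := ContinuousOn.div (by fun_prop) (by fun_prop) hq0
  have hf0 : ∀ z ∈ e ∪ B, f z ≠ 0 := fun z hz => div_ne_zero (hp0 z hz) (hq0 z hz)
  have hslitB : ∀ z ∈ B, f z ∈ Complex.slitPlane := by
    intro z hz
    by_contra hcon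
    rw [Complex.mem_slitPlane_iff, not_or, not_lt, not_not] at hcon
    obtain ⟨h1, h2⟩ := hcon
    obtain ⟨c, hc⟩ : ∃ c : ℝ, c = -(f z).re := ⟨_, rfl⟩
    have hc0 : 0 ≤ c := by linarith
    have h3 : f z = -(c : ℂ) := Complex.ext (by simp [hc]) (by simp [h2])
    have h4 : z - p = -(c : ℂ) * (z - q) := by
      rw [← h3, hf]; field_simp [hq0 z (Or.inr hz)]
    have h5 : (1 + c : ℂ) * (z - 1 / 2) = ((1 - c) * η : ℂ) * Complex.I := by
      rw [hp, hq] at h4; linear_combination h4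
    have h6 : (1 + c) * ‖z - 1 / 2‖ = |(1 - c) * η| := by
      have := congrArg norm h5
      rwa [norm_mul, norm_mul, Complex.norm_I, mul_one, ← Complex.ofReal_one, ← Complex.ofReal_add,
        ← Complex.ofReal_sub, ← Complex.ofReal_mul, Complex.norm_real, Complex.norm_real,
        Real.norm_of_nonneg (by linarith : 0 ≤ 1 + c), Real.norm_eq_abs, Complex.ofReal_one] at this
    have h7 : |(1 - c) * η| ≤ (1 + c) * η := by
      rw [abs_le]; constructor <;> nlinarith
    have h8 : ‖z - 1 / 2‖ ≤ η := by
      by_contra! h8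
      nlinarith
    exact hrB (by rw [Metric.mem_ball, dist_eq_norm]; exact h8.trans_lt hηr) hz
  have him : ∀ z ∈ e, (-f z).im * (z.re - 1 / 2) ≥ 0 ∧ (z.re ≠ 1 / 2 → (-f z).im * (z.re - 1 / 2) > 0) ∧
      (z.re = 1 / 2 → -f z = 1) := by
    intro z hz
    have hzi := (mem_segment_zero_one.1 hz).1
    have hn : 0 < Complex.normSq (z - q) := Complex.normSq_pos.2 (hq0 z (Or.inl hz))
    have h1 : (-f z).im = 2 * η * (z.re - 1 / 2) / Complex.normSq (z - q) := by
      rw [hf, Complex.neg_im, Complex.div_im]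
      simp only [Complex.sub_im, Complex.sub_re, hpre, hpim, hqre, hqim, hzi]
      field_simp
      ring
    refine ⟨?_, ?_, ?_⟩
    · rw [h1, ge_iff_le, div_mul_eq_mul_div]
      apply div_nonneg _ hn.le
      nlinarith [mul_nonneg hη.le (sq_nonneg (z.re - 1 / 2))]
    · intro hne
      have : 0 < (z.re - 1 / 2) ^ 2 := by positivity [sub_ne_zero.2 hne]
      rw [h1, gt_iff_lt, div_mul_eq_mul_div]
      apply div_pos _ hn
      nlinarith [mul_pos hη this]
    · intro h
      have hzz : z = 1 / 2 := Complex.ext (by simp [h]) (by simp [hzi])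
      rw [hf]
      simp only [hzz, hp, hq]
      have : (η : ℂ) * Complex.I ≠ 0 := by simp [hη.ne']
      rw [show (1 / 2 - (1 / 2 + (η : ℂ) * Complex.I)) = -(η * Complex.I) by ring,
        show (1 / 2 - (1 / 2 - (η : ℂ) * Complex.I)) = η * Complex.I by ring, neg_div, neg_neg,
        div_self this]
  have hslite : ∀ z ∈ e, -f z ∈ Complex.slitPlane := by
    intro z hz
    by_cases h : z.re = 1 / 2
    · rw [(him z hz).2.2 h]; exact Complex.one_mem_slitPlane
    · right
      intro h0
      have := (him z hz).2.1 h
      rw [h0, zero_mul] at this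
      exact lt_irrefl _ this
  have c1 := eq_of_exp_eq hB.isPreconnected (φ := fun z => Complex.log (f z) - g z) (c := 1)
    (((hfc.mono subset_union_right).clog hslitB).sub (hg.mono subset_union_right)) (fun z hz => by
      rw [Complex.exp_sub, Complex.exp_log (hf0 z (Or.inr hz)), hg' z (Or.inr hz),
        div_self (hf0 z (Or.inr hz))]) hB.left_mem hB.right_mem
  have c2 := eq_of_exp_eq heA.isPreconnected (φ := fun z => Complex.log (-f z) - g z) (c := -1)
    (((hfc.mono subset_union_left).neg.clog hslite).sub (hg.mono subset_union_left)) (fun z hz => by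
      rw [Complex.exp_sub, Complex.exp_log (neg_ne_zero.2 (hf0 z (Or.inl hz))), hg' z (Or.inl hz),
        neg_div, div_self (hf0 z (Or.inl hz))]) heA.left_mem heA.right_mem
  have i1 : 0 < (-f 1).im := by
    have := (him 1 heA.right_mem).2.1 (by norm_num)
    rw [Complex.one_re] at this
    linarith
  have i0 : (-f 0).im < 0 := by
    have := (him 0 heA.left_mem).2.1 (by norm_num)
    rw [Complex.zero_re] at this
    linarith
  have a1 : Complex.log (f 1) = Complex.log (-f 1) - Real.pi * Complex.I := by
    have h := Complex.arg_neg_eq_arg_sub_pi_of_im_pos i1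
    rw [neg_neg] at h
    rw [Complex.log, Complex.log, h, norm_neg]; push_cast; ring
  have a0 : Complex.log (f 0) = Complex.log (-f 0) + Real.pi * Complex.I := by
    have h := Complex.arg_neg_eq_arg_add_pi_of_im_neg i0
    rw [neg_neg] at h
    rw [Complex.log, Complex.log, h, norm_neg]; push_cast; ring
  have : (2 : ℂ) * (Real.pi * Complex.I) = 0 := by
    rw [a1, a0] at c1
    linear_combination c1 - c2
  simp [Real.pi_ne_zero] at this

theorem bounded_component_subset_convex {X N : Set ℂ} {u : ℂ}
    (hb : Bornology.IsBounded (connectedComponentIn Xᶜ u)) (hN : Convex ℝ N) (hNo : IsOpen N)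
    (hXN : X ⊆ N) : connectedComponentIn Xᶜ u ⊆ N := by
  intro w hw
  by_contra hwN
  obtain ⟨f, hf⟩ := geometric_hahn_banach_open_point hN hNo hwN
  by_cases hNe : N.Nonempty
  · obtain ⟨n, hn⟩ := hNe
    set v := w - n with hv
    have hfv : 0 < f v := by rw [hv, map_sub]; linarith [hf n hn]
    have hray : (fun t : ℝ => w + (t : ℂ) * v) '' Ici 0 ⊆ connectedComponentIn Xᶜ u := by
      rw [connectedComponentIn_eq hw]
      refine (isPreconnected_Ici.image _ (by fun_prop)).subset_connectedComponentIn
        ⟨0, self_mem_Ici, by simp⟩ ?_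
      rintro _ ⟨t, ht, rfl⟩ hX
      have h1 := hf _ (hXN hX)
      rw [map_add, ← Complex.real_smul, map_smul, smul_eq_mul] at h1
      nlinarith [mul_nonneg (show (0:ℝ) ≤ t from ht) hfv.le]
    obtain ⟨R, hR⟩ := (hb.subset hray).subset_closedBall w
    have hv0 : 0 < ‖v‖ := norm_pos_iff.2 fun h => by rw [h, map_zero] at hfv; exact lt_irrefl _ hfv
    have h2 := hR ⟨(|R| + 1) / ‖v‖, by simp only [mem_Ici]; positivity, rfl⟩
    rw [Metric.mem_closedBall, dist_eq_norm, add_sub_cancel_left, norm_mul, Complex.norm_real,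
      Real.norm_of_nonneg (by positivity), div_mul_cancel₀ _ hv0.ne'] at h2
    linarith [le_abs_self R]
  · have hX : X = ∅ := by rw [not_nonempty_iff_eq_empty.1 hNe] at hXN; exact subset_empty_iff.1 hXN
    rw [hX, compl_empty, connectedComponentIn_univ, PreconnectedSpace.connectedComponent_eq_univ] at hb
    exact NormedSpace.unbounded_univ ℝ ℂ hb

/-- A weak Jordan curve theorem for loops containing a straight segment. -/
theorem jordan {B : Set ℂ} (hB : IsArc B 0 1) (hBS : B ∩ segment ℝ 0 1 = {0, 1}) :
    ∃ W W' : Set ℂ, IsOpen W ∧ IsOpen W' ∧ IsPreconnected W ∧ W.Nonempty ∧ Disjoint W W' ∧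
      Disjoint W (segment ℝ 0 1 ∪ B) ∧ Disjoint W' (segment ℝ 0 1 ∪ B) ∧
      frontier W = segment ℝ 0 1 ∪ B ∧ frontier W' = segment ℝ 0 1 ∪ B ∧
      ∀ N : Set ℂ, Convex ℝ N → IsOpen N → segment ℝ 0 1 ∪ B ⊆ N → W ⊆ N := by
  obtain ⟨p, hp, q, hq, hpq⟩ := jordan_separates hB hBS
  have hJ : IsLoop (segment ℝ 0 1 ∪ B) :=
    IsLoop.of_arcs (IsArc.segment zero_ne_one) hB (by rw [inter_comm, hBS])
  generalize segment ℝ (0 : ℂ) 1 ∪ B = J at *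
  have hopen : ∀ u, IsOpen (connectedComponentIn Jᶜ u) := fun u =>
    hJ.isClosed.isOpen_compl.connectedComponentIn
  have hdis : ∀ u v, connectedComponentIn Jᶜ u ≠ connectedComponentIn Jᶜ v →
      Disjoint (connectedComponentIn Jᶜ u) (connectedComponentIn Jᶜ v) := by
    intro u v h
    by_contra hcon
    obtain ⟨z, hz, hz'⟩ := not_disjoint_iff.1 hcon
    exact h ((connectedComponentIn_eq hz).trans (connectedComponentIn_eq hz').symm)
  have hfr : ∀ u v, u ∉ J → v ∉ J → connectedComponentIn Jᶜ u ≠ connectedComponentIn Jᶜ v →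
      frontier (connectedComponentIn Jᶜ u) = J := by
    intro u v hu hv h
    by_contra hne
    obtain ⟨s, t, A, hA, hFA, hAJ⟩ := hJ.exists_arc_of_ssubset isClosed_frontier
      ((frontier_connectedComponentIn_subset hJ.isClosed u).ssubset_of_ne hne)
    have h1 : Aᶜ ⊆ connectedComponentIn Jᶜ u := by
      refine hA.isPreconnected_compl.subset_of_closure_inter_subset (hopen u)
        ⟨u, fun hh => hu (hAJ hh), mem_connectedComponentIn hu⟩ ?_
      rintro z ⟨hz, hzA⟩
      by_contra hzW
      exact hzA (hFA (by rw [(hopen u).frontier_eq]; exact ⟨hz, hzW⟩))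
    exact disjoint_left.1 (hdis u v h) (h1 fun hh => hv (hAJ hh)) (mem_connectedComponentIn hv)
  have main : ∀ u v, u ∉ J → v ∉ J → connectedComponentIn Jᶜ u ≠ connectedComponentIn Jᶜ v →
      Bornology.IsBounded (connectedComponentIn Jᶜ u) →
      ∃ W W' : Set ℂ, IsOpen W ∧ IsOpen W' ∧ IsPreconnected W ∧ W.Nonempty ∧ Disjoint W W' ∧
      Disjoint W J ∧ Disjoint W' J ∧ frontier W = J ∧ frontier W' = J ∧
      ∀ N : Set ℂ, Convex ℝ N → IsOpen N → J ⊆ N → W ⊆ N := fun u v hu hv h hb =>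
    ⟨_, _, hopen u, hopen v, isPreconnected_connectedComponentIn, ⟨u, mem_connectedComponentIn hu⟩,
      hdis u v h, disjoint_left.2 fun z hz => connectedComponentIn_subset _ _ hz,
      disjoint_left.2 fun z hz => connectedComponentIn_subset _ _ hz, hfr u v hu hv h,
      hfr v u hv hu h.symm, fun N hN hNo hJN => bounded_component_subset_convex hb hN hNo hJN⟩
  rcases bounded_or_bounded hJ.isCompact hpq with hb | hb
  · exact main p q hp hq hpq hb
  · exact main q p hq hp hpq.symm hb

section Charts

variable {S : Type*} [TopologicalSpace S]

theorem exists_chart {x : S} (hx : x ∉ Bd S) {V : Set S} (hV : V ∈ 𝓝 x) :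
    ∃ ψ : ℂ → S, IsOpenEmbedding ψ ∧ ψ 0 = x ∧ range ψ ⊆ V := by
  simp only [Bd, Set.mem_ofPred_eq, not_not] at hx
  obtain ⟨U, hU, hxU, ⟨e⟩⟩ := hx
  let e' : ℂ ≃ₜ U := Complex.equivRealProdCLM.toHomeomorph.trans e.symm
  have he : IsOpenEmbedding (fun z => (e' z : S)) :=
    hU.isOpenEmbedding_subtypeVal.comp e'.isOpenEmbedding
  set c := e'.symm ⟨x, hxU⟩ with hc
  have hcx : (e' c : S) = x := by simp [hc]
  have : (fun z => (e' z : S)) ⁻¹' V ∈ 𝓝 c :=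
    he.continuous.continuousAt.preimage_mem_nhds (by simpa [hcx] using hV)
  obtain ⟨r, hr, hrV⟩ := Metric.mem_nhds_iff.1 this
  refine ⟨fun z => (e' (OpenPartialHomeomorph.univBall c r z) : S), ?_, ?_, ?_⟩
  · exact he.comp ((OpenPartialHomeomorph.univBall c r).isOpenEmbedding (by simp))
  · simp [hcx]
  · rintro _ ⟨z, rfl⟩
    apply hrV
    have := (OpenPartialHomeomorph.univBall c r).map_source (x := z) (by simp)
    rwa [OpenPartialHomeomorph.univBall_target c hr] at this

theorem disjoint_range_Bd {ψ : ℂ → S} (hψ : IsOpenEmbedding ψ) : Disjoint (range ψ) (Bd S) := by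
  rw [disjoint_left]
  intro x hx hxB
  exact hxB ⟨range ψ, hψ.isOpen_range, hx,
    ⟨hψ.isEmbedding.toHomeomorph.symm.trans Complex.equivRealProdCLM.toHomeomorph⟩⟩

theorem Topology.IsOpenEmbedding.preimage_closure {T : Type*} [TopologicalSpace T] {ψ : T → S}
    (hψ : IsOpenEmbedding ψ) (A : Set S) : ψ ⁻¹' closure A = closure (ψ ⁻¹' A) :=
  hψ.isOpenMap.preimage_closure_eq_closure_preimage hψ.continuous A

end Charts

/-- The curves `a ∈ 𝒜` split the surface into two open sides `G` and `E`, each of which is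
adherent to every curve. -/
structure IsState {S : Type*} [TopologicalSpace S] (𝒜 : Finset (Set S)) (G E : Set S) : Prop where
  isOpen_left : IsOpen G
  isOpen_right : IsOpen E
  disjoint : Disjoint G E
  isLoop : ∀ a ∈ 𝒜, IsLoop a
  disjoint_Bd : ∀ a ∈ 𝒜, Disjoint a (Bd S)
  disjoint_left : ∀ a ∈ 𝒜, Disjoint a G
  disjoint_right : ∀ a ∈ 𝒜, Disjoint a E
  pairwise : ∀ a ∈ 𝒜, ∀ b ∈ 𝒜, a ≠ b → Disjoint a b
  cover : ∀ x, x ∈ G ∨ x ∈ E ∨ ∃ a ∈ 𝒜, x ∈ a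
  subset_left : ∀ a ∈ 𝒜, a ⊆ closure G
  subset_right : ∀ a ∈ 𝒜, a ⊆ closure E

section

variable {S : Type*} [TopologicalSpace S]

theorem IsArc.preimage {T : Type*} [TopologicalSpace T] {ψ : T → S} (hψ : IsOpenEmbedding ψ)
    {A : Set S} {x y : T} (hA : IsArc A (ψ x) (ψ y)) (hAr : A ⊆ range ψ) :
    IsArc (ψ ⁻¹' A) x y := by
  have : Nonempty T := ⟨x⟩
  obtain ⟨ρ, hρc, hρ⟩ : ∃ ρ : S → T, ContinuousOn ρ (range ψ) ∧ ∀ z, ρ (ψ z) = z := by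
    refine ⟨(hψ.toOpenPartialHomeomorph ψ).symm, ?_, fun z => ?_⟩
    · simpa using (hψ.toOpenPartialHomeomorph ψ).continuousOn_symm
    · simpa using (hψ.toOpenPartialHomeomorph ψ).left_inv (x := z) (by simp)
  have hAρ : ρ '' A = ψ ⁻¹' A := by
    ext z
    constructor
    · rintro ⟨_, h, rfl⟩
      obtain ⟨w, rfl⟩ := hAr h
      simpa [hρ] using h
    · exact fun h => ⟨_, h, hρ z⟩
  have hρi : InjOn ρ A := by
    intro a ha b hb h
    obtain ⟨z, rfl⟩ := hAr ha
    obtain ⟨w, rfl⟩ := hAr hb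
    rw [hρ, hρ] at h
    rw [h]
  have hA2 := hA.image (hρc.mono hAr) hρi
  rwa [hAρ, hρ, hρ] at hA2

theorem IsLoop.no_three_sides [T2Space S] {a : Set S} (ha : IsLoop a) {y : S} (hy : y ∈ a)
    (hyB : y ∉ Bd S) {U : Set S} (hU : U ∈ 𝓝 y) {V : Fin 3 → Set S} (hV : ∀ i, IsOpen (V i))
    (hVy : ∀ i, y ∈ closure (V i)) (hVd : Pairwise fun i j => Disjoint (V i) (V j))
    (hVa : ∀ i, Disjoint (V i) a) (hUV : U \ a ⊆ ⋃ i, V i) : False := by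
  obtain ⟨ψ, hψ, rfl, -⟩ := exists_chart hyB Filter.univ_mem
  obtain ⟨s, t, Γ, Γ', hΓ, hΓ', hi, hu, hyΓ, hys, hyt, hΓr⟩ :=
    ha.exists_small_arc hy (hψ.isOpen_range.mem_nhds ⟨0, rfl⟩)
  have hyΓ' : ψ 0 ∉ Γ' := fun h => by
    rcases hi.subset ⟨hyΓ, h⟩ with h | h
    exacts [hys h, hyt h]
  obtain ⟨z₁, rfl⟩ := hΓr hΓ.left_mem
  obtain ⟨z₂, rfl⟩ := hΓr hΓ.right_mem
  have hΓ2 := hΓ.preimage hψ hΓr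
  refine _root_.no_three_sides hΓ2 (y := 0) hyΓ (fun h => hys (by rw [h])) (fun h => hyt (by rw [h]))
    (U := ψ ⁻¹' (U ∩ Γ'ᶜ)) (V := fun i => ψ ⁻¹' V i) ?_ (fun i => (hV i).preimage hψ.continuous)
    (fun i => ?_) (fun i j hij => (hVd hij).preimage _) (fun i => ?_) ?_
  · exact hψ.continuous.continuousAt.preimage_mem_nhds
      (Filter.inter_mem hU (hΓ'.isClosed.isOpen_compl.mem_nhds hyΓ'))
  · rw [← hψ.preimage_closure]; exact hVy i
  · exact ((hVa i).mono_right (hu ▸ subset_union_left)).preimage _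
  · rintro z ⟨⟨hz, hz'⟩, hzΓ⟩
    have := hUV ⟨hz, fun h => by rw [← hu] at h; exact h.elim hzΓ hz'⟩
    simpa using this

namespace IsState

variable {𝒜 : Finset (Set S)} {G E : Set S}

theorem symm (h : IsState 𝒜 G E) : IsState 𝒜 E G where
  isOpen_left := h.isOpen_right
  isOpen_right := h.isOpen_left
  disjoint := h.disjoint.symm
  isLoop := h.isLoop
  disjoint_Bd := h.disjoint_Bd
  disjoint_left := h.disjoint_right
  disjoint_right := h.disjoint_left
  pairwise := h.pairwise
  cover x := by
    rcases h.cover x with h | h | h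
    exacts [Or.inr (Or.inl h), Or.inl h, Or.inr (Or.inr h)]
  subset_left := h.subset_right
  subset_right := h.subset_left

theorem isClosed_others [T2Space S] (h : IsState 𝒜 G E) (a : Set S) :
    IsClosed (⋃ b ∈ {b | b ∈ 𝒜 ∧ b ≠ a}, b) := by
  apply Set.Finite.isClosed_biUnion ((Finset.finite_toSet 𝒜).subset fun b hb => hb.1)
  exact fun b hb => (h.isLoop b hb.1).isClosed

theorem exists_nhds [T2Space S] (h : IsState 𝒜 G E) {a : Set S} (ha : a ∈ 𝒜) :
    ∃ U, IsOpen U ∧ a ⊆ U ∧ ∀ x ∈ U, x ∈ G ∨ x ∈ E ∨ x ∈ a := by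
  refine ⟨_, (h.isClosed_others a).isOpen_compl, fun x hx hx' => ?_, fun x hx => ?_⟩
  · obtain ⟨b, hb, hxb⟩ := mem_iUnion₂.1 hx'
    exact Set.disjoint_left.1 (h.pairwise b hb.1 a ha hb.2) hxb hx
  · rcases h.cover x with h | h | ⟨b, hb, hxb⟩
    · exact Or.inl h
    · exact Or.inr (Or.inl h)
    · by_cases hba : b = a
      · exact Or.inr (Or.inr (hba ▸ hxb))
      · exact absurd (mem_iUnion₂.2 ⟨b, ⟨hb, hba⟩, hxb⟩) hx

theorem adherent_one_side [T2Space S] (h : IsState 𝒜 G E) {G₁ G₂ : Set S} (h₁ : IsOpen G₁)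
    (h₂ : IsOpen G₂) (hd : Disjoint G₁ G₂) (hG : G₁ ∪ G₂ = G) {a : Set S} (ha : a ∈ 𝒜) :
    (a ⊆ closure G₁ ∧ Disjoint a (closure G₂)) ∨ (a ⊆ closure G₂ ∧ Disjoint a (closure G₁)) := by
  have hcov : a ⊆ closure G₁ ∪ closure G₂ := by
    rw [← closure_union, hG]; exact h.subset_left a ha
  have hdis : a ∩ (closure G₁ ∩ closure G₂) = ∅ := by
    rw [eq_empty_iff_forall_notMem]
    rintro y ⟨hy, hy1, hy2⟩
    obtain ⟨U, hU, haU, hUc⟩ := h.exists_nhds ha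
    have e1 : Disjoint G₁ E := h.disjoint.mono_left (hG ▸ subset_union_left)
    have e2 : Disjoint G₂ E := h.disjoint.mono_left (hG ▸ subset_union_right)
    have f1 : Disjoint G₁ a := (h.disjoint_left a ha).symm.mono_left (hG ▸ subset_union_left)
    have f2 : Disjoint G₂ a := (h.disjoint_left a ha).symm.mono_left (hG ▸ subset_union_right)
    refine (h.isLoop a ha).no_three_sides hy (fun hb => Set.disjoint_left.1 (h.disjoint_Bd a ha) hy hb)
      (hU.mem_nhds (haU hy)) (V := ![G₁, G₂, E]) ?_ ?_ ?_ ?_ ?_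
    · intro i; fin_cases i
      exacts [h₁, h₂, h.isOpen_right]
    · intro i; fin_cases i
      exacts [hy1, hy2, h.subset_right a ha hy]
    · intro i j hij
      fin_cases i <;> fin_cases j <;> first | exact absurd rfl hij | skip
      exacts [hd, e1, hd.symm, e2, e1.symm, e2.symm]
    · intro i; fin_cases i
      exacts [f1, f2, (h.disjoint_right a ha).symm]
    · rintro x ⟨hx, hxa⟩
      rcases hUc x hx with hx | hx | hx
      · rw [← hG] at hx
        rcases hx with hx | hx
        exacts [mem_iUnion.2 ⟨0, hx⟩, mem_iUnion.2 ⟨1, hx⟩]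
      · exact mem_iUnion.2 ⟨2, hx⟩
      · exact absurd hx hxa
  have hor := isPreconnected_closed_iff.1 (h.isLoop a ha).isPreconnected _ _ isClosed_closure
    isClosed_closure hcov
  by_cases c1 : (a ∩ closure G₁).Nonempty
  · by_cases c2 : (a ∩ closure G₂).Nonempty
    · have := hor c1 c2
      rw [hdis] at this
      exact absurd this not_nonempty_empty
    · rw [not_nonempty_iff_eq_empty] at c2
      exact Or.inl ⟨fun x hx => (hcov hx).elim id fun h' => absurd (mem_inter hx h')
        (by simp [c2]), disjoint_iff_inter_eq_empty.2 c2⟩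
  · rw [not_nonempty_iff_eq_empty] at c1
    exact Or.inr ⟨fun x hx => (hcov hx).elim (fun h' => absurd (mem_inter hx h')
        (by simp [c1])) id, disjoint_iff_inter_eq_empty.2 c1⟩

open Classical in
theorem sub [T2Space S] (h : IsState 𝒜 G E) {G₁ G₂ : Set S} (h₁ : IsOpen G₁)
    (h₂ : IsOpen G₂) (hd : Disjoint G₁ G₂) (hG : G₁ ∪ G₂ = G) :
    IsState (𝒜.filter (· ⊆ closure G₁)) G₁ (closure G₁)ᶜ := by
  have hG1 : G₁ ⊆ G := hG ▸ subset_union_left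
  have hE : E ⊆ (closure G₁)ᶜ := by
    have := (h.disjoint.mono_left hG1).closure_left h.isOpen_right
    exact this.subset_compl_left
  refine ⟨h₁, isClosed_closure.isOpen_compl, ?_, ?_, ?_, ?_, ?_, ?_, ?_, ?_, ?_⟩
  · exact disjoint_compl_right.mono_left subset_closure
  · exact fun a ha => h.isLoop a (Finset.mem_filter.1 ha).1
  · exact fun a ha => h.disjoint_Bd a (Finset.mem_filter.1 ha).1
  · exact fun a ha => (h.disjoint_left a (Finset.mem_filter.1 ha).1).mono_right hG1
  · exact fun a ha => disjoint_compl_right.mono_left (Finset.mem_filter.1 ha).2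
  · exact fun a ha b hb => h.pairwise a (Finset.mem_filter.1 ha).1 b (Finset.mem_filter.1 hb).1
  · intro x
    by_cases hx : x ∈ G₁
    · exact Or.inl hx
    by_cases hx' : x ∈ closure G₁
    · right; right
      rcases h.cover x with hx2 | hx2 | ⟨a, ha, hxa⟩
      · rw [← hG] at hx2
        rcases hx2 with hx2 | hx2
        · exact absurd hx2 hx
        · exact absurd hx2 (Set.disjoint_left.1 (hd.closure_left h₂) hx')
      · exact absurd hx' (hE hx2)
      · refine ⟨a, Finset.mem_filter.2 ⟨ha, ?_⟩, hxa⟩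
        rcases h.adherent_one_side h₁ h₂ hd hG ha with ⟨h', -⟩ | ⟨-, h'⟩
        · exact h'
        · exact absurd hx' (Set.disjoint_left.1 h' hxa)
    · exact Or.inr (Or.inl hx')
  · exact fun a ha => (Finset.mem_filter.1 ha).2
  · exact fun a ha => (h.subset_right a (Finset.mem_filter.1 ha).1).trans (closure_mono hE)

theorem eq_empty_of_no_adherent [T2Space S] [PreconnectedSpace S] (h : IsState 𝒜 G E)
    {G₁ G₂ : Set S}
    (h₂ : IsOpen G₂) (h₁ : IsOpen G₁) (hd : Disjoint G₁ G₂) (hG : G₁ ∪ G₂ = G)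
    (hadh : ∀ a ∈ 𝒜, Disjoint a (closure G₂)) : G₂ = ∅ ∨ G₂ = univ := by
  have hG2 : G₂ ⊆ G := hG ▸ subset_union_right
  apply isClopen_iff.1
  refine ⟨?_, h₂⟩
  rw [← closure_subset_iff_isClosed]
  intro x hx
  rcases h.cover x with hx2 | hx2 | ⟨a, ha, hxa⟩
  · rw [← hG] at hx2
    rcases hx2 with hx2 | hx2
    · exact absurd hx2 (Set.disjoint_left.1 (hd.symm.closure_left h₁) hx)
    · exact hx2
  · exact absurd hx2 (Set.disjoint_left.1
      ((h.disjoint.mono_left hG2).closure_left h.isOpen_right) hx)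
  · exact absurd hx (Set.disjoint_left.1 (hadh a ha) hxa)

theorem isPreconnected_of_singleton [T2Space S] [PreconnectedSpace S] {a : Set S}
    (h : IsState {a} G E) : IsPreconnected G := by
  rw [IsPreconnected]
  by_contra hcon
  push Not at hcon
  obtain ⟨u, v, hu, hv, huv, hnu, hnv, hi⟩ := hcon
  have key : ∀ u v : Set S, IsOpen u → IsOpen v → G ⊆ u ∪ v → (G ∩ u).Nonempty →
      (G ∩ v).Nonempty → G ∩ (u ∩ v) = ∅ → ¬ Disjoint a (closure (G ∩ v)) := by
    intro u v hu hv huv hnu hnv hi hdis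
    have hd : Disjoint (G ∩ u) (G ∩ v) := by
      rw [Set.disjoint_left]
      rintro x ⟨hx, hxu⟩ ⟨-, hxv⟩
      exact (eq_empty_iff_forall_notMem.1 hi) x ⟨hx, hxu, hxv⟩
    rcases h.eq_empty_of_no_adherent (h.isOpen_left.inter hv) (h.isOpen_left.inter hu) hd
      (by rw [← inter_union_distrib_left, inter_eq_left.2 huv]) (by simpa using hdis) with h' | h'
    · exact hnv.ne_empty h'
    · obtain ⟨x, hx⟩ := (h.isLoop a (by simp)).nonempty
      exact Set.disjoint_left.1 (h.disjoint_left a (by simp)) hx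
        ((h' ▸ mem_univ x : x ∈ G ∩ v)).1
  have hi' : G ∩ (u ∩ v) = ∅ := by simpa [not_nonempty_iff_eq_empty] using hi
  have hd : Disjoint (G ∩ u) (G ∩ v) := by
    rw [Set.disjoint_left]
    rintro x ⟨hx, hxu⟩ ⟨-, hxv⟩
    exact (eq_empty_iff_forall_notMem.1 hi') x ⟨hx, hxu, hxv⟩
  rcases h.adherent_one_side (h.isOpen_left.inter hu) (h.isOpen_left.inter hv) hd
      (by rw [← inter_union_distrib_left, inter_eq_left.2 huv]) (a := a) (by simp) with
    ⟨-, h'⟩ | ⟨-, h'⟩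
  · exact key u v hu hv huv hnu hnv hi' h'
  · exact key v u hv hu (by rwa [union_comm]) hnv hnu (by rwa [inter_comm v u]) h'

end IsState

end

theorem isLoop_sphere (c : ℂ) {r : ℝ} (hr : 0 < r) : IsLoop (Metric.sphere c r) := by
  have key : ∀ ε : ℝ, ε = 1 ∨ ε = -1 → IsArc
      ((fun t : ℝ => (⟨t, ε * √(1 - t ^ 2)⟩ : ℂ)) '' Icc (-1) 1) (-1) 1 := by
    intro ε hε
    have hc : Continuous (fun t : ℝ => (⟨t, ε * √(1 - t ^ 2)⟩ : ℂ)) := by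
      have : (fun t : ℝ => (⟨t, ε * √(1 - t ^ 2)⟩ : ℂ)) =
          fun t : ℝ => (t : ℂ) + ((ε * √(1 - t ^ 2) : ℝ) : ℂ) * Complex.I := by
        ext t; exact Complex.mk_eq_add_mul_I _ _
      rw [this]; fun_prop
    have := IsArc.of_Icc (γ := fun t : ℝ => (⟨t, ε * √(1 - t ^ 2)⟩ : ℂ)) (a := -1) (b := 1)
      (by norm_num) hc.continuousOn (fun a _ b _ h => (Complex.ext_iff.1 h).1)
    convert this using 1 <;> apply Complex.ext <;> simp
  have h1 := IsLoop.of_arcs (key 1 (Or.inl rfl)) (key (-1) (Or.inr rfl)) (by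
    rintro _ ⟨⟨t, ht, rfl⟩, ⟨s, hs, h⟩⟩
    have h1 := (Complex.ext_iff.1 h).1
    have h2 := (Complex.ext_iff.1 h).2
    simp only at h1 h2
    subst h1
    have h3 : √(1 - s ^ 2) = 0 := by linarith
    rw [Real.sqrt_eq_zero (by nlinarith [hs.1, hs.2])] at h3
    simp only [h3, Real.sqrt_zero, mul_zero]
    have : (s - 1) * (s + 1) = 0 := by linarith
    rcases mul_eq_zero.1 this with h | h
    · right; apply Complex.ext <;> simp; linarith
    · left; apply Complex.ext <;> simp; linarith)
  have h2 := h1.image (f := fun z : ℂ => c + r * z) (by fun_prop) (fun a _ b _ h => by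
    have hr' : (r : ℂ) ≠ 0 := by exact_mod_cast hr.ne'
    simpa [hr'] using h)
  convert h2 using 1
  have hs : (fun t : ℝ => (⟨t, 1 * √(1 - t ^ 2)⟩ : ℂ)) '' Icc (-1) 1 ∪
      (fun t : ℝ => (⟨t, -1 * √(1 - t ^ 2)⟩ : ℂ)) '' Icc (-1) 1 = Metric.sphere 0 1 := by
    ext z
    have hz : z ∈ Metric.sphere (0 : ℂ) 1 ↔ z.re ^ 2 + z.im ^ 2 = 1 := by
      rw [mem_sphere_zero_iff_norm, ← Complex.normSq_add_mul_I, Complex.re_add_im,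
        Complex.normSq_eq_norm_sq, pow_eq_one_iff_of_nonneg (norm_nonneg _) two_ne_zero]
    rw [hz]
    constructor
    · rintro (⟨t, ht, rfl⟩ | ⟨t, ht, rfl⟩) <;> simp only <;>
        nlinarith [Real.sq_sqrt (show 0 ≤ 1 - t ^ 2 by nlinarith [ht.1, ht.2])]
    · intro h
      have ht : z.re ∈ Icc (-1 : ℝ) 1 := by constructor <;> nlinarith [sq_nonneg z.im]
      have h2 : 1 - z.re ^ 2 = z.im ^ 2 := by linarith
      rcases le_total 0 z.im with hi | hi
      · left
        refine ⟨z.re, ht, ?_⟩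
        apply Complex.ext <;> simp [h2, Real.sqrt_sq hi]
      · right
        refine ⟨z.re, ht, ?_⟩
        apply Complex.ext <;> simp [h2, Real.sqrt_sq_eq_abs, abs_of_nonpos hi]
  rw [hs]
  ext z
  have hr' : (r : ℂ) ≠ 0 := by exact_mod_cast hr.ne'
  constructor
  · intro h
    refine ⟨(z - c) / r, ?_, by field_simp; ring⟩
    rw [mem_sphere_iff_norm] at h
    rw [mem_sphere_zero_iff_norm, norm_div, h, Complex.norm_real, Real.norm_of_nonneg hr.le,
      div_self hr.ne']
  · rintro ⟨w, hw, rfl⟩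
    rw [mem_sphere_zero_iff_norm] at hw
    simp [mem_sphere_iff_norm, hw, abs_of_pos hr]

namespace IsState

variable {S : Type*} [TopologicalSpace S] {𝒜 : Finset (Set S)} {G E : Set S}

open Classical in
theorem remove_disc [T2Space S] (h : IsState 𝒜 G E) {ψ : ℂ → S} (hψ : IsOpenEmbedding ψ) {c : ℂ}
    {r : ℝ} (hr : 0 < r) (hD : ψ '' Metric.closedBall c r ⊆ G) :
    ψ '' Metric.sphere c r ∉ 𝒜 ∧
    IsState (insert (ψ '' Metric.sphere c r) 𝒜) (G \ ψ '' Metric.closedBall c r)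
      (E ∪ ψ '' Metric.ball c r) := by
  have hDc : IsCompact (ψ '' Metric.closedBall c r) :=
    (isCompact_closedBall c r).image hψ.continuous
  have hbG : ψ '' Metric.ball c r ⊆ G := (image_mono Metric.ball_subset_closedBall).trans hD
  have hsG : ψ '' Metric.sphere c r ⊆ G := (image_mono Metric.sphere_subset_closedBall).trans hD
  have hsub : ψ '' Metric.sphere c r ⊆ ψ '' Metric.closedBall c r :=
    image_mono Metric.sphere_subset_closedBall
  have hl := (isLoop_sphere c hr).image hψ.continuous.continuousOn hψ.injective.injOn
  have hold : ∀ a ∈ 𝒜, Disjoint a (ψ '' Metric.sphere c r) := fun a ha =>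
    (h.disjoint_left a ha).mono_right hsG
  have hcl : ∀ A : Set ℂ, ψ '' closure A ⊆ closure (ψ '' A) := fun A =>
    image_closure_subset_closure_image hψ.continuous
  refine ⟨fun hmem => ?_, ?_⟩
  · obtain ⟨x, hx⟩ := hl.nonempty
    exact Set.disjoint_left.1 (hold _ hmem) hx hx
  refine ⟨h.isOpen_left.sdiff hDc.isClosed, h.isOpen_right.union
    (hψ.isOpenMap _ Metric.isOpen_ball), ?_, ?_, ?_, ?_, ?_, ?_, ?_, ?_, ?_⟩
  · rw [disjoint_union_right]
    exact ⟨h.disjoint.mono_left sdiff_subset,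
      disjoint_sdiff_left.mono_right (image_mono Metric.ball_subset_closedBall)⟩
  · simp only [Finset.mem_insert, forall_eq_or_imp]
    exact ⟨hl, h.isLoop⟩
  · simp only [Finset.mem_insert, forall_eq_or_imp]
    exact ⟨(disjoint_range_Bd hψ).mono_left (image_subset_range _ _), h.disjoint_Bd⟩
  · simp only [Finset.mem_insert, forall_eq_or_imp]
    exact ⟨disjoint_sdiff_right.mono_left hsub,
      fun a ha => (h.disjoint_left a ha).mono_right sdiff_subset⟩
  · simp only [Finset.mem_insert, forall_eq_or_imp, disjoint_union_right]
    refine ⟨⟨h.disjoint.mono_left hsG, ?_⟩, fun a ha => ⟨h.disjoint_right a ha,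
      (h.disjoint_left a ha).mono_right hbG⟩⟩
    rw [disjoint_image_iff hψ.injective]
    exact Metric.sphere_disjoint_ball
  · simp only [Finset.mem_insert]
    rintro a (rfl | ha) b (rfl | hb) hab
    · exact absurd rfl hab
    · exact (hold b hb).symm
    · exact hold a ha
    · exact h.pairwise a ha b hb hab
  · intro x
    simp only [Finset.mem_insert, exists_eq_or_imp]
    by_cases hx : x ∈ ψ '' Metric.closedBall c r
    · rw [← Metric.ball_union_sphere, image_union] at hx
      exact Or.inr (hx.imp (Or.inr) Or.inl)
    · rcases h.cover x with h | h | h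
      · exact Or.inl ⟨h, hx⟩
      · exact Or.inr (Or.inl (Or.inl h))
      · exact Or.inr (Or.inr (Or.inr h))
  · simp only [Finset.mem_insert, forall_eq_or_imp]
    constructor
    · rintro _ ⟨z, hz, rfl⟩
      have h1 : z ∈ closure (ψ ⁻¹' (G \ ψ '' Metric.closedBall c r)) := by
        have h2 : z ∈ closure ((Metric.closedBall c r)ᶜ) := by
          rw [closure_compl, interior_closedBall c hr.ne']
          exact fun h' => (Metric.mem_ball.1 h').ne hz
        have h3 : ψ ⁻¹' G ∈ 𝓝 z :=
          (h.isOpen_left.preimage hψ.continuous).mem_nhds (hsG ⟨z, hz, rfl⟩)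
        rw [mem_closure_iff_nhds] at h2 ⊢
        intro t ht
        obtain ⟨w, ⟨hw1, hw2⟩, hw3⟩ := h2 _ (Filter.inter_mem ht h3)
        refine ⟨w, hw1, hw2, fun hw => hw3 ?_⟩
        rwa [hψ.injective.mem_set_image] at hw
      rwa [← hψ.preimage_closure] at h1
    · intro a ha x hx
      have : (ψ '' Metric.closedBall c r)ᶜ ∈ 𝓝 x := hDc.isClosed.isOpen_compl.mem_nhds fun hx' =>
        Set.disjoint_left.1 (h.disjoint_left a ha) hx (hD hx')
      have h2 := h.subset_left a ha hx
      rw [mem_closure_iff_nhds] at h2 ⊢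
      intro t ht
      obtain ⟨w, ⟨hw1, hw2⟩, hw3⟩ := h2 _ (Filter.inter_mem ht this)
      exact ⟨w, hw1, hw3, hw2⟩
  · simp only [Finset.mem_insert, forall_eq_or_imp]
    constructor
    · refine Subset.trans ?_ (closure_mono subset_union_right)
      refine Subset.trans ?_ (hcl _)
      rw [closure_ball c hr.ne']
      exact hsub
    · exact fun a ha => (h.subset_right a ha).trans (closure_mono subset_union_left)

end IsState

theorem exists_landing {g ε A : Set ℂ} (hg : IsOpen g) (hε : IsOpen ε) (hA : IsClosed A)
    (hgε : Disjoint g ε) (hgA : Disjoint g A) (hεA : Disjoint ε A)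
    (hcov : ∀ z, z ∈ g ∨ z ∈ ε ∨ z ∈ A) (h0 : (0 : ℂ) ∈ closure ε) 
    (hseg : ∀ z ∈ segment ℝ (0 : ℂ) 1, z ≠ 0 → z ≠ 1 → z ∈ g) (h0A : (0 : ℂ) ∈ A) {r : ℝ}
    (hr : 0 < r) (hr1 : r ≤ 1) {p : ℂ} (hp : p ∈ (Metric.ball 0 r ∩ g) \ segment ℝ (0 : ℂ) 1) :
    ∃ u ∈ A, ‖u‖ < r ∧ u ≠ 0 ∧
      ArcIn (((Metric.ball 0 r ∩ g) \ segment ℝ (0 : ℂ) 1) ∪ {u}) p u := by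
  set e := segment ℝ (0 : ℂ) 1 with he
  have hec : IsClosed e := (IsArc.segment zero_ne_one).isClosed
  set X := (Metric.ball 0 r ∩ g) \ e with hX
  have hXo : IsOpen X := (Metric.isOpen_ball.inter hg).sdiff hec
  set Q := connectedComponentIn X p with hQ
  have hQo : IsOpen Q := hXo.connectedComponentIn
  have hQX : Q ⊆ X := connectedComponentIn_subset _ _
  have hQp : IsPreconnected Q := isPreconnected_connectedComponentIn
  have hpQ : p ∈ Q := mem_connectedComponentIn hp
  have hQcl : ∀ y ∈ closure Q, y ∈ X → y ∈ Q := by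
    intro y hy hyX
    have : IsPreconnected (insert y Q) :=
      hQp.subset_closure (subset_insert _ _) (insert_subset hy subset_closure)
    exact this.subset_connectedComponentIn (Or.inr hpQ) (insert_subset hyX hQX) (Or.inl rfl)
  obtain ⟨y, hyQ, hyA, hyr, hy0⟩ : ∃ y ∈ closure Q, y ∈ A ∧ ‖y‖ < r ∧ y ≠ 0 := by
    by_contra hcon
    push Not at hcon
    have hstar : StarConvex ℝ (-(r / 2 : ℝ) : ℂ) (Metric.ball (0 : ℂ) r \ e) := by
      intro z hz a b ha hb hab
      refine ⟨convex_ball (0 : ℂ) r ?_ hz.1 ha hb hab, fun hmem => ?_⟩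
      · simp [abs_of_pos hr, hr]
      · rw [he, mem_segment_zero_one] at hmem
        obtain ⟨h1, h2, h3⟩ := hmem
        apply hz.2
        rw [he, mem_segment_zero_one]
        simp at h1 h2
        have hz1 : |z.re| < r := (Complex.abs_re_le_norm z).trans_lt (by simpa using hz.1)
        rcases eq_or_lt_of_le hb with hb0 | hb0
        · have : a = 1 := by linarith
          subst this; subst hb0
          simp at h2; linarith
        · refine ⟨h1.resolve_left hb0.ne', ?_, by linarith [le_abs_self z.re]⟩
          by_contra hneg
          nlinarith
    have hpre := (hstar.isPathConnected ⟨by simpa [abs_of_pos hr] using hr, fun h => by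
      have := (mem_segment_zero_one.1 h).2.1
      simp at this
      linarith⟩).isConnected.isPreconnected
    have hsub : Metric.ball (0 : ℂ) r \ e ⊆ Q := by
      refine hpre.subset_left_of_subset_union hQo isClosed_closure.isOpen_compl
        (disjoint_compl_right.mono_left subset_closure) (v := (closure Q)ᶜ) ?_ ⟨p, ⟨hp.1.1, hp.2⟩, hpQ⟩
      intro z hz
      by_cases hzc : z ∈ closure Q
      · left
        rcases hcov z with h | h | h
        · exact hQcl z hzc ⟨⟨hz.1, h⟩, hz.2⟩
        · have : Disjoint Q ε := hgε.mono_left fun w hw => (hQX hw).1.2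
          exact absurd h (disjoint_left.1 (this.closure_left hε) hzc)
        · have := hcon z hzc h (by simpa using hz.1)
          exact absurd (this ▸ left_mem_segment ℝ (0 : ℂ) 1) hz.2
      · exact Or.inr hzc
    obtain ⟨w, hw, hwε⟩ := mem_closure_iff_nhds.1 h0 _ (Metric.ball_mem_nhds 0 hr)
    refine disjoint_left.1 hgε (hQX (hsub ⟨hw, fun hwe => ?_⟩)).1.2 hwε
    refine disjoint_left.1 hgε (hseg w hwe ?_ ?_) hwε
    · rintro rfl; exact disjoint_left.1 hεA hwε h0A
    · rintro rfl; simp at hw; linarith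
  have hye : y ∉ e := fun h => by
    refine disjoint_left.1 hgA (hseg y h hy0 ?_) hyA
    rintro rfl; simp at hyr; linarith
  obtain ⟨s, hs, hsub⟩ := Metric.isOpen_iff.1 (Metric.isOpen_ball.sdiff hec) y
    (show y ∈ Metric.ball (0 : ℂ) r \ e from ⟨by simpa using hyr, hye⟩)
  obtain ⟨q, hq, hqQ⟩ := mem_closure_iff_nhds.1 hyQ _ (Metric.ball_mem_nhds y (half_pos hs))
  obtain ⟨u, huA, hu⟩ := hA.exists_infDist_eq_dist ⟨y, hyA⟩ q
  have hqy : dist q y < s / 2 := hq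
  have hqu : dist q u ≤ dist q y := hu ▸ Metric.infDist_le_dist_of_mem hyA
  have huy : u ∈ Metric.ball y s := by
    have := dist_triangle u q y
    rw [dist_comm u q] at this
    rw [Metric.mem_ball]; linarith
  have hqne : q ≠ u := fun h => disjoint_left.1 hgA (hQX hqQ).1.2 (h ▸ huA)
  have hsegA : ∀ z ∈ segment ℝ q u, z ≠ u → z ∉ A := by
    intro z hz hzu hzA
    have h1 := Metric.infDist_le_dist_of_mem (x := q) hzA
    have h2 := dist_add_dist_of_mem_segment hz
    have h3 : 0 < dist z u := dist_pos.2 hzu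
    linarith
  have hsegball : segment ℝ q u ⊆ Metric.ball y s := (convex_ball y s).segment_subset
    (by rw [Metric.mem_ball]; linarith) huy
  have hsegp : IsPreconnected (segment ℝ q u \ {u}) := by
    have := (IsArc.segment (E := ℂ) hqne)
    refine this.interior_isPreconnected.subset_closure (fun z hz => ⟨hz.1, fun h => hz.2 (Or.inr h)⟩) ?_
    exact sdiff_subset.trans this.subset_closure_interior
  have hsegX : segment ℝ q u \ {u} ⊆ X := by
    intro z hz
    refine ⟨⟨(hsub (hsegball hz.1)).1, ?_⟩, (hsub (hsegball hz.1)).2⟩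
    refine (hsegp.subset_left_of_subset_union hg hε hgε (fun w hw => ?_) ?_) hz
    swap; · exact ⟨q, ⟨left_mem_segment _ _ _, hqne⟩, (hQX hqQ).1.2⟩
    rcases hcov w with h | h | h
    exacts [Or.inl h, Or.inr h, absurd h (hsegA w hw.1 hw.2)]
  refine ⟨u, huA, by simpa using (hsub huy).1, ?_, ?_⟩
  · rintro rfl
    exact (hsub huy).2 (left_mem_segment _ _ _)
  · refine ((arcIn_of_isOpen hQo hQp hpQ hqQ).mono (hQX.trans subset_union_left)).trans
      (ArcIn.of_segment fun z hz => ?_)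
    by_cases h : z = u
    · exact Or.inr h
    · exact Or.inl (hsegX ⟨hz, h⟩)

theorem exists_parallel_arc {g ε A M : Set ℂ} (hg : IsOpen g) (hε : IsOpen ε) (hA : IsClosed A)
    (hgε : Disjoint g ε) (hgA : Disjoint g A) (hεA : Disjoint ε A)
    (hcov : ∀ z, z ∈ g ∨ z ∈ ε ∨ z ∈ A) (h0 : (0 : ℂ) ∈ closure ε) (h1 : (1 : ℂ) ∈ closure ε)
    (hseg : ∀ z ∈ segment ℝ (0 : ℂ) 1, z ≠ 0 → z ≠ 1 → z ∈ g) (h0A : (0 : ℂ) ∈ A)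
    (h1A : (1 : ℂ) ∈ A) (hM : IsOpen M) (hMe : segment ℝ (0 : ℂ) 1 ⊆ M)
    {U₀ U₁ : Set ℂ} (hU₀ : U₀ ∈ 𝓝 0) (hU₁ : U₁ ∈ 𝓝 1) :
    ∃ u ∈ A ∩ U₀, ∃ v ∈ A ∩ U₁, u ≠ 0 ∧ v ≠ 1 ∧ ∃ C, IsArc C u v ∧ C ⊆ M ∧
      C \ {u, v} ⊆ g \ segment ℝ (0 : ℂ) 1 := by
  set e := segment ℝ (0 : ℂ) 1 with he
  have hec : IsClosed e := (IsArc.segment zero_ne_one).isClosed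
  obtain ⟨r₀, hr₀, hr₀U⟩ := Metric.mem_nhds_iff.1
    (Filter.inter_mem hU₀ (hM.mem_nhds (hMe (left_mem_segment _ _ _))))
  obtain ⟨r₁, hr₁, hr₁U⟩ := Metric.mem_nhds_iff.1
    (Filter.inter_mem hU₁ (hM.mem_nhds (hMe (right_mem_segment _ _ _))))
  obtain ⟨r, hr, hrr₀, hrr₁, hr2⟩ : ∃ r : ℝ, 0 < r ∧ r ≤ r₀ ∧ r ≤ r₁ ∧ r ≤ 1 / 2 :=
    ⟨min (min r₀ r₁) (1 / 2), by positivity, (min_le_left _ _).trans (min_le_left _ _),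
      (min_le_left _ _).trans (min_le_right _ _), min_le_right _ _⟩
  have hmid : segment ℝ ((r / 2 : ℝ) : ℂ) ((1 - r / 2 : ℝ) : ℂ) ⊆ g ∩ M := by
    have hsub : segment ℝ ((r / 2 : ℝ) : ℂ) ((1 - r / 2 : ℝ) : ℂ) ⊆
        {z | z.im = 0 ∧ r / 2 ≤ z.re ∧ z.re ≤ 1 - r / 2} := by
      rintro _ ⟨a, b, ha, hb, hab, rfl⟩
      have : a = 1 - b := by linarith
      subst this
      simp only [Set.mem_ofPred_eq]
      simp
      constructor <;> nlinarith
    intro z hz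
    obtain ⟨h1, h2, h3⟩ := hsub hz
    have hze : z ∈ e := mem_segment_zero_one.2 ⟨h1, by linarith, by linarith⟩
    refine ⟨hseg z hze ?_ ?_, hMe hze⟩
    · rintro rfl; simp at h2; linarith
    · rintro rfl; simp at h3; linarith
  obtain ⟨η, hη, hηs⟩ := (IsArc.segment (u := ((r / 2 : ℝ) : ℂ))
    (v := ((1 - r / 2 : ℝ) : ℂ)) (fun h => by
      have := Complex.ofReal_injective h
      linarith)).isCompact.exists_thickening_subset_open (hg.inter hM) hmid
  obtain ⟨κ, hκ, hκη, hκr⟩ : ∃ κ : ℝ, 0 < κ ∧ κ < η ∧ κ < r / 2 :=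
    ⟨min (η / 2) (r / 4), by positivity, (min_le_left _ _).trans_lt (by linarith),
      (min_le_right _ _).trans_lt (by linarith)⟩
  have hup : ∀ z ∈ segment ℝ ((r / 2 : ℝ) : ℂ) ((1 - r / 2 : ℝ) : ℂ),
      z + κ * Complex.I ∈ (M ∩ g) \ e := by
    intro z hz
    have : z + κ * Complex.I ∈ g ∩ M := hηs (Metric.mem_thickening_iff.2 ⟨z, hz, by
      simpa [abs_of_pos hκ] using hκη⟩)
    refine ⟨⟨this.2, this.1⟩, fun h => ?_⟩
    have him : z.im = 0 := by
      obtain ⟨a, b, ha, hb, hab, rfl⟩ := hz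
      simp
    have := (mem_segment_zero_one.1 h).1
    simp [him, hκ.ne'] at this
  set p₀ : ℂ := ((r / 2 : ℝ) : ℂ) + κ * Complex.I with hp₀
  set p₁ : ℂ := ((1 - r / 2 : ℝ) : ℂ) + κ * Complex.I with hp₁
  have m₀ := hup _ (left_mem_segment _ _ _)
  have m₁ := hup _ (right_mem_segment _ _ _)
  have hn : ‖κ * Complex.I‖ = κ := by simp [abs_of_pos hκ]
  have n₀ : ‖p₀‖ < r := by
    refine (norm_add_le _ _).trans_lt ?_
    rw [hn, Complex.norm_real, Real.norm_of_nonneg (by positivity)]; linarith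
  have n₁ : ‖1 - p₁‖ < r := by
    have : 1 - p₁ = ((r / 2 : ℝ) : ℂ) - κ * Complex.I := by rw [hp₁]; push_cast; ring
    rw [this]
    refine (norm_sub_le _ _).trans_lt ?_
    rw [hn, Complex.norm_real, Real.norm_of_nonneg (by positivity)]; linarith
  have hhor : ArcIn ((M ∩ g) \ e) p₀ p₁ := by
    apply ArcIn.of_segment
    intro z hz
    have : z - κ * Complex.I ∈ segment ℝ ((r / 2 : ℝ) : ℂ) ((1 - r / 2 : ℝ) : ℂ) := by
      have := (mem_segment_translate ℝ (-(κ * Complex.I))).2 hz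
      have e₀ : -(κ * Complex.I) + ((r / 2 : ℝ) + κ * Complex.I) = ((r / 2 : ℝ) : ℂ) := by ring
      have e₁ : -(κ * Complex.I) + ((1 - r / 2 : ℝ) + κ * Complex.I) = ((1 - r / 2 : ℝ) : ℂ) := by
        ring
      rwa [hp₀, hp₁, e₀, e₁, neg_add_eq_sub] at this
    simpa using hup _ this
  obtain ⟨u, huA, hur, hu0, hpu⟩ := exists_landing hg hε hA hgε hgA hεA hcov h0 hseg h0A hr
    (by linarith) (p := p₀) ⟨⟨by simpa using n₀, m₀.1.2⟩, m₀.2⟩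
  let f : ℂ → ℂ := fun z => 1 - z
  have hf : Continuous f := by fun_prop
  have hff : ∀ z, f (f z) = z := fun z => sub_sub_cancel _ _
  have hfe : ∀ z, f z ∈ e ↔ z ∈ e := by
    intro z
    rw [he, mem_segment_zero_one, mem_segment_zero_one]
    simp only [f, Complex.sub_im, Complex.sub_re, Complex.one_im, Complex.one_re]
    constructor <;> rintro ⟨h1, h2, h3⟩ <;> exact ⟨by linarith, by linarith, by linarith⟩
  have hfh : f ⁻¹' closure ε = closure (f ⁻¹' ε) := (Homeomorph.subLeft (1 : ℂ)).preimage_closure ε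
  obtain ⟨v, hvA, hvr, hv0, hpv⟩ := exists_landing (hg.preimage hf) (hε.preimage hf)
    (hA.preimage hf) (hgε.preimage f) (hgA.preimage f) (hεA.preimage f) (fun z => hcov (f z))
    (by rw [← hfh]; simpa [f] using h1)
    (fun z hz hz0 hz1 => hseg (f z) ((hfe z).2 hz) (fun h => hz1 (sub_eq_zero.1 h).symm)
      (fun h => hz0 (by simpa [f] using h))) (by simpa [f] using h1A) hr (by linarith)
      (p := f p₁) ⟨⟨by simpa [f] using n₁, by rw [mem_preimage, hff]; exact m₁.1.2⟩,
        fun h => m₁.2 ((hfe _).1 h)⟩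
  have hpv' : ArcIn ((M ∩ g) \ e ∪ {f v}) p₁ (f v) := by
    rcases hpv with h | ⟨D, hD, hDa⟩
    · exact Or.inl (by rw [← h, hff])
    · right
      have hDf := hDa.image hf.continuousOn (fun a _ b _ h => by simpa [f] using h)
      rw [hff] at hDf
      refine ⟨f '' D, ?_, hDf⟩
      rintro _ ⟨z, hz, rfl⟩
      rcases hD hz with hz | hz
      · refine Or.inl ⟨⟨(hr₁U (Metric.ball_subset_ball hrr₁ ?_)).2, hz.1.2⟩,
          fun h => hz.2 ((hfe z).1 h)⟩
        have := hz.1.1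
        simpa [f, dist_eq_norm] using this
      · rw [mem_singleton_iff.1 hz]; exact Or.inr rfl
  have hfv : ‖f v - 1‖ < r := by simpa [f] using hvr
  have huv : u ≠ f v := by
    intro h
    have h1 : ‖(1 : ℂ)‖ ≤ ‖u‖ + ‖f v - 1‖ := by
      have := norm_sub_le u (f v - 1)
      rw [h, sub_sub_cancel] at this
      rwa [h]
    rw [norm_one] at h1; linarith
  refine ⟨u, ⟨huA, (hr₀U (Metric.ball_subset_ball hrr₀ (by simpa using hur))).1⟩, f v,
    ⟨hvA, (hr₁U (Metric.ball_subset_ball hrr₁ (by simpa [dist_eq_norm] using hfv))).1⟩, hu0,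
    fun h => hv0 (by simpa [f] using h), ?_⟩
  have hu' : ArcIn ((M ∩ g) \ e ∪ {u, f v}) p₀ u := hpu.mono (by
    apply union_subset_union _ (by simp)
    rintro z ⟨⟨hz, hzg⟩, hze⟩
    exact ⟨⟨(hr₀U (Metric.ball_subset_ball hrr₀ hz)).2, hzg⟩, hze⟩)
  have hv' : ArcIn ((M ∩ g) \ e ∪ {u, f v}) p₁ (f v) := hpv'.mono
    (union_subset_union_right _ (by simp))
  rcases (hu'.symm.trans (hhor.mono subset_union_left)).trans hv' with h | ⟨C, hCs, hC⟩
  · exact absurd h huv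
  · have huM : u ∈ M := (hr₀U (Metric.ball_subset_ball hrr₀ (by simpa using hur))).2
    have hvM : f v ∈ M :=
      (hr₁U (Metric.ball_subset_ball hrr₁ (by simpa [dist_eq_norm] using hfv))).2
    refine ⟨C, hC, fun z hz => ?_, fun z hz => ?_⟩
    · rcases hCs hz with h | h | h
      exacts [h.1.1, h ▸ huM, (mem_singleton_iff.1 h) ▸ hvM]
    · rcases hCs hz.1 with h | h
      exacts [⟨h.1.2, h.2⟩, absurd h hz.2]

namespace IsState

variable {S : Type*} [TopologicalSpace S] {𝒜 : Finset (Set S)} {G E : Set S}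

open Classical in
/-- Surgery: a disc `W ⊆ G` whose boundary consists of `P ⊆ a ∪ b` and of a set `K` crossing `G`
is moved to the other side. -/
theorem surgery [T2Space S] (h : IsState 𝒜 G E) {a b : Set S} (ha : a ∈ 𝒜) (hb : b ∈ 𝒜)
    {W W' K P P' : Set S} (hW : IsOpen W) (hWG : W ⊆ G) (hWW' : Disjoint W W')
    (hWJ : Disjoint W (K ∪ P)) (hW'J : Disjoint W' (K ∪ P))
    (hcl : closure W = W ∪ (K ∪ P)) (hcl' : K ∪ P ⊆ closure W')
    (hK : IsClosed K) (hKB : Disjoint K (Bd S)) (hKG : K \ (a ∪ b) ⊆ G)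
    (hKd : K ⊆ closure (K \ (a ∪ b)))
    (hP : P ⊆ a ∪ b) (hPP : P' ⊆ P) (hPK : P \ P' ⊆ K) (hKP : Disjoint K P')
    (hL : IsClosed ((a ∪ b) \ P')) {𝒩 : Finset (Set S)}
    (hN : ⋃₀ (𝒩 : Set (Set S)) = K ∪ (a ∪ b) \ P') (hNl : ∀ c ∈ 𝒩, IsLoop c)
    (hNp : ∀ c ∈ 𝒩, ∀ d ∈ 𝒩, c ≠ d → Disjoint c d) :
    IsState ((𝒜.erase a).erase b ∪ 𝒩) (G \ (W ∪ (K ∪ P))) (E ∪ W ∪ P') := by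
  have habG : Disjoint (a ∪ b) G := disjoint_union_left.2 ⟨h.disjoint_left a ha, h.disjoint_left b hb⟩
  have habE : Disjoint (a ∪ b) E :=
    disjoint_union_left.2 ⟨h.disjoint_right a ha, h.disjoint_right b hb⟩
  have hRc : IsClosed (W ∪ (K ∪ P)) := hcl ▸ isClosed_closure
  have hP'ab : P' ⊆ a ∪ b := hPP.trans hP
  have hNs : ∀ c ∈ 𝒩, c ⊆ K ∪ (a ∪ b) \ P' := fun c hc => hN ▸ subset_sUnion_of_mem hc
  have hKE : Disjoint K E := by
    rw [Set.disjoint_left]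
    intro x hx hxE
    by_cases hxab : x ∈ a ∪ b
    · exact Set.disjoint_left.1 habE hxab hxE
    · exact Set.disjoint_left.1 h.disjoint (hKG ⟨hx, hxab⟩) hxE
  have hK' : ∀ x ∈ K, x ∉ G → x ∈ a ∪ b := fun x hx hxG => by
    by_contra hc; exact hxG (hKG ⟨hx, hc⟩)
  have hold : ∀ c ∈ (𝒜.erase a).erase b, c ∈ 𝒜 ∧ Disjoint c (a ∪ b) := by
    intro c hc
    simp only [Finset.mem_erase] at hc
    exact ⟨hc.2.2, disjoint_union_right.2 ⟨h.pairwise c hc.2.2 a ha hc.2.1,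
      h.pairwise c hc.2.2 b hb hc.1⟩⟩
  have hG'o : IsOpen (G \ (W ∪ (K ∪ P))) := h.isOpen_left.sdiff hRc
  have hadh : ∀ x ∉ W ∪ (K ∪ P), x ∈ closure G → x ∈ closure (G \ (W ∪ (K ∪ P))) := by
    intro x hx hxG
    rw [mem_closure_iff_nhds] at hxG ⊢
    intro t ht
    obtain ⟨y, ⟨hy1, hy2⟩, hy3⟩ := hxG _ (Filter.inter_mem ht (hRc.isOpen_compl.mem_nhds hx))
    exact ⟨y, hy1, hy3, hy2⟩
  have hadhK : ∀ x ∈ K ∪ P, x ∈ G → x ∈ closure (G \ (W ∪ (K ∪ P))) := by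
    intro x hx hxG
    have := hcl' hx
    rw [mem_closure_iff_nhds] at this ⊢
    intro t ht
    obtain ⟨y, ⟨hy1, hy2⟩, hy3⟩ := this _ (Filter.inter_mem ht (h.isOpen_left.mem_nhds hxG))
    exact ⟨y, hy1, hy2, fun hh => hh.elim (fun h' => Set.disjoint_left.1 hWW' h' hy3)
      (fun h' => Set.disjoint_left.1 hW'J hy3 h')⟩
  have hadhK2 : K ⊆ closure (G \ (W ∪ (K ∪ P))) := by
    refine hKd.trans (closure_minimal ?_ isClosed_closure)
    exact fun x hx => hadhK x (Or.inl hx.1) (hKG hx)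
  have hE'o : IsOpen (E ∪ W ∪ P') := by
    rw [isOpen_iff_mem_nhds]
    rintro x (hx | hx)
    · exact Filter.mem_of_superset ((h.isOpen_right.union hW).mem_nhds hx) subset_union_left
    · obtain ⟨c, hc, hcab, hxc⟩ : ∃ c ∈ 𝒜, c ⊆ a ∪ b ∧ x ∈ c := by
        rcases hP'ab hx with hx | hx
        exacts [⟨a, ha, subset_union_left, hx⟩, ⟨b, hb, subset_union_right, hx⟩]
      obtain ⟨U, hU, hcU, hUc⟩ := h.exists_nhds hc
      have hU2 : U ∩ (K ∪ (a ∪ b) \ P')ᶜ ∈ 𝓝 x := Filter.inter_mem (hU.mem_nhds (hcU hxc))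
        ((hK.union hL).isOpen_compl.mem_nhds fun hh => hh.elim
          (fun h' => Set.disjoint_left.1 hKP h' hx) (fun h' => h'.2 hx))
      have hxn : x ∉ closure (G \ (W ∪ (K ∪ P))) := by
        intro hxcl
        refine (h.isLoop c hc).no_three_sides hxc (Set.disjoint_left.1 (h.disjoint_Bd c hc) hxc)
          hU2 (V := ![G \ (W ∪ (K ∪ P)), E, W]) ?_ ?_ ?_ ?_ ?_
        · intro i; fin_cases i
          exacts [hG'o, h.isOpen_right, hW]
        · intro i; fin_cases i
          exacts [hxcl, h.subset_right c hc hxc, hcl.symm ▸ Or.inr (Or.inr (hPP hx))]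
        · have e1 : Disjoint (G \ (W ∪ (K ∪ P))) E := h.disjoint.mono_left sdiff_subset
          have e2 : Disjoint (G \ (W ∪ (K ∪ P))) W := disjoint_sdiff_left.mono_right subset_union_left
          have e3 : Disjoint E W := h.disjoint.symm.mono_right hWG
          intro i j hij
          fin_cases i <;> fin_cases j <;> first | exact absurd rfl hij | skip
          exacts [e1, e2, e1.symm, e3, e2.symm, e3.symm]
        · intro i; fin_cases i
          exacts [(h.disjoint_left c hc).symm.mono_left sdiff_subset, (h.disjoint_right c hc).symm,
            (h.disjoint_left c hc).symm.mono_left hWG]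
        · rintro y ⟨⟨hy, hy'⟩, hyc⟩
          rcases hUc y hy with hyG | hyE | hyc'
          · by_cases hyR : y ∈ W ∪ (K ∪ P)
            · rcases hyR with hyW | hyK | hyP
              · exact mem_iUnion.2 ⟨2, hyW⟩
              · exact absurd (Or.inl hyK) hy'
              · exact absurd hyG (Set.disjoint_left.1 habG (hP hyP))
            · exact mem_iUnion.2 ⟨0, hyG, hyR⟩
          · exact mem_iUnion.2 ⟨1, hyE⟩
          · exact absurd hyc' hyc
      filter_upwards [hU2, isClosed_closure.isOpen_compl.mem_nhds hxn]
      rintro y ⟨hy, hy'⟩ hyG'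
      rcases hUc y hy with hyG | hyE | hyc'
      · by_cases hyR : y ∈ W ∪ (K ∪ P)
        · rcases hyR with hyW | hyK | hyP
          · exact Or.inl (Or.inr hyW)
          · exact absurd (Or.inl hyK) hy'
          · exact absurd hyG (Set.disjoint_left.1 habG (hP hyP))
        · exact absurd (subset_closure (show y ∈ G \ (W ∪ (K ∪ P)) from ⟨hyG, hyR⟩)) hyG'
      · exact Or.inl (Or.inl hyE)
      · by_contra hcon
        exact hy' (Or.inr ⟨hcab hyc', fun hh => hcon (Or.inr hh)⟩)
  have hNR : ∀ c ∈ 𝒩, Disjoint c (G \ (W ∪ (K ∪ P))) := by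
    intro c hc
    refine Disjoint.mono_left (hNs c hc) (disjoint_union_left.2 ⟨?_, ?_⟩)
    · exact disjoint_sdiff_right.mono_left fun x hx => Or.inr (Or.inl hx)
    · exact (habG.mono_left sdiff_subset).mono_right sdiff_subset
  have hNE : ∀ c ∈ 𝒩, Disjoint c (E ∪ W ∪ P') := by
    intro c hc
    refine Disjoint.mono_left (hNs c hc) (disjoint_union_left.2 ⟨?_, ?_⟩)
    · exact disjoint_union_right.2 ⟨disjoint_union_right.2 ⟨hKE,
        (hWJ.mono_right subset_union_left).symm⟩, hKP⟩
    · exact disjoint_union_right.2 ⟨disjoint_union_right.2 ⟨habE.mono_left sdiff_subset,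
        (habG.mono_left sdiff_subset).mono_right hWG⟩, disjoint_sdiff_left⟩
  have hoN : ∀ c ∈ (𝒜.erase a).erase b, ∀ d ∈ 𝒩, Disjoint c d := by
    intro c hc d hd
    refine Disjoint.mono_right (hNs d hd) (disjoint_union_right.2 ⟨?_, (hold c hc).2.mono_right
      sdiff_subset⟩)
    rw [Set.disjoint_left]
    intro x hx hxK
    exact Set.disjoint_left.1 (hold c hc).2 hx
      (hK' x hxK (Set.disjoint_left.1 (h.disjoint_left c (hold c hc).1) hx))
  have hoR : ∀ c ∈ (𝒜.erase a).erase b, ∀ x ∈ c, x ∉ W ∪ (K ∪ P) := by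
    intro c hc x hx hxR
    have hxG := Set.disjoint_left.1 (h.disjoint_left c (hold c hc).1) hx
    have hxab := Set.disjoint_left.1 (hold c hc).2 hx
    rcases hxR with hh | hh | hh
    exacts [hxG (hWG hh), hxab (hK' x hh hxG), hxab (hP hh)]
  refine ⟨hG'o, hE'o, ?_, ?_, ?_, ?_, ?_, ?_, ?_, ?_, ?_⟩
  · refine disjoint_union_right.2 ⟨disjoint_union_right.2 ⟨h.disjoint.mono_left sdiff_subset,
      disjoint_sdiff_left.mono_right subset_union_left⟩, disjoint_sdiff_left.mono_right
      fun x hx => Or.inr (Or.inr (hPP hx))⟩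
  · intro c hc
    rcases Finset.mem_union.1 hc with hc | hc
    exacts [h.isLoop c (hold c hc).1, hNl c hc]
  · intro c hc
    rcases Finset.mem_union.1 hc with hc | hc
    · exact h.disjoint_Bd c (hold c hc).1
    · exact Disjoint.mono_left (hNs c hc) (disjoint_union_left.2 ⟨hKB, Disjoint.mono_left
        sdiff_subset (disjoint_union_left.2 ⟨h.disjoint_Bd a ha, h.disjoint_Bd b hb⟩)⟩)
  · intro c hc
    rcases Finset.mem_union.1 hc with hc | hc
    exacts [(h.disjoint_left c (hold c hc).1).mono_right sdiff_subset, hNR c hc]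
  · intro c hc
    rcases Finset.mem_union.1 hc with hc | hc
    · exact disjoint_union_right.2 ⟨disjoint_union_right.2 ⟨h.disjoint_right c (hold c hc).1,
        (h.disjoint_left c (hold c hc).1).mono_right hWG⟩, (hold c hc).2.mono_right hP'ab⟩
    · exact hNE c hc
  · intro c hc d hd hcd
    rcases Finset.mem_union.1 hc with hc | hc <;> rcases Finset.mem_union.1 hd with hd | hd
    exacts [h.pairwise c (hold c hc).1 d (hold d hd).1 hcd, hoN c hc d hd, (hoN d hd c hc).symm,
      hNp c hc d hd hcd]
  · intro x
    have hmN : x ∈ K ∪ (a ∪ b) \ P' → ∃ c ∈ (𝒜.erase a).erase b ∪ 𝒩, x ∈ c := by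
      intro hx
      rw [← hN] at hx
      obtain ⟨c, hc, hxc⟩ := hx
      exact ⟨c, Finset.mem_union_right _ hc, hxc⟩
    have hmab : x ∈ a ∪ b → x ∈ E ∪ W ∪ P' ∨ ∃ c ∈ (𝒜.erase a).erase b ∪ 𝒩, x ∈ c := by
      intro hx
      by_cases hxP : x ∈ P'
      exacts [Or.inl (Or.inr hxP), Or.inr (hmN (Or.inr ⟨hx, hxP⟩))]
    rcases h.cover x with hx | hx | ⟨c, hc, hxc⟩
    · by_cases hxR : x ∈ W ∪ (K ∪ P)
      · rcases hxR with hh | hh | hh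
        · exact Or.inr (Or.inl (Or.inl (Or.inr hh)))
        · exact Or.inr (Or.inr (hmN (Or.inl hh)))
        · exact Or.inr (hmab (hP hh))
      · exact Or.inl ⟨hx, hxR⟩
    · exact Or.inr (Or.inl (Or.inl (Or.inl hx)))
    · right
      by_cases hca : c = a
      · exact hmab (Or.inl (hca ▸ hxc))
      by_cases hcb : c = b
      · exact hmab (Or.inr (hcb ▸ hxc))
      · exact Or.inr ⟨c, Finset.mem_union_left _ (by simp [hca, hcb, hc]), hxc⟩
  · intro c hc
    rcases Finset.mem_union.1 hc with hc | hc
    · exact fun x hx => hadh x (hoR c hc x hx) (h.subset_left c (hold c hc).1 hx)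
    · intro x hx
      rcases hNs c hc hx with hxK | ⟨hxab, hxP⟩
      · exact hadhK2 hxK
      · by_cases hxR : x ∈ W ∪ (K ∪ P)
        · rcases hxR with hh | hh | hh
          · exact absurd (hWG hh) (Set.disjoint_left.1 habG hxab)
          · exact hadhK2 hh
          · exact hadhK2 (hPK ⟨hh, hxP⟩)
        · refine hadh x hxR ?_
          rcases hxab with hh | hh
          exacts [h.subset_left a ha hh, h.subset_left b hb hh]
  · have hsub : E ⊆ E ∪ W ∪ P' := fun x hx => Or.inl (Or.inl hx)
    intro c hc
    rcases Finset.mem_union.1 hc with hc | hc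
    · exact (h.subset_right c (hold c hc).1).trans (closure_mono hsub)
    · intro x hx
      rcases hNs c hc hx with hxK | ⟨hxab | hxab, -⟩
      · have : x ∈ closure W := hcl.symm ▸ Or.inr (Or.inl hxK)
        exact closure_mono (fun y hy => Or.inl (Or.inr hy)) this
      · exact closure_mono hsub (h.subset_right a ha hxab)
      · exact closure_mono hsub (h.subset_right b hb hxab)

end IsState

namespace IsState

variable {S : Type*} [TopologicalSpace S] {𝒜 : Finset (Set S)} {G E : Set S}

open Classical in
theorem ribbon_of_arc [T2Space S] (h : IsState 𝒜 G E) {a b : Set S} (ha : a ∈ 𝒜) (hb : b ∈ 𝒜)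
    {ψ : ℂ → S} (hψ : IsOpenEmbedding ψ) {M : Set ℂ} (hM : IsOpen M) (hMc : Convex ℝ M)
    (hMe : segment ℝ (0 : ℂ) 1 ⊆ M) (hMo : ∀ c ∈ 𝒜, c ≠ a → c ≠ b → Disjoint c (ψ '' M))
    (hseg : ∀ z ∈ segment ℝ (0 : ℂ) 1, z ≠ 0 → z ≠ 1 → ψ z ∈ G) (h0a : ψ 0 ∈ a) (h1b : ψ 1 ∈ b)
    {u v : ℂ} {C : Set ℂ} (hC : IsArc C u v) (hCM : C ⊆ M)
    (hCG : C \ {u, v} ⊆ ψ ⁻¹' G \ segment ℝ (0 : ℂ) 1) {Pu Pv : Set S}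
    (hPu : IsArc Pu (ψ 0) (ψ u)) (hPv : IsArc Pv (ψ 1) (ψ v)) (hPua : Pu ⊆ a) (hPvb : Pv ⊆ b)
    (hPuM : Pu ⊆ ψ '' M) (hPvM : Pv ⊆ ψ '' M) (hPd : Disjoint Pu Pv) {L : Set S}
    (hL : IsClosed L) (hLab : L ∪ (Pu ∪ Pv) = a ∪ b)
    (hLP : L ∩ (Pu ∪ Pv) = {ψ 0, ψ u, ψ 1, ψ v})
    (hLc : ∀ x ∈ L \ {ψ 0, ψ u, ψ 1, ψ v}, ∃ Q, IsPreconnected Q ∧ x ∈ Q ∧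
      Q ⊆ L \ {ψ 0, ψ u, ψ 1, ψ v} ∧ ∃ w ∈ Q, w ∉ ψ '' M)
    {𝒩 : Finset (Set S)} (hN : ⋃₀ (𝒩 : Set (Set S)) = ψ '' (segment ℝ 0 1 ∪ C) ∪ L)
    (hNl : ∀ c ∈ 𝒩, IsLoop c) (hNp : ∀ c ∈ 𝒩, ∀ d ∈ 𝒩, c ≠ d → Disjoint c d) :
    ∃ R : Set ℂ, IsCompact R ∧ IsPreconnected R ∧ segment ℝ 0 1 ⊆ R ∧ R ⊆ M ∧
      ∃ E', IsState ((𝒜.erase a).erase b ∪ 𝒩) (G \ ψ '' R) E' := by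
  set e := segment ℝ (0 : ℂ) 1 with he
  have heA : IsArc e 0 1 := IsArc.segment zero_ne_one
  have habG : Disjoint (a ∪ b) G :=
    disjoint_union_left.2 ⟨h.disjoint_left a ha, h.disjoint_left b hb⟩
  have hPab : Pu ∪ Pv ⊆ a ∪ b := union_subset_union hPua hPvb
  have hPr : Pu ∪ Pv ⊆ range ψ := union_subset (hPuM.trans (image_subset_range _ _))
    (hPvM.trans (image_subset_range _ _))
  have hcorner : ∀ z ∈ e ∪ C, ψ z ∈ a ∪ b → ψ z ∈ ({ψ 0, ψ u, ψ 1, ψ v} : Set S) := by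
    intro z hz hzab
    have hzG := Set.disjoint_left.1 habG hzab
    rcases hz with hz | hz
    · by_cases h0 : z = 0
      · simp [h0]
      by_cases h1 : z = 1
      · simp [h1]
      exact absurd (hseg z hz h0 h1) hzG
    · by_cases h0 : z = u
      · simp [h0]
      by_cases h1 : z = v
      · simp [h1]
      exact absurd (hCG ⟨hz, by simp [h0, h1]⟩).1 hzG
  have huv : ∀ z ∈ C, ψ z ∈ a ∪ b → z = u ∨ z = v := by
    intro z hz hzab
    by_contra hcon
    exact Set.disjoint_left.1 habG hzab (hCG ⟨hz, by simpa using hcon⟩).1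
  have h01 : ∀ z ∈ e, ψ z ∈ a ∪ b → z = 0 ∨ z = 1 := by
    intro z hz hzab
    by_contra hcon
    push Not at hcon
    exact Set.disjoint_left.1 habG hzab (hseg z hz hcon.1 hcon.2)
  have hPu' := hPu.preimage hψ (subset_union_left.trans hPr)
  have hPv' := hPv.preimage hψ (subset_union_right.trans hPr)
  set B := ψ ⁻¹' Pu ∪ C ∪ ψ ⁻¹' Pv with hB
  have hBA : IsArc B 0 1 := by
    refine (hPu'.trans hC ?_).trans hPv'.symm ?_
    · rintro z ⟨hz, hzC⟩
      rcases huv z hzC (Or.inl (hPua hz)) with rfl | rfl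
      · rfl
      · exact absurd hPv.right_mem (Set.disjoint_left.1 hPd hz)
    · rintro z ⟨hz | hz, hzv⟩
      · exact absurd hzv (Set.disjoint_left.1 hPd hz)
      · rcases huv z hz (Or.inr (hPvb hzv)) with rfl | rfl
        · exact absurd hzv (Set.disjoint_left.1 hPd hPu.right_mem)
        · rfl
  have hBe : B ∩ e = {0, 1} := by
    apply Subset.antisymm
    · rintro z ⟨(hz | hz) | hz, hze⟩
      · exact h01 z hze (Or.inl (hPua hz))
      · by_cases hzuv : z ∈ ({u, v} : Set ℂ)
        · rcases hzuv with rfl | hzv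
          · exact h01 z hze (Or.inl (hPua hPu.right_mem))
          · rw [mem_singleton_iff] at hzv
            subst hzv
            exact h01 z hze (Or.inr (hPvb hPv.right_mem))
        · exact absurd hze (hCG ⟨hz, hzuv⟩).2
      · exact h01 z hze (Or.inr (hPvb hz))
    · rintro z (rfl | rfl)
      · exact ⟨hBA.left_mem, heA.left_mem⟩
      · exact ⟨hBA.right_mem, heA.right_mem⟩
  obtain ⟨W, W', hW, hW', hWp, hWne, hWW', hWJ, hW'J, hfW, hfW', hWconv⟩ := jordan hBA hBe
  set J := e ∪ B with hJ
  have hJc : IsCompact J := heA.isCompact.union hBA.isCompact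
  have hJM : J ⊆ M := by
    refine union_subset hMe (union_subset (union_subset ?_ hCM) ?_)
    · exact fun z hz => (hψ.injective.mem_set_image).1 (hPuM hz)
    · exact fun z hz => (hψ.injective.mem_set_image).1 (hPvM hz)
  have hWM : W ⊆ M := hWconv M hMc hM hJM
  have hclW : closure W = W ∪ J := by rw [closure_eq_self_union_frontier, hfW]
  have hclWc : IsCompact (closure W) := by
    obtain ⟨r, hr⟩ := hJc.isBounded.subset_ball (0 : ℂ)
    exact (Metric.isBounded_ball.subset
      (hWconv _ (convex_ball 0 r) Metric.isOpen_ball hr)).isCompact_closure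
  have hJψ : ψ '' J = ψ '' (e ∪ C) ∪ (Pu ∪ Pv) := by
    rw [hJ, hB, union_comm (ψ ⁻¹' Pu) C, union_assoc, ← union_assoc e, image_union, ← preimage_union,
      image_preimage_eq_of_subset hPr]
  have hclψ : closure (ψ '' W) = ψ '' closure W := by
    refine Subset.antisymm (closure_minimal (image_mono subset_closure)
      (hclWc.image hψ.continuous).isClosed) (image_closure_subset_closure_image hψ.continuous)
  have hcorJ : ∀ x ∈ ψ '' J, x ∈ L → x ∈ ({ψ 0, ψ u, ψ 1, ψ v} : Set S) := by
    intro x hx hxL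
    rw [hJψ] at hx
    rcases hx with ⟨z, hz, rfl⟩ | hx
    · exact hcorner z hz (hLab ▸ Or.inl hxL)
    · rw [← hLP]; exact ⟨hxL, hx⟩
  have hcorJ' : ({ψ 0, ψ u, ψ 1, ψ v} : Set S) ⊆ ψ '' (e ∪ C) := by
    rintro x (rfl | rfl | rfl | rfl)
    exacts [⟨_, Or.inl heA.left_mem, rfl⟩, ⟨_, Or.inr hC.left_mem, rfl⟩,
      ⟨_, Or.inl heA.right_mem, rfl⟩, ⟨_, Or.inr hC.right_mem, rfl⟩]
  have hWJψ : Disjoint (ψ '' W) (ψ '' J) := (disjoint_image_iff hψ.injective).2 hWJ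
  have hLW : Disjoint L (ψ '' W) := by
    rw [Set.disjoint_left]
    intro x hxL hxW
    have hx4 : x ∉ ({ψ 0, ψ u, ψ 1, ψ v} : Set S) := fun hx =>
      Set.disjoint_left.1 hWJψ hxW (by rw [hJψ]; exact Or.inl (hcorJ' hx))
    obtain ⟨Q, hQ, hxQ, hQL, w, hwQ, hwM⟩ := hLc x ⟨hxL, hx4⟩
    refine hwM (image_mono hWM ?_)
    refine (hQ.subset_left_of_subset_union (hψ.isOpenMap _ hW)
      (isClosed_closure (s := ψ '' W)).isOpen_compl
      (disjoint_compl_right.mono_left subset_closure) (fun y hy => ?_) ⟨x, hxQ, hxW⟩) hwQ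
    by_cases hyc : y ∈ closure (ψ '' W)
    · rw [hclψ, hclW, image_union] at hyc
      exact Or.inl (hyc.resolve_right fun hyJ => (hQL hy).2 (hcorJ y hyJ (hQL hy).1))
    · exact Or.inr hyc
  have hWcurves : ∀ c ∈ 𝒜, Disjoint c (ψ '' W) := by
    have hab : Disjoint (a ∪ b) (ψ '' W) := by
      rw [← hLab]
      refine disjoint_union_left.2 ⟨hLW, hWJψ.symm.mono_left ?_⟩
      rw [hJψ]; exact subset_union_right
    intro c hc
    by_cases hca : c = a
    · exact hab.mono_left (hca ▸ subset_union_left)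
    by_cases hcb : c = b
    · exact hab.mono_left (hcb ▸ subset_union_right)
    exact (hMo c hc hca hcb).mono_right (image_mono hWM)
  have hWG : ψ '' W ⊆ G := by
    refine (hWp.image _ hψ.continuous.continuousOn).subset_left_of_subset_union h.isOpen_left
      h.isOpen_right h.disjoint ?_ ?_
    · intro x hx
      rcases h.cover x with hh | hh | ⟨c, hc, hxc⟩
      exacts [Or.inl hh, Or.inr hh, absurd hx (Set.disjoint_left.1 (hWcurves c hc) hxc)]
    · have hhalf : (1 / 2 : ℂ) ∈ e := mem_segment_zero_one.2 (by constructor <;> norm_num)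
      have hhG : ψ (1 / 2) ∈ G := hseg _ hhalf (by norm_num) (by norm_num)
      have : (1 / 2 : ℂ) ∈ closure W := hclW ▸ Or.inr (Or.inl hhalf)
      obtain ⟨z, hz, hzW⟩ := mem_closure_iff_nhds.1 this _
        ((h.isOpen_left.preimage hψ.continuous).mem_nhds hhG)
      exact ⟨ψ z, ⟨z, hzW, rfl⟩, hz⟩
  have hPL : (a ∪ b) \ ((Pu ∪ Pv) \ L) = L := by
    rw [← hLab]
    ext x
    simp only [mem_sdiff, mem_union]
    tauto
  refine ⟨closure W, hclWc, hWp.closure, ?_, ?_, E ∪ ψ '' W ∪ (Pu ∪ Pv) \ L, ?_⟩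
  · rw [hclW]; exact fun z hz => Or.inr (Or.inl hz)
  · rw [hclW]; exact union_subset hWM hJM
  have := h.surgery ha hb (W := ψ '' W) (W' := ψ '' W') (K := ψ '' (e ∪ C)) (P := Pu ∪ Pv)
    (P' := (Pu ∪ Pv) \ L) (hψ.isOpenMap _ hW) hWG
    ((disjoint_image_iff hψ.injective).2 hWW') (hJψ ▸ hWJψ)
    (hJψ ▸ (disjoint_image_iff hψ.injective).2 hW'J) ?_ ?_ ?_ ?_ ?_ ?_ hPab sdiff_subset ?_ ?_ ?_
    (𝒩 := 𝒩) ?_ hNl hNp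
  · rwa [← hJψ, ← image_union, ← hclW] at this
  · rw [hclψ, hclW, image_union, hJψ]
  · rw [← hJψ, ← hfW']
    exact (image_mono frontier_subset_closure).trans
      (image_closure_subset_closure_image hψ.continuous)
  · exact ((heA.isCompact.union hC.isCompact).image hψ.continuous).isClosed
  · exact (disjoint_range_Bd hψ).mono_left (image_subset_range _ _)
  · rintro _ ⟨⟨z, hz | hz, rfl⟩, hzab⟩
    · refine hseg z hz ?_ ?_
      · rintro rfl; exact hzab (Or.inl h0a)
      · rintro rfl; exact hzab (Or.inr h1b)
    · refine (hCG ⟨hz, ?_⟩).1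
      rintro (rfl | hzv)
      · exact hzab (Or.inl (hPua hPu.right_mem))
      · rw [mem_singleton_iff] at hzv
        subst hzv
        exact hzab (Or.inr (hPvb hPv.right_mem))
  · have hd : e ∪ C ⊆ closure ((e \ {0, 1}) ∪ (C \ {u, v})) := by
      rw [closure_union]
      exact union_subset_union heA.subset_closure_interior hC.subset_closure_interior
    refine (image_mono hd).trans ((image_closure_subset_closure_image hψ.continuous).trans
      (closure_mono ?_))
    rintro _ ⟨z, hz | hz, rfl⟩
    · refine ⟨⟨z, Or.inl hz.1, rfl⟩, fun hzab => hz.2 (h01 z hz.1 hzab)⟩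
    · refine ⟨⟨z, Or.inr hz.1, rfl⟩, fun hzab => hz.2 (huv z hz.1 hzab)⟩
  · rw [sdiff_sdiff_right_self, inter_comm, hLP]
    exact hcorJ'
  · rw [Set.disjoint_left]
    rintro _ ⟨z, hz, rfl⟩ ⟨hzP, hzL⟩
    have := hcorner z hz (hPab hzP)
    rw [← hLP] at this
    exact hzL this.1
  · rwa [hPL]
  · rw [hPL, hN]

end IsState

section

variable {S : Type*} [TopologicalSpace S]

/-- A point of an arc near one end and a point near the other end cut it into three arcs. -/
theorem IsArc.shrink_both [T2Space S] {D : Set S} {p q : S} (hD : IsArc D p q) {V₀ V₁ : Set S}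
    (h₀ : V₀ ∈ 𝓝 p) (h₁ : V₁ ∈ 𝓝 q) :
    ∃ U₀ ∈ 𝓝 p, ∃ U₁ ∈ 𝓝 q, ∀ z ∈ D ∩ U₀, z ≠ p → ∀ w ∈ D ∩ U₁, w ≠ q →
      ∃ A₁ A₂ A₃, IsArc A₁ p z ∧ IsArc A₂ z w ∧ IsArc A₃ q w ∧ A₁ ∪ A₂ ∪ A₃ = D ∧
        A₁ ∩ A₂ = {z} ∧ A₂ ∩ A₃ = {w} ∧ Disjoint A₁ A₃ ∧ A₁ ⊆ V₀ ∧ A₃ ⊆ V₁ := by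
  obtain ⟨m, hm, hmpq⟩ := hD.interior_nonempty
  simp only [mem_insert_iff, mem_singleton_iff, not_or] at hmpq
  obtain ⟨E₁, E₂, hE₁, hE₂, hU, hI⟩ := hD.split hm hmpq.1 hmpq.2
  have hp2 : p ∉ E₂ := fun hp => hmpq.1 (by
    have : p ∈ E₁ ∩ E₂ := ⟨hE₁.left_mem, hp⟩
    rw [hI] at this; exact this.symm)
  have hq1 : q ∉ E₁ := fun hq => hmpq.2 (by
    have : q ∈ E₁ ∩ E₂ := ⟨hq, hE₂.right_mem⟩
    rw [hI] at this; exact this.symm)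
  obtain ⟨U₀, hU₀, hz⟩ := hE₁.shrink (Filter.inter_mem h₀ (hE₂.isClosed.isOpen_compl.mem_nhds hp2))
  obtain ⟨U₁, hU₁, hw⟩ :=
    hE₂.symm.shrink (Filter.inter_mem h₁ (hE₁.isClosed.isOpen_compl.mem_nhds hq1))
  refine ⟨U₀ ∩ E₂ᶜ, Filter.inter_mem hU₀ (hE₂.isClosed.isOpen_compl.mem_nhds hp2),
    U₁ ∩ E₁ᶜ, Filter.inter_mem hU₁ (hE₁.isClosed.isOpen_compl.mem_nhds hq1), ?_⟩
  rintro z ⟨hzD, hzU, hz2⟩ hzp w ⟨hwD, hwU, hw1⟩ hwq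
  have hzE : z ∈ E₁ := by rw [← hU] at hzD; exact hzD.resolve_right hz2
  have hwE : w ∈ E₂ := by rw [← hU] at hwD; exact hwD.resolve_left hw1
  obtain ⟨-, A₁, A₂, hA₁, hA₂, hAU, hAI, hAV⟩ := hz z ⟨hzE, hzU⟩ hzp
  obtain ⟨-, B₁, B₂, hB₁, hB₂, hBU, hBI, hBV⟩ := hw w ⟨hwE, hwU⟩ hwq
  have hA1 : A₁ ⊆ E₁ := hAU ▸ subset_union_left
  have hA2 : A₂ ⊆ E₁ := hAU ▸ subset_union_right
  have hB1 : B₁ ⊆ E₂ := hBU ▸ subset_union_left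
  have hB2 : B₂ ⊆ E₂ := hBU ▸ subset_union_right
  refine ⟨A₁, A₂ ∪ B₂, B₁, hA₁, hA₂.trans hB₂.symm ?_, hB₁, ?_, ?_, ?_, ?_, ?_, ?_⟩
  · rw [← hI]; exact inter_subset_inter hA2 hB2
  · rw [← hU, ← hAU, ← hBU]
    ext; simp only [mem_union]; tauto
  · refine Subset.antisymm ?_ ?_
    · rintro x ⟨hx1, hx2 | hx2⟩
      · rw [← hAI]; exact ⟨hx1, hx2⟩
      · exact absurd (hB2 hx2) (hAV hx1).2
    · rintro _ rfl
      exact ⟨hA₁.right_mem, Or.inl hA₂.left_mem⟩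
  · refine Subset.antisymm ?_ ?_
    · rintro x ⟨hx1 | hx1, hx2⟩
      · exact absurd (hA2 hx1) (hBV hx2).2
      · rw [← hBI]; exact ⟨hx2, hx1⟩
    · rintro _ rfl
      exact ⟨Or.inr hB₂.left_mem, hB₁.right_mem⟩
  · exact Set.disjoint_left.2 fun x hx hx' => (hAV hx).2 (hB1 hx')
  · exact hAV.trans inter_subset_left
  · exact hBV.trans inter_subset_left

/-- A point of a loop near a given point cuts off a small arc. -/
theorem IsLoop.shrink [T2Space S] {a : Set S} (ha : IsLoop a) {p : S} (hp : p ∈ a) {V : Set S}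
    (hV : V ∈ 𝓝 p) :
    ∃ U ∈ 𝓝 p, ∀ z ∈ a ∩ U, z ≠ p → ∃ X Y, IsArc X p z ∧ IsArc Y p z ∧ X ∩ Y = {p, z} ∧
      X ∪ Y = a ∧ X ⊆ V := by
  obtain ⟨q, hq, hqp⟩ := ha.exists_ne p
  obtain ⟨A, B, hA, hB, hAB, hABa⟩ := ha.cut hp hq hqp.symm
  have key : ∀ A B : Set S, IsArc A p q → IsArc B p q → A ∩ B = {p, q} → A ∪ B = a →
      ∃ U ∈ 𝓝 p, ∀ z ∈ A ∩ U, z ≠ p → ∃ X Y, IsArc X p z ∧ IsArc Y p z ∧ X ∩ Y = {p, z} ∧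
        X ∪ Y = a ∧ X ⊆ V := by
    intro A B hA hB hAB hABa
    obtain ⟨U, hU, h⟩ := hA.shrink hV
    refine ⟨U, hU, fun z hz hzp => ?_⟩
    obtain ⟨hzq, A₁, A₂, h1, h2, h3, h4, h5⟩ := h z hz hzp
    have hA1 : A₁ ⊆ A := h3 ▸ subset_union_left
    have hA2 : A₂ ⊆ A := h3 ▸ subset_union_right
    have hq1 : q ∉ A₁ := fun hq => hzq (by
      have : q ∈ A₁ ∩ A₂ := ⟨hq, h2.right_mem⟩
      rw [h4] at this; exact this.symm)
    have hp2 : p ∉ A₂ := fun hp => hzp (by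
      have : p ∈ A₁ ∩ A₂ := ⟨h1.left_mem, hp⟩
      rw [h4] at this; exact this.symm)
    refine ⟨A₁, B ∪ A₂, h1, hB.trans h2.symm ?_, Subset.antisymm ?_ ?_, ?_, h5⟩
    · rintro x ⟨hxB, hxA⟩
      have : x ∈ A ∩ B := ⟨hA2 hxA, hxB⟩
      rw [hAB] at this
      rcases this with rfl | h
      · exact absurd hxA hp2
      · exact h
    · rintro x ⟨hx1, hx2 | hx2⟩
      · have : x ∈ A ∩ B := ⟨hA1 hx1, hx2⟩
        rw [hAB] at this
        rcases this with rfl | h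
        · exact Or.inl rfl
        · rw [mem_singleton_iff] at h
          subst h
          exact absurd hx1 hq1
      · have : x ∈ A₁ ∩ A₂ := ⟨hx1, hx2⟩
        rw [h4] at this
        exact Or.inr this
    · rintro x (rfl | hx)
      · exact ⟨h1.left_mem, Or.inl hB.left_mem⟩
      · rw [mem_singleton_iff] at hx
        subst hx
        exact ⟨h1.right_mem, Or.inr h2.left_mem⟩
    · rw [← hABa, ← h3]
      ext; simp only [mem_union]; tauto
  obtain ⟨U, hU, h⟩ := key A B hA hB hAB hABa
  obtain ⟨U', hU', h'⟩ := key B A hB hA (by rw [inter_comm, hAB]) (by rw [union_comm, hABa])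
  refine ⟨U ∩ U', Filter.inter_mem hU hU', ?_⟩
  rintro z ⟨hza, hzU, hzU'⟩ hzp
  rw [← hABa] at hza
  rcases hza with hz | hz
  · exact h z ⟨hz, hzU⟩ hzp
  · exact h' z ⟨hz, hzU'⟩ hzp

theorem IsLoop.of_four_arcs [T2Space S] {X e Y C : Set S} {u s t v : S} (hX : IsArc X u s)
    (he : IsArc e s t) (hY : IsArc Y t v) (hC : IsArc C u v) (hXe : X ∩ e ⊆ {s})
    (heY : e ∩ Y ⊆ {t}) (hYC : Y ∩ C ⊆ {v}) (hXC : X ∩ C ⊆ {u}) (hXY : Disjoint X Y)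
    (heC : Disjoint e C) : IsLoop (X ∪ e ∪ (C ∪ Y)) := by
  refine IsLoop.of_arcs (hX.trans he hXe) (hC.trans hY.symm ?_) ?_
  · rw [inter_comm]; exact hYC
  · rintro x ⟨hx | hx, hx' | hx'⟩
    · exact Or.inl (hXC ⟨hx, hx'⟩)
    · exact absurd hx' (Set.disjoint_left.1 hXY hx)
    · exact absurd hx' (Set.disjoint_left.1 heC hx)
    · exact Or.inr (heY ⟨hx, hx'⟩)

end

namespace IsState

variable {S : Type*} [TopologicalSpace S] {𝒜 : Finset (Set S)} {G E : Set S}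

theorem exists_convex_nhd [T2Space S] (h : IsState 𝒜 G E) {a b : Set S} {ψ : ℂ → S}
    (hψ : IsOpenEmbedding ψ) (ha : a ∈ 𝒜) (hb : b ∈ 𝒜)
    (hseg : ∀ z ∈ segment ℝ (0 : ℂ) 1, z ≠ 0 → z ≠ 1 → ψ z ∈ G) (h0a : ψ 0 ∈ a) (h1b : ψ 1 ∈ b)
    {V : Set ℂ} (hV : IsOpen V) (hVe : segment ℝ (0 : ℂ) 1 ⊆ V) {F : Set S} (hF : IsClosed F)
    (hFe : Disjoint F (ψ '' segment ℝ 0 1)) :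
    ∃ M, IsOpen M ∧ Convex ℝ M ∧ segment ℝ (0 : ℂ) 1 ⊆ M ∧ M ⊆ V ∧
      (∀ c ∈ 𝒜, c ≠ a → c ≠ b → Disjoint c (ψ '' M)) ∧ Disjoint F (ψ '' M) := by
  set O := ⋃ c ∈ {c | c ∈ 𝒜 ∧ c ≠ a ∧ c ≠ b}, c with hO
  have hOc : IsClosed O := by
    apply Set.Finite.isClosed_biUnion ((Finset.finite_toSet 𝒜).subset fun b hb => hb.1)
    exact fun b hb => (h.isLoop b hb.1).isClosed
  have hOe : ∀ z ∈ segment ℝ (0 : ℂ) 1, ψ z ∉ O ∪ F := by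
    rintro z hz (hz' | hz')
    · obtain ⟨c, hc, hzc⟩ := mem_iUnion₂.1 hz'
      by_cases h0 : z = 0
      · subst h0
        exact Set.disjoint_left.1 (h.pairwise c hc.1 a ha hc.2.1) hzc h0a
      by_cases h1 : z = 1
      · subst h1
        exact Set.disjoint_left.1 (h.pairwise c hc.1 b hb hc.2.2) hzc h1b
      exact Set.disjoint_left.1 (h.disjoint_left c hc.1) hzc (hseg z hz h0 h1)
    · exact Set.disjoint_left.1 hFe hz' ⟨z, hz, rfl⟩
  obtain ⟨δ, hδ, hδV⟩ := (IsArc.segment (zero_ne_one (α := ℂ))).isCompact.exists_thickening_subset_open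
    (hV.inter ((hOc.union hF).isOpen_compl.preimage hψ.continuous))
    (fun z hz => ⟨hVe hz, hOe z hz⟩)
  refine ⟨_, Metric.isOpen_thickening, (convex_segment _ _).thickening δ,
    Metric.self_subset_thickening hδ _, fun z hz => (hδV hz).1, ?_, ?_⟩
  · intro c hc hca hcb
    rw [Set.disjoint_left]
    rintro _ hx ⟨z, hz, rfl⟩
    exact (hδV hz).2 (Or.inl (mem_iUnion₂.2 ⟨c, ⟨hc, hca, hcb⟩, hx⟩))
  · rw [Set.disjoint_left]
    rintro _ hx ⟨z, hz, rfl⟩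
    exact (hδV hz).2 (Or.inr hx)

theorem exists_parallel [T2Space S] (h : IsState 𝒜 G E) {a b : Set S} {ψ : ℂ → S}
    (hψ : IsOpenEmbedding ψ) (ha : a ∈ 𝒜) (hb : b ∈ 𝒜)
    (hseg : ∀ z ∈ segment ℝ (0 : ℂ) 1, z ≠ 0 → z ≠ 1 → ψ z ∈ G) (h0a : ψ 0 ∈ a) (h1b : ψ 1 ∈ b)
    {M : Set ℂ} (hM : IsOpen M) (hMe : segment ℝ (0 : ℂ) 1 ⊆ M) {U₀ U₁ : Set S}
    (hU₀ : U₀ ∈ 𝓝 (ψ 0)) (hU₁ : U₁ ∈ 𝓝 (ψ 1)) :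
    ∃ u v C, ψ u ∈ a ∩ U₀ ∧ ψ v ∈ b ∩ U₁ ∧ ψ u ≠ ψ 0 ∧ ψ v ≠ ψ 1 ∧ IsArc C u v ∧ C ⊆ M ∧
      C \ {u, v} ⊆ ψ ⁻¹' G \ segment ℝ (0 : ℂ) 1 := by
  have hAc : IsClosed (⋃ c ∈ (𝒜 : Set (Set S)), c) :=
    Set.Finite.isClosed_biUnion (Finset.finite_toSet 𝒜) fun b hb => (h.isLoop b hb).isClosed
  have hmem : ∀ c ∈ 𝒜, ∀ x ∈ c, x ∈ ⋃ c ∈ (𝒜 : Set (Set S)), c :=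
    fun c hc x hx => mem_iUnion₂.2 ⟨c, hc, hx⟩
  have hoth : ∀ c ∈ 𝒜, ∀ x ∈ c, (⋃ b ∈ {b | b ∈ 𝒜 ∧ b ≠ c}, b)ᶜ ∈ 𝓝 x := by
    intro c hc x hx
    refine (h.isClosed_others c).isOpen_compl.mem_nhds fun hx' => ?_
    obtain ⟨d, hd, hxd⟩ := mem_iUnion₂.1 hx'
    exact Set.disjoint_left.1 (h.pairwise d hd.1 c hc hd.2) hxd hx
  have huniq : ∀ c ∈ 𝒜, ∀ x ∈ ⋃ c ∈ (𝒜 : Set (Set S)), c,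
      x ∈ (⋃ b ∈ {b | b ∈ 𝒜 ∧ b ≠ c}, b)ᶜ → x ∈ c := by
    intro c hc x hx hx'
    obtain ⟨d, hd, hxd⟩ := mem_iUnion₂.1 hx
    by_cases hdc : d = c
    · exact hdc ▸ hxd
    · exact absurd (mem_iUnion₂.2 ⟨d, ⟨hd, hdc⟩, hxd⟩) hx'
  obtain ⟨u, hu, v, hv, hu0, hv1, C, hC, hCM, hCG⟩ := exists_parallel_arc
    (h.isOpen_left.preimage hψ.continuous) (h.isOpen_right.preimage hψ.continuous)
    (hAc.preimage hψ.continuous) (h.disjoint.preimage ψ)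
    (Disjoint.preimage ψ (disjoint_iUnion₂_right.2 fun c hc => (h.disjoint_left c hc).symm))
    (Disjoint.preimage ψ (disjoint_iUnion₂_right.2 fun c hc => (h.disjoint_right c hc).symm))
    (fun z => by
      rcases h.cover (ψ z) with h' | h' | ⟨c, hc, hzc⟩
      · exact Or.inl h'
      · exact Or.inr (Or.inl h')
      · exact Or.inr (Or.inr (hmem c hc _ hzc)))
    (by rw [← hψ.preimage_closure]; exact h.subset_right a ha h0a)
    (by rw [← hψ.preimage_closure]; exact h.subset_right b hb h1b)
    hseg (hmem a ha _ h0a) (hmem b hb _ h1b) hM hMe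
    (hψ.continuous.continuousAt (Filter.inter_mem hU₀ (hoth a ha _ h0a)))
    (hψ.continuous.continuousAt (Filter.inter_mem hU₁ (hoth b hb _ h1b)))
  exact ⟨u, v, C, ⟨huniq a ha _ hu.1 hu.2.2, hu.2.1⟩, ⟨huniq b hb _ hv.1 hv.2.2, hv.2.1⟩,
    hψ.injective.ne hu0, hψ.injective.ne hv1, hC, hCM, hCG⟩

end IsState

namespace IsState

variable {S : Type*} [TopologicalSpace S] {𝒜 : Finset (Set S)} {G E : Set S}

section

variable {a b : Set S} {ψ : ℂ → S} {u v : ℂ} {C : Set ℂ}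

theorem segment_inter (h : IsState 𝒜 G E) (ha : a ∈ 𝒜) (hb : b ∈ 𝒜)
    (hseg : ∀ z ∈ segment ℝ (0 : ℂ) 1, z ≠ 0 → z ≠ 1 → ψ z ∈ G) :
    ∀ x ∈ ψ '' segment ℝ (0 : ℂ) 1, x ∈ a ∪ b → x = ψ 0 ∨ x = ψ 1 := by
  rintro _ ⟨z, hz, rfl⟩ hzab
  by_contra hcon
  push Not at hcon
  have hzG := hseg z hz (fun e => hcon.1 (by rw [e])) (fun e => hcon.2 (by rw [e]))
  rcases hzab with h' | h'
  · exact Set.disjoint_left.1 (h.disjoint_left a ha) h' hzG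
  · exact Set.disjoint_left.1 (h.disjoint_left b hb) h' hzG

theorem arc_inter (h : IsState 𝒜 G E) (ha : a ∈ 𝒜) (hb : b ∈ 𝒜)
    (hCG : C \ {u, v} ⊆ ψ ⁻¹' G \ segment ℝ (0 : ℂ) 1) :
    ∀ x ∈ ψ '' C, x ∈ a ∪ b → x = ψ u ∨ x = ψ v := by
  rintro _ ⟨z, hz, rfl⟩ hzab
  by_contra hcon
  push Not at hcon
  have hzG := (hCG ⟨hz, by
    rintro (rfl | hz')
    · exact hcon.1 rfl
    · rw [mem_singleton_iff] at hz'
      subst hz'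
      exact hcon.2 rfl⟩).1
  rcases hzab with h' | h'
  · exact Set.disjoint_left.1 (h.disjoint_left a ha) h' hzG
  · exact Set.disjoint_left.1 (h.disjoint_left b hb) h' hzG

theorem segment_disjoint_arc (h : IsState 𝒜 G E) (ha : a ∈ 𝒜) (hb : b ∈ 𝒜)
    (hψ : IsOpenEmbedding ψ)
    (hseg : ∀ z ∈ segment ℝ (0 : ℂ) 1, z ≠ 0 → z ≠ 1 → ψ z ∈ G)
    (hCG : C \ {u, v} ⊆ ψ ⁻¹' G \ segment ℝ (0 : ℂ) 1) {Pu Pv : Set S}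
    (hPu : IsArc Pu (ψ 0) (ψ u)) (hPv : IsArc Pv (ψ 1) (ψ v)) (hPua : Pu ⊆ a) (hPvb : Pv ⊆ b)
    (hPd : Disjoint Pu Pv) : Disjoint (ψ '' segment ℝ (0 : ℂ) 1) (ψ '' C) := by
  rw [disjoint_image_iff hψ.injective, Set.disjoint_left]
  intro z hz hzC
  by_cases hzuv : z ∈ ({u, v} : Set ℂ)
  · rcases hzuv with rfl | hzv
    · rcases h.segment_inter ha hb hseg (ψ z) ⟨z, hz, rfl⟩ (Or.inl (hPua hPu.right_mem)) with e | e
      · exact hPu.ne e.symm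
      · exact Set.disjoint_left.1 hPd hPu.right_mem (e ▸ hPv.left_mem)
    · rw [mem_singleton_iff] at hzv
      subst hzv
      rcases h.segment_inter ha hb hseg (ψ z) ⟨z, hz, rfl⟩ (Or.inr (hPvb hPv.right_mem)) with e | e
      · exact Set.disjoint_right.1 hPd hPv.right_mem (e ▸ hPu.left_mem)
      · exact hPv.ne e.symm
  · exact (hCG ⟨hzC, hzuv⟩).2 hz

open Classical in
/-- The ribbon surgery when the two remaining boundary arcs are joined into a single curve. -/
theorem ribbon_single [T2Space S] (h : IsState 𝒜 G E) (ha : a ∈ 𝒜) (hb : b ∈ 𝒜)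
    (hψ : IsOpenEmbedding ψ) {M : Set ℂ} (hM : IsOpen M) (hMc : Convex ℝ M)
    (hMe : segment ℝ (0 : ℂ) 1 ⊆ M) (hMo : ∀ c ∈ 𝒜, c ≠ a → c ≠ b → Disjoint c (ψ '' M))
    (hseg : ∀ z ∈ segment ℝ (0 : ℂ) 1, z ≠ 0 → z ≠ 1 → ψ z ∈ G) (h0a : ψ 0 ∈ a) (h1b : ψ 1 ∈ b)
    (hC : IsArc C u v) (hCM : C ⊆ M)
    (hCG : C \ {u, v} ⊆ ψ ⁻¹' G \ segment ℝ (0 : ℂ) 1) {Pu Pv : Set S}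
    (hPu : IsArc Pu (ψ 0) (ψ u)) (hPv : IsArc Pv (ψ 1) (ψ v)) (hPua : Pu ⊆ a) (hPvb : Pv ⊆ b)
    (hPuM : Pu ⊆ ψ '' M) (hPvM : Pv ⊆ ψ '' M) (hPd : Disjoint Pu Pv) {X Y : Set S} {s t : S}
    (hst : ({s, t} : Set S) = {ψ 0, ψ 1}) (he : IsArc (ψ '' segment ℝ (0 : ℂ) 1) s t)
    (hX : IsArc X (ψ u) s) (hY : IsArc Y t (ψ v)) (hXY : Disjoint X Y)
    (hU : X ∪ Y ∪ (Pu ∪ Pv) = a ∪ b)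
    (hI : (X ∪ Y) ∩ (Pu ∪ Pv) ⊆ {ψ 0, ψ u, ψ 1, ψ v})
    (hwX : ∃ w ∈ X, w ∉ ψ '' M) (hwY : ∃ w ∈ Y, w ∉ ψ '' M) :
    ∃ R : Set ℂ, IsCompact R ∧ IsPreconnected R ∧ segment ℝ 0 1 ⊆ R ∧ R ⊆ M ∧
      ∃ c E', IsState ((𝒜.erase a).erase b ∪ {c}) (G \ ψ '' R) E' := by
  have hXab : X ⊆ a ∪ b := by rw [← hU]; exact subset_union_left.trans subset_union_left
  have hYab : Y ⊆ a ∪ b := by rw [← hU]; exact subset_union_right.trans subset_union_left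
  have hCS : IsArc (ψ '' C) (ψ u) (ψ v) := hC.image hψ.continuous.continuousOn hψ.injective.injOn
  have hei := h.segment_inter ha hb hseg
  have hci := h.arc_inter ha hb hCG
  have heC := h.segment_disjoint_arc ha hb hψ hseg hCG hPu hPv hPua hPvb hPd
  have hei' : ∀ x ∈ ψ '' segment ℝ (0 : ℂ) 1, x ∈ a ∪ b → x = s ∨ x = t := by
    intro x hx hx'
    have : x ∈ ({s, t} : Set S) := by rw [hst]; exact hei x hx hx'
    exact this
  have hloop : IsLoop (X ∪ ψ '' segment ℝ (0 : ℂ) 1 ∪ (ψ '' C ∪ Y)) := by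
    refine IsLoop.of_four_arcs hX he hY hCS ?_ ?_ ?_ ?_ hXY heC
    · rintro x ⟨hx, hx'⟩
      refine (hei' x hx' (hXab hx)).resolve_right ?_
      rintro rfl
      exact Set.disjoint_left.1 hXY hx hY.left_mem
    · rintro x ⟨hx', hx⟩
      refine (hei' x hx' (hYab hx)).resolve_left ?_
      rintro rfl
      exact Set.disjoint_left.1 hXY hX.right_mem hx
    · rintro x ⟨hx, hx'⟩
      refine (hci x hx' (hYab hx)).resolve_left ?_
      rintro rfl
      exact Set.disjoint_left.1 hXY hX.left_mem hx
    · rintro x ⟨hx, hx'⟩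
      refine (hci x hx' (hXab hx)).resolve_right ?_
      rintro rfl
      exact Set.disjoint_left.1 hXY hx hY.right_mem
  have hcorner : ({ψ 0, ψ u, ψ 1, ψ v} : Set S) = {s, ψ u, t, ψ v} := by
    have e1 : ({ψ 0, ψ u, ψ 1, ψ v} : Set S) = {ψ 0, ψ 1} ∪ {ψ u, ψ v} := by
      ext; simp only [mem_insert_iff, mem_singleton_iff, mem_union]; tauto
    rw [e1, ← hst]
    ext; simp only [mem_insert_iff, mem_singleton_iff, mem_union]; tauto
  have hXo : X \ {ψ u, s} ⊆ (X ∪ Y) \ {ψ 0, ψ u, ψ 1, ψ v} := by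
    rw [hcorner]
    rintro x ⟨hx, hx'⟩
    refine ⟨Or.inl hx, ?_⟩
    rintro (rfl | rfl | rfl | hxv)
    · exact hx' (Or.inr rfl)
    · exact hx' (Or.inl rfl)
    · exact Set.disjoint_left.1 hXY hx hY.left_mem
    · rw [mem_singleton_iff] at hxv
      subst hxv
      exact Set.disjoint_left.1 hXY hx hY.right_mem
  have hYo : Y \ {t, ψ v} ⊆ (X ∪ Y) \ {ψ 0, ψ u, ψ 1, ψ v} := by
    rw [hcorner]
    rintro x ⟨hx, hx'⟩
    refine ⟨Or.inr hx, ?_⟩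
    rintro (rfl | rfl | rfl | hxv)
    · exact Set.disjoint_left.1 hXY hX.right_mem hx
    · exact Set.disjoint_left.1 hXY hX.left_mem hx
    · exact hx' (Or.inl rfl)
    · exact hx' (Or.inr hxv)
  have hcM : ({ψ 0, ψ u, ψ 1, ψ v} : Set S) ⊆ ψ '' M := by
    rintro x (rfl | rfl | rfl | rfl)
    · exact hPuM hPu.left_mem
    · exact hPuM hPu.right_mem
    · exact hPvM hPv.left_mem
    · exact hPvM hPv.right_mem
  obtain ⟨R, h1, h2, h3, h4, E', h5⟩ := h.ribbon_of_arc ha hb hψ hM hMc hMe hMo hseg h0a h1b hC hCM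
    hCG hPu hPv hPua hPvb hPuM hPvM hPd (hX.isClosed.union hY.isClosed) hU
    (hI.antisymm (by
      rintro x (rfl | rfl | rfl | rfl)
      · refine ⟨?_, Or.inl hPu.left_mem⟩
        have : ψ 0 ∈ ({s, t} : Set S) := by rw [hst]; exact Or.inl rfl
        rcases this with e | e
        · rw [e]; exact Or.inl hX.right_mem
        · rw [mem_singleton_iff.1 e]; exact Or.inr hY.left_mem
      · exact ⟨Or.inl hX.left_mem, Or.inl hPu.right_mem⟩
      · refine ⟨?_, Or.inr hPv.left_mem⟩
        have : ψ 1 ∈ ({s, t} : Set S) := by rw [hst]; exact Or.inr rfl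
        rcases this with e | e
        · rw [e]; exact Or.inl hX.right_mem
        · rw [mem_singleton_iff.1 e]; exact Or.inr hY.left_mem
      · exact ⟨Or.inr hY.right_mem, Or.inr hPv.right_mem⟩))
    (by
      rintro x ⟨hx | hx, hx'⟩
      · obtain ⟨w, hw, hwM⟩ := hwX
        refine ⟨X \ {ψ u, s}, hX.interior_isPreconnected, ⟨hx, fun hx2 => hx' ?_⟩, hXo, w,
          ⟨hw, fun hw2 => hwM (hcM ?_)⟩, hwM⟩
        · rw [hcorner]; rcases hx2 with e | e <;> simp_all
        · rw [hcorner]; rcases hw2 with e | e <;> simp_all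
      · obtain ⟨w, hw, hwM⟩ := hwY
        refine ⟨Y \ {t, ψ v}, hY.interior_isPreconnected, ⟨hx, fun hx2 => hx' ?_⟩, hYo, w,
          ⟨hw, fun hw2 => hwM (hcM ?_)⟩, hwM⟩
        · rw [hcorner]; rcases hx2 with e | e <;> simp_all
        · rw [hcorner]; rcases hw2 with e | e <;> simp_all)
    (𝒩 := {X ∪ ψ '' segment ℝ (0 : ℂ) 1 ∪ (ψ '' C ∪ Y)})
    (by
      rw [Finset.coe_singleton, sUnion_singleton, image_union]
      ext; simp only [mem_union]; tauto)
    (by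
      intro c hc
      rw [Finset.mem_singleton.1 hc]
      exact hloop)
    (by
      intro c hc d hd hcd
      rw [Finset.mem_singleton.1 hc, Finset.mem_singleton.1 hd] at hcd
      exact absurd rfl hcd)
  exact ⟨R, h1, h2, h3, h4, _, E', h5⟩

end

open Classical in
/-- Removing a ribbon around a cross-cut joining two distinct curves merges them. -/
theorem ribbon_ne [T2Space S] (h : IsState 𝒜 G E) {a b : Set S} {ψ : ℂ → S} (ha : a ∈ 𝒜)
    (hb : b ∈ 𝒜) (hab : a ≠ b)
    (hψ : IsOpenEmbedding ψ)
    (hseg : ∀ z ∈ segment ℝ (0 : ℂ) 1, z ≠ 0 → z ≠ 1 → ψ z ∈ G) (h0a : ψ 0 ∈ a) (h1b : ψ 1 ∈ b)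
    {V : Set ℂ} (hV : IsOpen V) (hVe : segment ℝ (0 : ℂ) 1 ⊆ V) :
    ∃ R : Set ℂ, IsCompact R ∧ IsPreconnected R ∧ segment ℝ 0 1 ⊆ R ∧ R ⊆ V ∧
      ∃ c E', IsState ((𝒜.erase a).erase b ∪ {c}) (G \ ψ '' R) E' := by
  have hdab := h.pairwise a ha b hb hab
  obtain ⟨w₁, hw₁a, hw₁⟩ := (h.isLoop a ha).exists_ne (ψ 0)
  obtain ⟨w₂, hw₂b, hw₂⟩ := (h.isLoop b hb).exists_ne (ψ 1)
  have hei := h.segment_inter ha hb hseg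
  obtain ⟨M, hM, hMc, hMe, hMV, hMo, hMF⟩ := h.exists_convex_nhd hψ ha hb hseg h0a h1b hV hVe
    (F := {w₁, w₂}) (Set.toFinite _).isClosed (by
      rw [Set.disjoint_left]
      rintro x (rfl | hx) hx'
      · rcases hei x hx' (Or.inl hw₁a) with e | e
        · exact hw₁ e
        · exact Set.disjoint_left.1 hdab hw₁a (e ▸ h1b)
      · rw [mem_singleton_iff] at hx
        subst hx
        rcases hei x hx' (Or.inr hw₂b) with e | e
        · exact Set.disjoint_right.1 hdab hw₂b (e ▸ h0a)
        · exact hw₂ e)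
  have hψM : IsOpen (ψ '' M) := hψ.isOpenMap M hM
  obtain ⟨U₀, hU₀, hX⟩ := (h.isLoop a ha).shrink h0a
    (hψM.mem_nhds ⟨0, hMe (left_mem_segment _ _ _), rfl⟩)
  obtain ⟨U₁, hU₁, hY⟩ := (h.isLoop b hb).shrink h1b
    (hψM.mem_nhds ⟨1, hMe (right_mem_segment _ _ _), rfl⟩)
  obtain ⟨u, v, C, hu, hv, hu0, hv1, hC, hCM, hCG⟩ :=
    h.exists_parallel hψ ha hb hseg h0a h1b hM hMe hU₀ hU₁
  obtain ⟨Pu, X, hPu, hXa, hPuX, hPuXU, hPuM⟩ := hX _ hu hu0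
  obtain ⟨Pv, Y, hPv, hYa, hPvY, hPvYU, hPvM⟩ := hY _ hv hv1
  have hPua : Pu ⊆ a := hPuXU ▸ subset_union_left
  have hXa' : X ⊆ a := hPuXU ▸ subset_union_right
  have hPvb : Pv ⊆ b := hPvYU ▸ subset_union_left
  have hYb' : Y ⊆ b := hPvYU ▸ subset_union_right
  obtain ⟨R, h1, h2, h3, h4, h5⟩ := h.ribbon_single ha hb hψ hM hMc hMe hMo hseg h0a h1b hC hCM hCG
    hPu hPv hPua hPvb hPuM hPvM (hdab.mono hPua hPvb) (s := ψ 0) (t := ψ 1) rfl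
    ((IsArc.segment zero_ne_one).image hψ.continuous.continuousOn hψ.injective.injOn)
    hXa.symm hYa (hdab.mono hXa' hYb')
    (by rw [← hPuXU, ← hPvYU]; ext; simp only [mem_union]; tauto)
    (by
      rintro x ⟨hx | hx, hx' | hx'⟩
      · have : x ∈ Pu ∩ X := ⟨hx', hx⟩
        rw [hPuX] at this
        rcases this with e | e <;> simp_all
      · exact absurd (hPvb hx') (Set.disjoint_left.1 hdab (hXa' hx))
      · exact absurd (hYb' hx) (Set.disjoint_left.1 hdab (hPua hx'))
      · have : x ∈ Pv ∩ Y := ⟨hx', hx⟩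
        rw [hPvY] at this
        rcases this with e | e <;> simp_all)
    ⟨w₁, by
      rw [← hPuXU] at hw₁a
      refine hw₁a.resolve_left fun hw => ?_
      exact Set.disjoint_left.1 hMF (Or.inl rfl) (hPuM hw), Set.disjoint_left.1 hMF (Or.inl rfl)⟩
    ⟨w₂, by
      rw [← hPvYU] at hw₂b
      refine hw₂b.resolve_left fun hw => ?_
      exact Set.disjoint_left.1 hMF (Or.inr rfl) (hPvM hw), Set.disjoint_left.1 hMF (Or.inr rfl)⟩
  exact ⟨R, h1, h2, h3, h4.trans hMV, h5⟩

end IsState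

namespace IsState

variable {S : Type*} [TopologicalSpace S] {𝒜 : Finset (Set S)} {G E : Set S}

set_option maxHeartbeats 1000000 in
open Classical in
theorem ribbon_self_aux [T2Space S] (h : IsState 𝒜 G E) {a : Set S} {ψ : ℂ → S} (ha : a ∈ 𝒜)
    (hψ : IsOpenEmbedding ψ) {M : Set ℂ} (hM : IsOpen M) (hMc : Convex ℝ M)
    (hMe : segment ℝ (0 : ℂ) 1 ⊆ M) (hMo : ∀ c ∈ 𝒜, c ≠ a → c ≠ a → Disjoint c (ψ '' M))
    (hseg : ∀ z ∈ segment ℝ (0 : ℂ) 1, z ≠ 0 → z ≠ 1 → ψ z ∈ G)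
    {D₁ D₂ : Set S} (hD₁ : IsArc D₁ (ψ 0) (ψ 1)) (hD₂ : IsArc D₂ (ψ 0) (ψ 1))
    (hI : D₁ ∩ D₂ = {ψ 0, ψ 1}) (hU : D₁ ∪ D₂ = a) (hw₁ : ∃ w ∈ D₁, w ∉ ψ '' M)
    (hw₂ : ∃ w ∈ D₂, w ∉ ψ '' M) :
    ∃ U₀ ∈ 𝓝 (ψ 0), ∃ U₁ ∈ 𝓝 (ψ 1), ∀ u v C, ψ u ∈ D₁ ∩ U₀ → ψ v ∈ a ∩ U₁ → ψ u ≠ ψ 0 →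
      ψ v ≠ ψ 1 → IsArc C u v → C ⊆ M → C \ {u, v} ⊆ ψ ⁻¹' G \ segment ℝ (0 : ℂ) 1 →
      ∃ R : Set ℂ, IsCompact R ∧ IsPreconnected R ∧ segment ℝ 0 1 ⊆ R ∧ R ⊆ M ∧
        ∃ 𝒩 E', IsState ((𝒜.erase a).erase a ∪ 𝒩) (G \ ψ '' R) E' := by
  have hψM : IsOpen (ψ '' M) := hψ.isOpenMap M hM
  have h0M : ψ '' M ∈ 𝓝 (ψ 0) := hψM.mem_nhds ⟨0, hMe (left_mem_segment _ _ _), rfl⟩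
  have h1M : ψ '' M ∈ 𝓝 (ψ 1) := hψM.mem_nhds ⟨1, hMe (right_mem_segment _ _ _), rfl⟩
  have h0a : ψ 0 ∈ a := hU ▸ Or.inl hD₁.left_mem
  have h1a : ψ 1 ∈ a := hU ▸ Or.inl hD₁.right_mem
  have hD₁a : D₁ ⊆ a := hU ▸ subset_union_left
  have hD₂a : D₂ ⊆ a := hU ▸ subset_union_right
  obtain ⟨N₀, N₁, hN₀, hN₁, h0N, h1N, hN⟩ := t2_separation hD₁.ne
  obtain ⟨U₀, hU₀, U₁, hU₁, hsame⟩ := hD₁.shrink_both h0M h1M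
  obtain ⟨U₀', hU₀', hd1⟩ := hD₁.shrink (Filter.inter_mem h0M (hN₀.mem_nhds h0N))
  obtain ⟨U₁', hU₁', hd2⟩ := hD₂.symm.shrink (Filter.inter_mem h1M (hN₁.mem_nhds h1N))
  refine ⟨U₀ ∩ U₀', Filter.inter_mem hU₀ hU₀', U₁ ∩ U₁', Filter.inter_mem hU₁ hU₁', ?_⟩
  rintro u v C ⟨huD, huU, huU'⟩ ⟨hva, hvU, hvU'⟩ hu0 hv1 hC hCM hCG
  rw [← hU] at hva
  have hseg' : IsArc (ψ '' segment ℝ (0 : ℂ) 1) (ψ 0) (ψ 1) :=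
    (IsArc.segment zero_ne_one).image hψ.continuous.continuousOn hψ.injective.injOn
  rcases hva with hvD | hvD
  · obtain ⟨A₁, A₂, A₃, hA₁, hA₂, hA₃, hAU, hA12, hA23, hA13, hA1M, hA3M⟩ :=
      hsame _ ⟨huD, huU⟩ hu0 _ ⟨hvD, hvU⟩ hv1
    have hA1D : A₁ ⊆ D₁ := hAU ▸ subset_union_left.trans subset_union_left
    have hA2D : A₂ ⊆ D₁ := hAU ▸ subset_union_right.trans subset_union_left
    have hA3D : A₃ ⊆ D₁ := hAU ▸ subset_union_right
    have h0A2 : ψ 0 ∉ A₂ := fun h0 => hu0 (by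
      have : ψ 0 ∈ A₁ ∩ A₂ := ⟨hA₁.left_mem, h0⟩
      rw [hA12] at this; exact this.symm)
    have h1A2 : ψ 1 ∉ A₂ := fun h1 => hv1 (by
      have : ψ 1 ∈ A₂ ∩ A₃ := ⟨h1, hA₃.left_mem⟩
      rw [hA23] at this; exact this.symm)
    have hA2D2 : Disjoint A₂ D₂ := by
      rw [Set.disjoint_left]
      intro x hx hx'
      have : x ∈ D₁ ∩ D₂ := ⟨hA2D hx, hx'⟩
      rw [hI] at this
      rcases this with rfl | e
      · exact h0A2 hx
      · rw [mem_singleton_iff] at e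
        subst e
        exact h1A2 hx
    have hei := h.segment_inter ha ha hseg
    have hci := h.arc_inter ha ha hCG
    have heC := h.segment_disjoint_arc ha ha hψ hseg hCG hA₁ hA₃ (hA1D.trans hD₁a)
      (hA3D.trans hD₁a) hA13
    have hcM : ({ψ 0, ψ u, ψ 1, ψ v} : Set S) ⊆ ψ '' M := by
      rintro x (rfl | rfl | rfl | rfl)
      · exact hA1M hA₁.left_mem
      · exact hA1M hA₁.right_mem
      · exact hA3M hA₃.left_mem
      · exact hA3M hA₃.right_mem
    have hA2o : A₂ \ {ψ u, ψ v} ⊆ (A₂ ∪ D₂) \ {ψ 0, ψ u, ψ 1, ψ v} := by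
      rintro x ⟨hx, hx'⟩
      refine ⟨Or.inl hx, ?_⟩
      rintro (rfl | rfl | rfl | hxv)
      · exact h0A2 hx
      · exact hx' (Or.inl rfl)
      · exact h1A2 hx
      · exact hx' (Or.inr hxv)
    have hD2o : D₂ \ {ψ 0, ψ 1} ⊆ (A₂ ∪ D₂) \ {ψ 0, ψ u, ψ 1, ψ v} := by
      rintro x ⟨hx, hx'⟩
      refine ⟨Or.inr hx, ?_⟩
      rintro (rfl | rfl | rfl | hxv)
      · exact hx' (Or.inl rfl)
      · exact Set.disjoint_left.1 hA2D2 hA₂.left_mem hx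
      · exact hx' (Or.inr rfl)
      · rw [mem_singleton_iff] at hxv
        subst hxv
        exact Set.disjoint_left.1 hA2D2 hA₂.right_mem hx
    obtain ⟨R, h1, h2, h3, h4, E', h5⟩ := h.ribbon_of_arc ha ha hψ hM hMc hMe hMo hseg h0a h1a hC
      hCM hCG hA₁ hA₃ (hA1D.trans hD₁a) (hA3D.trans hD₁a) hA1M hA3M hA13
      (hA₂.isClosed.union hD₂.isClosed)
      (by rw [← hU, ← hAU]; ext; simp only [mem_union]; tauto)
      (by
        refine Subset.antisymm ?_ ?_
        · rintro x ⟨hx | hx, hx' | hx'⟩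
          · have : x ∈ A₁ ∩ A₂ := ⟨hx', hx⟩
            rw [hA12] at this
            exact Or.inr (Or.inl this)
          · have : x ∈ A₂ ∩ A₃ := ⟨hx, hx'⟩
            rw [hA23] at this
            exact Or.inr (Or.inr (Or.inr this))
          · have : x ∈ D₁ ∩ D₂ := ⟨hA1D hx', hx⟩
            rw [hI] at this
            rcases this with e | e
            · exact Or.inl e
            · exact Or.inr (Or.inr (Or.inl e))
          · have : x ∈ D₁ ∩ D₂ := ⟨hA3D hx', hx⟩
            rw [hI] at this
            rcases this with e | e
            · exact Or.inl e
            · exact Or.inr (Or.inr (Or.inl e))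
        · rintro x (rfl | rfl | rfl | rfl)
          · exact ⟨Or.inr hD₂.left_mem, Or.inl hA₁.left_mem⟩
          · exact ⟨Or.inl hA₂.left_mem, Or.inl hA₁.right_mem⟩
          · exact ⟨Or.inr hD₂.right_mem, Or.inr hA₃.left_mem⟩
          · exact ⟨Or.inl hA₂.right_mem, Or.inr hA₃.right_mem⟩)
      (by
        rintro x ⟨hx | hx, hx'⟩
        · obtain ⟨w, hw, hwM⟩ := hw₁
          have hwA : w ∈ A₂ := by
            rw [← hAU] at hw
            rcases hw with (hw | hw) | hw
            · exact absurd (hA1M hw) hwM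
            · exact hw
            · exact absurd (hA3M hw) hwM
          refine ⟨A₂ \ {ψ u, ψ v}, hA₂.interior_isPreconnected, ⟨hx, fun hx2 => hx' ?_⟩, hA2o, w,
            ⟨hwA, fun hw2 => hwM (hcM ?_)⟩, hwM⟩
          · rcases hx2 with e | e <;> simp_all
          · rcases hw2 with e | e <;> simp_all
        · obtain ⟨w, hw, hwM⟩ := hw₂
          refine ⟨D₂ \ {ψ 0, ψ 1}, hD₂.interior_isPreconnected, ⟨hx, fun hx2 => hx' ?_⟩, hD2o, w,
            ⟨hw, fun hw2 => hwM (hcM ?_)⟩, hwM⟩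
          · rcases hx2 with e | e <;> simp_all
          · rcases hw2 with e | e <;> simp_all)
      (𝒩 := {ψ '' C ∪ A₂, ψ '' segment ℝ (0 : ℂ) 1 ∪ D₂})
      (by
        rw [Finset.coe_insert, Finset.coe_singleton, sUnion_insert, sUnion_singleton, image_union]
        ext; simp only [mem_union]; tauto)
      (by
        intro c hc
        rcases Finset.mem_insert.1 hc with rfl | hc
        · refine IsLoop.of_arcs (hC.image hψ.continuous.continuousOn hψ.injective.injOn) hA₂ ?_
          rintro x ⟨hx, hx'⟩
          exact hci x hx (Or.inl (hD₁a (hA2D hx')))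
        · rw [Finset.mem_singleton.1 hc]
          refine IsLoop.of_arcs hseg' hD₂ ?_
          rintro x ⟨hx, hx'⟩
          exact hei x hx (Or.inl (hD₂a hx')))
      (by
        have hdis : Disjoint (ψ '' C ∪ A₂) (ψ '' segment ℝ (0 : ℂ) 1 ∪ D₂) := by
          rw [Set.disjoint_left]
          rintro x (hx | hx) (hx' | hx')
          · exact Set.disjoint_left.1 heC hx' hx
          · rcases hci x hx (Or.inl (hD₂a hx')) with rfl | rfl
            · exact Set.disjoint_left.1 hA2D2 hA₂.left_mem hx'
            · exact Set.disjoint_left.1 hA2D2 hA₂.right_mem hx'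
          · rcases hei x hx' (Or.inl (hD₁a (hA2D hx))) with rfl | rfl
            · exact h0A2 hx
            · exact h1A2 hx
          · exact Set.disjoint_left.1 hA2D2 hx hx'
        intro c hc d hd hcd
        rcases Finset.mem_insert.1 hc with rfl | hc <;> rcases Finset.mem_insert.1 hd with rfl | hd
        · exact absurd rfl hcd
        · rw [Finset.mem_singleton.1 hd]; exact hdis
        · rw [Finset.mem_singleton.1 hc]; exact hdis.symm
        · exact absurd ((Finset.mem_singleton.1 hc).trans (Finset.mem_singleton.1 hd).symm) hcd)
    exact ⟨R, h1, h2, h3, h4, _, E', h5⟩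
  · obtain ⟨hu1, A₁, A₂, hA₁, hA₂, hAU, hAI, hAM⟩ := hd1 _ ⟨huD, huU'⟩ hu0
    obtain ⟨hv0, B₁, B₂, hB₁, hB₂, hBU, hBI, hBM⟩ := hd2 _ ⟨hvD, hvU'⟩ hv1
    have hA1D : A₁ ⊆ D₁ := hAU ▸ subset_union_left
    have hA2D : A₂ ⊆ D₁ := hAU ▸ subset_union_right
    have hB1D : B₁ ⊆ D₂ := hBU ▸ subset_union_left
    have hB2D : B₂ ⊆ D₂ := hBU ▸ subset_union_right
    have h0A2 : ψ 0 ∉ A₂ := fun h0 => hu0 (by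
      have : ψ 0 ∈ A₁ ∩ A₂ := ⟨hA₁.left_mem, h0⟩
      rw [hAI] at this; exact this.symm)
    have h1B2 : ψ 1 ∉ B₂ := fun h1 => hv1 (by
      have : ψ 1 ∈ B₁ ∩ B₂ := ⟨hB₁.left_mem, h1⟩
      rw [hBI] at this; exact this.symm)
    have hPd : Disjoint A₁ B₁ := by
      rw [Set.disjoint_left]
      exact fun x hx hx' => Set.disjoint_left.1 hN (hAM hx).2 (hBM hx').2
    have hcr : ∀ x ∈ D₁, x ∈ D₂ → x = ψ 0 ∨ x = ψ 1 := by
      intro x hx hx'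
      have : x ∈ D₁ ∩ D₂ := ⟨hx, hx'⟩
      rw [hI] at this
      exact this
    obtain ⟨R, h1, h2, h3, h4, c, E', h5⟩ := h.ribbon_single ha ha hψ hM hMc hMe hMo hseg h0a h1a hC
      hCM hCG hA₁ hB₁ (hA1D.trans hD₁a) (hB1D.trans hD₂a) (hAM.trans inter_subset_left)
      (hBM.trans inter_subset_left) hPd (X := A₂) (Y := B₂) (s := ψ 1) (t := ψ 0) (pair_comm _ _)
      hseg'.symm hA₂ hB₂.symm
      (by
        rw [Set.disjoint_left]
        intro x hx hx'
        rcases hcr x (hA2D hx) (hB2D hx') with rfl | rfl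
        · exact h0A2 hx
        · exact h1B2 hx')
      (by rw [← hU, ← hAU, ← hBU]; ext; simp only [mem_union]; tauto)
      (by
        have hAI' : ∀ x ∈ A₂, x ∈ A₁ → x = ψ u := fun x hx hx' => by
          have : x ∈ A₁ ∩ A₂ := ⟨hx', hx⟩
          rw [hAI] at this; exact this
        have hBI' : ∀ x ∈ B₂, x ∈ B₁ → x = ψ v := fun x hx hx' => by
          have : x ∈ B₁ ∩ B₂ := ⟨hx', hx⟩
          rw [hBI] at this; exact this
        rintro x ⟨hx | hx, hx' | hx'⟩
        · exact Or.inr (Or.inl (hAI' x hx hx'))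
        · rcases hcr x (hA2D hx) (hB1D hx') with e | e <;> simp_all
        · rcases hcr x (hA1D hx') (hB2D hx) with e | e <;> simp_all
        · exact Or.inr (Or.inr (Or.inr (hBI' x hx hx'))))
      (by
        obtain ⟨w, hw, hwM⟩ := hw₁
        rw [← hAU] at hw
        exact ⟨w, hw.resolve_left fun hw' => hwM (hAM hw').1, hwM⟩)
      (by
        obtain ⟨w, hw, hwM⟩ := hw₂
        rw [← hBU] at hw
        exact ⟨w, hw.resolve_left fun hw' => hwM (hBM hw').1, hwM⟩)
    exact ⟨R, h1, h2, h3, h4, _, E', h5⟩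

open Classical in
theorem ribbon_self [T2Space S] (h : IsState 𝒜 G E) {a : Set S} {ψ : ℂ → S} (ha : a ∈ 𝒜)
    (hψ : IsOpenEmbedding ψ)
    (hseg : ∀ z ∈ segment ℝ (0 : ℂ) 1, z ≠ 0 → z ≠ 1 → ψ z ∈ G) (h0a : ψ 0 ∈ a) (h1a : ψ 1 ∈ a)
    {V : Set ℂ} (hV : IsOpen V) (hVe : segment ℝ (0 : ℂ) 1 ⊆ V) :
    ∃ R : Set ℂ, IsCompact R ∧ IsPreconnected R ∧ segment ℝ 0 1 ⊆ R ∧ R ⊆ V ∧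
      ∃ 𝒩 E', IsState ((𝒜.erase a).erase a ∪ 𝒩) (G \ ψ '' R) E' := by
  obtain ⟨D₁, D₂, hD₁, hD₂, hI, hU⟩ := (h.isLoop a ha).cut h0a h1a (hψ.injective.ne zero_ne_one)
  have hei := h.segment_inter ha ha hseg
  obtain ⟨w₁, hw₁D, hw₁⟩ := hD₁.interior_nonempty
  obtain ⟨w₂, hw₂D, hw₂⟩ := hD₂.interior_nonempty
  obtain ⟨M, hM, hMc, hMe, hMV, hMo, hMF⟩ := h.exists_convex_nhd hψ ha ha hseg h0a h1a hV hVe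
    (F := {w₁, w₂}) (Set.toFinite _).isClosed (by
      rw [Set.disjoint_left]
      rintro x (rfl | hx) hx'
      · exact hw₁ (hei x hx' (Or.inl (hU ▸ Or.inl hw₁D)))
      · rw [mem_singleton_iff] at hx
        subst hx
        exact hw₂ (hei x hx' (Or.inl (hU ▸ Or.inr hw₂D))))
  have hw₁M : w₁ ∉ ψ '' M := Set.disjoint_left.1 hMF (Or.inl rfl)
  have hw₂M : w₂ ∉ ψ '' M := Set.disjoint_left.1 hMF (Or.inr rfl)
  obtain ⟨U₀, hU₀, U₁, hU₁, k1⟩ := h.ribbon_self_aux ha hψ hM hMc hMe hMo hseg hD₁ hD₂ hI hU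
    ⟨w₁, hw₁D, hw₁M⟩ ⟨w₂, hw₂D, hw₂M⟩
  obtain ⟨U₀', hU₀', U₁', hU₁', k2⟩ := h.ribbon_self_aux ha hψ hM hMc hMe hMo hseg hD₂ hD₁
    (by rw [inter_comm, hI]) (by rw [union_comm, hU]) ⟨w₂, hw₂D, hw₂M⟩ ⟨w₁, hw₁D, hw₁M⟩
  obtain ⟨u, v, C, ⟨hu, huU, huU'⟩, ⟨hv, hvU, hvU'⟩, hu0, hv1, hC, hCM, hCG⟩ :=
    h.exists_parallel hψ ha ha hseg h0a h1a hM hMe (Filter.inter_mem hU₀ hU₀')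
      (Filter.inter_mem hU₁ hU₁')
  have hu' := hu
  rw [← hU] at hu'
  rcases hu' with hu' | hu'
  · obtain ⟨R, h1, h2, h3, h4, h5⟩ := k1 u v C ⟨hu', huU⟩ ⟨hv, hvU⟩ hu0 hv1 hC hCM hCG
    exact ⟨R, h1, h2, h3, h4.trans hMV, h5⟩
  · obtain ⟨R, h1, h2, h3, h4, h5⟩ := k2 u v C ⟨hu', huU'⟩ ⟨hv, hvU'⟩ hu0 hv1 hC hCM hCG
    exact ⟨R, h1, h2, h3, h4.trans hMV, h5⟩

/-- A ribbon around a cross-cut can be removed from the left side. -/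
theorem ribbon [T2Space S] (h : IsState 𝒜 G E) {ψ : ℂ → S} (hψ : IsOpenEmbedding ψ)
    (hseg : ∀ z ∈ segment ℝ (0 : ℂ) 1, z ≠ 0 → z ≠ 1 → ψ z ∈ G) (h0 : ψ 0 ∉ G) (h1 : ψ 1 ∉ G)
    {V : Set ℂ} (hV : IsOpen V) (hVe : segment ℝ (0 : ℂ) 1 ⊆ V) :
    ∃ R : Set ℂ, IsCompact R ∧ IsPreconnected R ∧ segment ℝ 0 1 ⊆ R ∧ R ⊆ V ∧
      ∃ 𝒜' E', IsState 𝒜' (G \ ψ '' R) E' := by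
  classical
  have hcl : ∀ p ∈ segment ℝ (0 : ℂ) 1, ψ p ∈ closure G := by
    intro p hp
    have := (IsArc.segment (zero_ne_one (α := ℂ))).subset_closure_interior hp
    refine closure_mono ?_ (image_closure_subset_closure_image hψ.continuous ⟨p, this, rfl⟩)
    rintro _ ⟨z, ⟨hz, hz'⟩, rfl⟩
    simp only [mem_insert_iff, mem_singleton_iff, not_or] at hz'
    exact hseg z hz hz'.1 hz'.2
  have hmem : ∀ p ∈ segment ℝ (0 : ℂ) 1, ψ p ∉ G → ∃ a ∈ 𝒜, ψ p ∈ a := by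
    intro p hp hpG
    rcases h.cover (ψ p) with h' | h' | h'
    · exact absurd h' hpG
    · exact absurd (hcl p hp) (Set.disjoint_right.1 (h.disjoint.closure_left h.isOpen_right) h')
    · exact h'
  obtain ⟨a, ha, h0a⟩ := hmem 0 (left_mem_segment _ _ _) h0
  obtain ⟨b, hb, h1b⟩ := hmem 1 (right_mem_segment _ _ _) h1
  by_cases hab : a = b
  · subst hab
    obtain ⟨R, r1, r2, r3, r4, 𝒩, E', r5⟩ := h.ribbon_self ha hψ hseg h0a h1b hV hVe
    exact ⟨R, r1, r2, r3, r4, _, E', r5⟩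
  · obtain ⟨R, r1, r2, r3, r4, c, E', r5⟩ := h.ribbon_ne ha hb hab hψ hseg h0a h1b hV hVe
    exact ⟨R, r1, r2, r3, r4, _, E', r5⟩

end IsState

/-- A connected set avoiding a closed set which winds around the origin stays near the origin. -/
theorem norm_le_of_winding {X : Set ℂ} (hX : IsClosed X) {r : ℝ} (hXr : ∀ z ∈ X, ‖z‖ ≤ r)
    (Q : ℕ → Set ℂ) (hQ : ∀ j < 4, IsPreconnected (Q j)) (hQX : ∀ j < 4, Q j ⊆ X)
    (hQl : ∀ j < 4, Complex.I ^ j ∈ Q j) (hQr : ∀ j < 4, Complex.I ^ (j + 1) ∈ Q j)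
    (hQc : ∀ j < 4, ∀ z ∈ Q j, 0 < (z * ((1 - Complex.I) * (-Complex.I) ^ j)).re)
    {C : Set ℂ} (hC : IsPreconnected C) (hCX : Disjoint C X) (h0 : (0 : ℂ) ∈ C) {q : ℂ}
    (hq : q ∈ C) : ‖q‖ ≤ r := by
  by_contra! hqr
  have hq0 : q ≠ 0 := by
    rintro rfl
    have := hXr _ (hQX 0 (by norm_num) (hQl 0 (by norm_num)))
    simp at this hqr
    linarith
  have hX0 : ∀ z ∈ X, z ≠ 0 := by
    rintro z hz rfl
    exact Set.disjoint_left.1 hCX h0 hz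
  have h1 : HasLog (fun z => 1 - z / q) X := by
    refine HasLog.of_slitPlane (by fun_prop) fun z hz => Or.inl ?_
    have h2 : ‖z / q‖ < 1 := by
      rw [norm_div, div_lt_one (norm_pos_iff.2 hq0)]
      exact (hXr z hz).trans_lt hqr
    have := (Complex.re_le_norm (z / q)).trans_lt h2
    simp only [Complex.sub_re, Complex.one_re]
    linarith
  obtain ⟨φ, hφ, hφe⟩ : HasLog (fun z => (-q⁻¹) * z) X := by
    refine ((hasLog_div hX hC hCX h0 hq).mul h1).congr fun z hz => ?_
    have : z - q ≠ 0 := fun e => Set.disjoint_left.1 hCX hq (sub_eq_zero.1 e ▸ hz)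
    simp only [sub_zero]
    field_simp
    ring
  have hI : ∀ j : ℕ, Complex.I ^ j * (-Complex.I) ^ j = 1 := by
    intro j
    rw [← mul_pow]; simp
  have inc : ∀ j < 4, φ (Complex.I ^ (j + 1)) - φ (Complex.I ^ j) =
      Complex.log (1 + Complex.I) - Complex.log (1 - Complex.I) := by
    intro j hj
    set c := (1 - Complex.I) * (-Complex.I) ^ j with hc
    have hc0 : c ≠ 0 := by
      intro e
      have := hQc j hj _ (hQl j hj)
      rw [← hc, e] at this
      simp at this
    have := eq_of_exp_eq (hQ j hj) (φ := fun z => φ z - Complex.log (z * c)) (c := -q⁻¹ / c)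
      ((hφ.mono (hQX j hj)).sub (ContinuousOn.clog (by fun_prop) fun z hz =>
        Or.inl (hQc j hj z hz)))
      (fun z hz => by
        have hz0 := hX0 z (hQX j hj hz)
        rw [Complex.exp_sub, hφe z (hQX j hj hz), Complex.exp_log (mul_ne_zero hz0 hc0)]
        field_simp) (hQr j hj) (hQl j hj)
    have e1 : Complex.I ^ (j + 1) * c = 1 + Complex.I := by
      rw [hc, pow_succ]
      linear_combination (Complex.I * (1 - Complex.I)) * hI j - Complex.I_sq
    have e2 : Complex.I ^ j * c = 1 - Complex.I := by
      rw [hc]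
      linear_combination (1 - Complex.I) * hI j
    rw [e1, e2] at this
    linear_combination this
  have h4 : Complex.I ^ (3 + 1) = Complex.I ^ 0 := by simp [Complex.I_pow_four]
  have i0 := inc 0 (by norm_num)
  have i1 := inc 1 (by norm_num)
  have i2 := inc 2 (by norm_num)
  have i3 := inc 3 (by norm_num)
  rw [h4] at i3
  have hz : Complex.log (1 + Complex.I) = Complex.log (1 - Complex.I) := by
    linear_combination -(1 / 4) * (i0 + i1 + i2 + i3)
  have := congrArg Complex.exp hz
  rw [Complex.exp_log (fun e => by simpa using congrArg Complex.re e),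
    Complex.exp_log (fun e => by simpa using congrArg Complex.re e)] at this
  have := congrArg Complex.im this
  simp at this
  norm_num at this

namespace IsState

variable {S : Type*} [TopologicalSpace S] {𝒜 : Finset (Set S)} {G E : Set S}

theorem affine_isOpenEmbedding {ψ : ℂ → S} {p q : ℂ} (hψ : IsOpenEmbedding ψ) (hpq : p ≠ q) :
    IsOpenEmbedding fun z : ℂ => ψ (p + z * (q - p)) := by
  have h0 : q - p ≠ 0 := sub_ne_zero.2 hpq.symm
  have : IsOpenEmbedding fun z : ℂ => p + z * (q - p) := by
    exact ((Homeomorph.mulRight₀ (q - p) h0).trans (Homeomorph.addLeft p)).isOpenEmbedding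
  exact hψ.comp this

theorem affine_image_segment (p q : ℂ) :
    (fun z : ℂ => p + z * (q - p)) '' segment ℝ 0 1 = segment ℝ p q := by
  ext z
  simp only [mem_image, segment_eq_image]
  constructor
  · rintro ⟨_, ⟨t, ht, rfl⟩, rfl⟩
    refine ⟨t, ht, ?_⟩
    simp only [Complex.real_smul]
    push_cast
    ring
  · rintro ⟨t, ht, rfl⟩
    refine ⟨_, ⟨t, ht, rfl⟩, ?_⟩
    simp only [Complex.real_smul]
    push_cast
    ring

theorem affine_segment_mem {T : Type*} {G : Set T} {ψ : ℂ → T} {p q : ℂ} (hpq : p ≠ q)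
    (hseg : ∀ z ∈ segment ℝ p q, z ≠ p → z ≠ q → ψ z ∈ G) :
    ∀ z ∈ segment ℝ (0 : ℂ) 1, z ≠ 0 → z ≠ 1 → ψ (p + z * (q - p)) ∈ G := by
  intro z hz h0 h1
  have hqp : q - p ≠ 0 := sub_ne_zero.2 hpq.symm
  refine hseg _ (affine_image_segment p q ▸ ⟨z, hz, rfl⟩) (fun e => h0 ?_) (fun e => h1 ?_)
  · simpa [hqp] using e
  · refine mul_right_cancel₀ hqp ?_
    linear_combination e

theorem ribbon_segment [T2Space S] (h : IsState 𝒜 G E) {ψ : ℂ → S} (hψ : IsOpenEmbedding ψ)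
    {p q : ℂ} (hpq : p ≠ q) (hseg : ∀ z ∈ segment ℝ p q, z ≠ p → z ≠ q → ψ z ∈ G)
    (hp : ψ p ∉ G) (hq : ψ q ∉ G) {V : Set ℂ} (hV : IsOpen V) (hVe : segment ℝ p q ⊆ V) :
    ∃ R : Set ℂ, IsCompact R ∧ IsPreconnected R ∧ segment ℝ p q ⊆ R ∧ R ⊆ V ∧
      ∃ 𝒜' E', IsState 𝒜' (G \ ψ '' R) E' := by
  have hc : Continuous fun z : ℂ => p + z * (q - p) := by fun_prop
  obtain ⟨R, h1, h2, h3, h4, 𝒜', E', h5⟩ := h.ribbon (affine_isOpenEmbedding hψ hpq)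
    (affine_segment_mem hpq hseg) (by simpa using hp) (by simpa using hq) (hV.preimage hc)
    (by rw [← image_subset_iff, affine_image_segment]; exact hVe)
  refine ⟨_, h1.image hc, h2.image _ hc.continuousOn, ?_, image_subset_iff.2 h4, 𝒜', E', ?_⟩
  · rw [← affine_image_segment]; exact image_mono h3
  · rwa [image_image]

open Classical in
theorem merge_segment [T2Space S] (h : IsState 𝒜 G E) {a b : Set S} (ha : a ∈ 𝒜) (hb : b ∈ 𝒜)
    (hab : a ≠ b) {ψ : ℂ → S} (hψ : IsOpenEmbedding ψ)
    {p q : ℂ} (hpq : p ≠ q) (hseg : ∀ z ∈ segment ℝ p q, z ≠ p → z ≠ q → ψ z ∈ G)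
    (hp : ψ p ∈ a) (hq : ψ q ∈ b) {V : Set ℂ} (hV : IsOpen V) (hVe : segment ℝ p q ⊆ V) :
    ∃ R : Set ℂ, IsCompact R ∧ R ⊆ V ∧ ∃ c E', IsState ((𝒜.erase a).erase b ∪ {c}) (G \ ψ '' R) E' := by
  have hc : Continuous fun z : ℂ => p + z * (q - p) := by fun_prop
  obtain ⟨R, h1, h2, h3, h4, c, E', h5⟩ := h.ribbon_ne ha hb hab (affine_isOpenEmbedding hψ hpq)
    (affine_segment_mem hpq hseg) (by simpa using hp) (by simpa using hq) (hV.preimage hc)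
    (by rw [← image_subset_iff, affine_image_segment]; exact hVe)
  refine ⟨_, h1.image hc, image_subset_iff.2 h4, c, E', ?_⟩
  rwa [image_image]

/-- The right side together with the curves is locally connected. -/
theorem locally_linked [T2Space S] (h : IsState 𝒜 G E) {ψ : ℂ → S} (hψ : IsOpenEmbedding ψ)
    {x : ℂ} (hx : ψ x ∉ G) {V : Set ℂ} (hV : V ∈ 𝓝 x) :
    ∀ᶠ y in 𝓝 x, ψ y ∉ G → ∃ Q, IsPreconnected Q ∧ x ∈ Q ∧ y ∈ Q ∧ Q ⊆ V ∧
      ∀ z ∈ Q, ψ z ∉ G := by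
  rcases h.cover (ψ x) with h' | h' | ⟨a, ha, hxa⟩
  · exact absurd h' hx
  · obtain ⟨r, hr, hrV⟩ := Metric.mem_nhds_iff.1
      (Filter.inter_mem hV ((h.isOpen_right.preimage hψ.continuous).mem_nhds h'))
    filter_upwards [Metric.ball_mem_nhds x hr] with y hy hyG
    exact ⟨_, (convex_ball x r).isPreconnected, Metric.mem_ball_self hr, hy,
      fun z hz => (hrV hz).1, fun z hz hzG => Set.disjoint_left.1 h.disjoint hzG (hrV hz).2⟩
  · have haG : ∀ z ∈ a, z ∉ G := fun z hz => Set.disjoint_left.1 (h.disjoint_left a ha) hz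
    obtain ⟨U, hU, hsm⟩ := (h.isLoop a ha).shrink hxa (hψ.isOpenMap.image_mem_nhds hV)
    obtain ⟨N, hN, haN, hNc⟩ := h.exists_nhds ha
    obtain ⟨r, hr, hrV⟩ := Metric.mem_nhds_iff.1 (Filter.inter_mem hV
      (hψ.continuous.continuousAt (Filter.inter_mem hU (hN.mem_nhds (haN hxa)))))
    filter_upwards [Metric.ball_mem_nhds x hr] with y hy hyG
    have onA : ∀ z ∈ Metric.ball x r, ψ z ∈ a → ∃ Q, IsPreconnected Q ∧ x ∈ Q ∧ z ∈ Q ∧ Q ⊆ V ∧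
        ∀ w ∈ Q, ψ w ∉ G := by
      intro z hz hza
      by_cases hzx : z = x
      · subst hzx
        exact ⟨{z}, isPreconnected_singleton, rfl, rfl,
          singleton_subset_iff.2 (hrV hz).1, fun w hw => by rw [hw]; exact hx⟩
      · obtain ⟨X, Y, hX, -, -, hXY, hXV⟩ := hsm _ ⟨hza, (hrV hz).2.1⟩ (hψ.injective.ne hzx)
        have hX' := hX.preimage hψ (hXV.trans (image_subset_range _ _))
        exact ⟨_, hX'.isPreconnected, hX'.left_mem, hX'.right_mem,
          fun w hw => hψ.injective.mem_set_image.1 (hXV hw),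
          fun w hw => haG _ (hXY ▸ Or.inl hw)⟩
    rcases hNc (ψ y) (hrV hy).2.2 with h' | h' | h'
    · exact absurd h' hyG
    · have hyx : y ≠ x := by
        rintro rfl
        exact Set.disjoint_left.1 (h.disjoint_right a ha) hxa h'
      obtain ⟨z, hzF, A, hAs, hA, hAF⟩ := (IsArc.segment hyx).first_hit
        (h.isOpen_right.preimage hψ.continuous).isClosed_compl (fun hc => hc h')
        ⟨x, right_mem_segment _ _ _, Set.disjoint_left.1 (h.disjoint_right a ha) hxa⟩
      have hAb : A ⊆ Metric.ball x r := hAs.trans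
        ((convex_ball x r).segment_subset hy (Metric.mem_ball_self hr))
      have hAE : ∀ w ∈ A, w ≠ z → ψ w ∈ E := by
        intro w hw hwz
        by_contra hwE
        have : w ∈ A ∩ (ψ ⁻¹' E)ᶜ := ⟨hw, hwE⟩
        rw [hAF] at this
        exact hwz this
      have hzE : ψ z ∈ closure E := by
        have := hA.subset_closure_interior hA.right_mem
        refine closure_mono ?_ (image_closure_subset_closure_image hψ.continuous ⟨z, this, rfl⟩)
        rintro _ ⟨w, ⟨hw, hw'⟩, rfl⟩
        exact hAE w hw fun e => hw' (Or.inr e)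
      have hzG : ψ z ∉ G :=
        Set.disjoint_right.1 (h.disjoint.closure_right h.isOpen_left) hzE
      have hza : ψ z ∈ a := by
        rcases hNc (ψ z) (hrV (hAb hA.right_mem)).2.2 with h'' | h'' | h''
        · exact absurd h'' hzG
        · exact absurd h'' hzF
        · exact h''
      obtain ⟨Q, hQ, hxQ, hzQ, hQV, hQG⟩ := onA z (hAb hA.right_mem) hza
      refine ⟨Q ∪ A, hQ.union z hzQ hA.right_mem hA.isPreconnected, Or.inl hxQ, Or.inr hA.left_mem,
        union_subset hQV fun w hw => (hrV (hAb hw)).1, ?_⟩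
      rintro w (hw | hw)
      · exact hQG w hw
      · by_cases hwz : w = z
        · exact hwz ▸ hzG
        · exact Set.disjoint_right.1 h.disjoint (hAE w hw hwz)
    · exact onA y hy h'

end IsState

/-- `x` and `y` lie in a common connected subset of `V` which `ψ` maps into the complement
of `G`. -/
def Linked {S : Type*} (ψ : ℂ → S) (G : Set S) (V : Set ℂ) (x y : ℂ) : Prop :=
  ∃ Q, IsPreconnected Q ∧ x ∈ Q ∧ y ∈ Q ∧ Q ⊆ V ∧ ∀ z ∈ Q, ψ z ∉ G

namespace Linked

variable {S : Type*} {ψ : ℂ → S} {G G' : Set S} {V : Set ℂ} {x y z : ℂ}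

theorem symm (h : Linked ψ G V x y) : Linked ψ G V y x := by
  obtain ⟨Q, h1, h2, h3, h4⟩ := h
  exact ⟨Q, h1, h3, h2, h4⟩

theorem trans (h : Linked ψ G V x y) (h' : Linked ψ G V y z) : Linked ψ G V x z := by
  obtain ⟨Q, h1, h2, h3, h4, h5⟩ := h
  obtain ⟨Q', h1', h2', h3', h4', h5'⟩ := h'
  exact ⟨Q ∪ Q', h1.union y h3 h2' h1', Or.inl h2, Or.inr h3', union_subset h4 h4',
    fun w hw => hw.elim (h5 w) (h5' w)⟩

theorem anti (h : Linked ψ G V x y) (hG : G' ⊆ G) : Linked ψ G' V x y := by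
  obtain ⟨Q, h1, h2, h3, h4, h5⟩ := h
  exact ⟨Q, h1, h2, h3, h4, fun z hz hz' => h5 z hz (hG hz')⟩

end Linked

namespace IsState

variable {S : Type*} [TopologicalSpace S]

theorem link_aux [T2Space S] {ψ : ℂ → S} (hψ : IsOpenEmbedding ψ) {V : Set ℂ} (hV : IsOpen V)
    {p q : ℂ} (hVe : segment ℝ p q ⊆ V) (F : Finset ℂ) : ∀ {𝒜 : Finset (Set S)} {G E : Set S},
    IsState 𝒜 G E → (∀ x ∈ segment ℝ p q, ψ x ∉ G → ∃ f ∈ F, Linked ψ G V x f) →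
    ψ p ∉ G → ψ q ∉ G → ∃ 𝒜' G' E', IsState 𝒜' G' E' ∧ G' ⊆ G ∧
      (∃ K, IsCompact K ∧ K ⊆ V ∧ G \ G' ⊆ ψ '' K) ∧ Linked ψ G' V p q := by
  induction F using Finset.strongInduction with
  | H F ih =>
  intro 𝒜 G E h hF hp hq
  by_cases hpq : Linked ψ G V p q
  · exact ⟨𝒜, G, E, h, Subset.rfl, ⟨∅, isCompact_empty, empty_subset _, by simp⟩, hpq⟩
  have hseg : IsCompact (segment ℝ p q) := by
    rw [segment_eq_image]
    exact isCompact_Icc.image (by fun_prop)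
  set T := segment ℝ p q ∩ (ψ ⁻¹' G)ᶜ with hT
  have hTc : IsCompact T := hseg.inter_right (h.isOpen_left.preimage hψ.continuous).isClosed_compl
  have hloc : ∀ x ∈ T, ∀ᶠ y in 𝓝 x, y ∈ T → Linked ψ G V x y := by
    intro x hx
    filter_upwards [h.locally_linked hψ hx.2 (hV.mem_nhds (hVe hx.1))] with y hy hyT
    exact hy hyT.2
  have hpT : p ∈ T := ⟨left_mem_segment _ _ _, hp⟩
  have hqT : q ∈ T := ⟨right_mem_segment _ _ _, hq⟩
  have hpp : Linked ψ G V p p := (hloc p hpT).self_of_nhds hpT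
  have closed : ∀ P : ℂ → Prop, (∀ x y, Linked ψ G V x y → P y → P x) →
      IsCompact {x | x ∈ T ∧ P x} := by
    intro P hP
    refine hTc.of_isClosed_subset ?_ fun x hx => hx.1
    refine isClosed_of_closure_subset fun x hx => ?_
    have hxT : x ∈ T := closure_minimal (fun x hx => hx.1) hTc.isClosed hx
    obtain ⟨y, hy, hy'⟩ := ((mem_closure_iff_frequently.1 hx).and_eventually (hloc x hxT)).exists
    exact ⟨hxT, hP x y (hy' hy.1) hy.2⟩
  have hK₁ := closed (fun x => Linked ψ G V p x) fun x y hxy hy => hy.trans hxy.symm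
  have hK₂ := closed (fun x => ¬ Linked ψ G V p x) fun x y hxy hy hx => hy (hx.trans hxy)
  obtain ⟨⟨z, w⟩, ⟨⟨hzT, hz⟩, ⟨hwT, hw⟩⟩, hmin⟩ := (hK₁.prod hK₂).exists_isMinOn
    ⟨(p, q), ⟨hpT, hpp⟩, ⟨hqT, hpq⟩⟩ (f := fun x : ℂ × ℂ => dist x.1 x.2) (by fun_prop)
  have hzw : z ≠ w := by
    rintro rfl
    exact hw hz
  have hsub : segment ℝ z w ⊆ segment ℝ p q := (convex_segment p q).segment_subset hzT.1 hwT.1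
  have hgap : ∀ m ∈ segment ℝ z w, m ≠ z → m ≠ w → ψ m ∈ G := by
    intro m hm hmz hmw
    by_contra hmG
    have hmT : m ∈ T := ⟨hsub hm, hmG⟩
    have hd : dist z m + dist m w = dist z w := dist_add_dist_of_mem_segment hm
    by_cases hpm : Linked ψ G V p m
    · have := hmin (show ((m, w) : ℂ × ℂ) ∈ _ from ⟨⟨hmT, hpm⟩, ⟨hwT, hw⟩⟩)
      simp only [Set.mem_ofPred_eq] at this
      have := dist_pos.2 hmz.symm
      linarith
    · have := hmin (show ((z, m) : ℂ × ℂ) ∈ _ from ⟨⟨hzT, hz⟩, ⟨hmT, hpm⟩⟩)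
      simp only [Set.mem_ofPred_eq] at this
      have := dist_pos.2 hmw
      linarith
  obtain ⟨R, hR, hRp, hRs, hRV, 𝒜', E', h'⟩ := h.ribbon_segment hψ hzw hgap hzT.2 hwT.2 hV
    (hsub.trans hVe)
  have hsubG : G \ ψ '' R ⊆ G := sdiff_subset
  have hRl : ∀ x ∈ R, ∀ y ∈ R, Linked ψ (G \ ψ '' R) V x y := fun x hx y hy =>
    ⟨R, hRp, hx, hy, hRV, fun m hm hm' => hm'.2 ⟨m, hm, rfl⟩⟩
  have hzR : z ∈ R := hRs (left_mem_segment _ _ _)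
  have hwR : w ∈ R := hRs (right_mem_segment _ _ _)
  obtain ⟨f, hf, hwf⟩ := hF w hwT.1 hwT.2
  obtain ⟨f', hf', hzf⟩ := hF z hzT.1 hzT.2
  have hff : f' ≠ f := by
    rintro rfl
    exact hw (hz.trans (hzf.trans hwf.symm))
  have hzf' : ∃ g ∈ F.erase f, Linked ψ (G \ ψ '' R) V z g :=
    ⟨f', Finset.mem_erase.2 ⟨hff, hf'⟩, hzf.anti hsubG⟩
  obtain ⟨𝒜₂, G₂, E₂, h₂, hG₂, ⟨K, hK, hKV, hKG⟩, hl⟩ := ih (F.erase f) (Finset.erase_ssubset hf) h'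
    (by
      intro x hx hxG
      by_cases hxR : x ∈ R
      · obtain ⟨g, hg, hzg⟩ := hzf'
        exact ⟨g, hg, (hRl x hxR z hzR).trans hzg⟩
      · have hxG' : ψ x ∉ G := fun hx' => hxG ⟨hx', fun hx2 => hxR (hψ.injective.mem_set_image.1 hx2)⟩
        obtain ⟨g, hg, hxg⟩ := hF x hx hxG'
        by_cases hgf : g = f
        · subst hgf
          obtain ⟨g', hg', hzg⟩ := hzf'
          exact ⟨g', hg', ((hxg.trans hwf.symm).anti hsubG).trans ((hRl w hwR z hzR).trans hzg)⟩
        · exact ⟨g, Finset.mem_erase.2 ⟨hgf, hg⟩, hxg.anti hsubG⟩)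
    (fun h => hp h.1) (fun h => hq h.1)
  refine ⟨𝒜₂, G₂, E₂, h₂, hG₂.trans hsubG, ⟨R ∪ K, hR.union hK, union_subset hRV hKV, ?_⟩, hl⟩
  rintro x ⟨hx, hx'⟩
  rw [image_union]
  by_cases hxR : x ∈ ψ '' R
  · exact Or.inl hxR
  · exact Or.inr (hKG ⟨⟨hx, hxR⟩, hx'⟩)

/-- Finitely many ribbons along a segment link its end points. -/
theorem link [T2Space S] {𝒜 : Finset (Set S)} {G E : Set S} (h : IsState 𝒜 G E) {ψ : ℂ → S}
    (hψ : IsOpenEmbedding ψ) {V : Set ℂ} (hV : IsOpen V) {p q : ℂ} (hVe : segment ℝ p q ⊆ V)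
    (hp : ψ p ∉ G) (hq : ψ q ∉ G) : ∃ 𝒜' G' E', IsState 𝒜' G' E' ∧ G' ⊆ G ∧
      (∃ K, IsCompact K ∧ K ⊆ V ∧ G \ G' ⊆ ψ '' K) ∧ Linked ψ G' V p q := by
  have hseg : IsCompact (segment ℝ p q) := by
    rw [segment_eq_image]
    exact isCompact_Icc.image (by fun_prop)
  have hTc : IsCompact (segment ℝ p q ∩ (ψ ⁻¹' G)ᶜ) :=
    hseg.inter_right (h.isOpen_left.preimage hψ.continuous).isClosed_compl
  obtain ⟨F, hF⟩ := hTc.elim_nhds_subcover'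
    (fun x hx => {y | ψ y ∉ G → Linked ψ G V x y})
    (fun x hx => h.locally_linked hψ hx.2 (hV.mem_nhds (hVe hx.1)))
  classical
  refine link_aux hψ hV hVe (F.image Subtype.val) h (fun x hx hxG => ?_) hp hq
  obtain ⟨f, hf, hxf⟩ := mem_iUnion₂.1 (hF ⟨hx, hxG⟩)
  exact ⟨f, Finset.mem_image_of_mem _ hf, (hxf hxG).symm⟩

/-- Any point can be pushed out of the left side. -/
theorem exclude [T2Space S] {𝒜 : Finset (Set S)} {G E : Set S} (h : IsState 𝒜 G E) {ψ : ℂ → S}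
    (hψ : IsOpenEmbedding ψ) (p : ℂ) : ∃ 𝒜' G' E', IsState 𝒜' G' E' ∧ G' ⊆ G ∧
      (∃ K, IsCompact K ∧ G \ G' ⊆ ψ '' K) ∧ ψ p ∉ G' := by
  classical
  by_cases hp : ψ p ∈ G
  · obtain ⟨r, hr, hrG⟩ := Metric.nhds_basis_closedBall.mem_iff.1
      ((h.isOpen_left.preimage hψ.continuous).mem_nhds hp)
    refine ⟨_, _, _, (h.remove_disc hψ hr (image_subset_iff.2 hrG)).2, sdiff_subset,
      ⟨_, isCompact_closedBall p r, ?_⟩, ?_⟩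
    · rw [sdiff_sdiff_right_self]
      exact inter_subset_right
    · exact fun hp' => hp'.2 ⟨p, Metric.mem_closedBall_self hr.le, rfl⟩
  · exact ⟨𝒜, G, E, h, Subset.rfl, ⟨∅, isCompact_empty, by simp⟩, hp⟩

end IsState

theorem sdiff_subset_image_trans {S : Type*} {ψ : ℂ → S} {G G₁ G₂ : Set S} (h₁ : ∃ K, IsCompact K ∧ G \ G₁ ⊆ ψ '' K)
    (h₂ : ∃ K, IsCompact K ∧ G₁ \ G₂ ⊆ ψ '' K) : ∃ K, IsCompact K ∧ G \ G₂ ⊆ ψ '' K := by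
  obtain ⟨K, hK, h⟩ := h₁
  obtain ⟨K', hK', h'⟩ := h₂
  refine ⟨K ∪ K', hK.union hK', fun x hx => ?_⟩
  rw [image_union]
  by_cases hx₁ : x ∈ G₁
  · exact Or.inr (h' ⟨hx₁, hx.2⟩)
  · exact Or.inl (h ⟨hx.1, hx₁⟩)

namespace IsState

variable {S : Type*} [TopologicalSpace S] {𝒜 : Finset (Set S)} {G E : Set S} {ψ : ℂ → S}

theorem exclude_pow [T2Space S] (h : IsState 𝒜 G E) (hψ : IsOpenEmbedding ψ) (n : ℕ) :
    ∃ 𝒜' G' E', IsState 𝒜' G' E' ∧ G' ⊆ G ∧ (∃ K, IsCompact K ∧ G \ G' ⊆ ψ '' K) ∧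
      ∀ j < n, ψ (Complex.I ^ j) ∉ G' := by
  induction n with
  | zero => exact ⟨𝒜, G, E, h, Subset.rfl, ⟨∅, isCompact_empty, by simp⟩, by simp⟩
  | succ n ih =>
    obtain ⟨𝒜₁, G₁, E₁, h₁, hG₁, hK₁, hj⟩ := ih
    obtain ⟨𝒜₂, G₂, E₂, h₂, hG₂, hK₂, hp⟩ := h₁.exclude hψ (Complex.I ^ n)
    refine ⟨𝒜₂, G₂, E₂, h₂, hG₂.trans hG₁, sdiff_subset_image_trans hK₁ hK₂, fun j hj' hjG => ?_⟩
    rcases Nat.lt_succ_iff_lt_or_eq.1 hj' with hlt | rfl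
    · exact hj j hlt (hG₂ hjG)
    · exact hp hjG

/-- A convex neighbourhood of the `j`-th side of the square spanned by the fourth roots of
unity. -/
def sideNhd (j : ℕ) : Set ℂ :=
  {z | 9 / 10 < (z * ((1 - Complex.I) * (-Complex.I) ^ j)).re} ∩ Metric.ball 0 (9 / 5)

theorem isOpen_sideNhd (j : ℕ) : IsOpen (sideNhd j) :=
  (isOpen_lt continuous_const (by fun_prop)).inter Metric.isOpen_ball

theorem segment_subset_sideNhd (j : ℕ) :
    segment ℝ (Complex.I ^ j) (Complex.I ^ (j + 1)) ⊆ sideNhd j := by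
  have hconv : Convex ℝ (sideNhd j) := by
    refine Convex.inter ?_ (convex_ball _ _)
    exact convex_halfSpace_gt ⟨fun x y => by simp [add_mul], fun c x => by
      simp [mul_assoc, mul_sub]⟩ _
  have hI : Complex.I ^ j * (-Complex.I) ^ j = 1 := by
    rw [← mul_pow]
    simp
  refine hconv.segment_subset ⟨?_, by simp; norm_num⟩ ⟨?_, by simp; norm_num⟩
  · have : Complex.I ^ j * ((1 - Complex.I) * (-Complex.I) ^ j) = 1 - Complex.I := by
      linear_combination (1 - Complex.I) * hI
    simp only [Set.mem_ofPred_eq, this]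
    norm_num
  · have : Complex.I ^ (j + 1) * ((1 - Complex.I) * (-Complex.I) ^ j) = 1 + Complex.I := by
      linear_combination (1 - Complex.I) * Complex.I * hI - Complex.I_sq
    simp only [Set.mem_ofPred_eq, this]
    norm_num

theorem link_pow [T2Space S] (h : IsState 𝒜 G E) (hψ : IsOpenEmbedding ψ)
    (hI : ∀ j < 4, ψ (Complex.I ^ j) ∉ G) (n : ℕ) :
    ∃ 𝒜' G' E', IsState 𝒜' G' E' ∧ G' ⊆ G ∧ (∃ K, IsCompact K ∧ G \ G' ⊆ ψ '' K) ∧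
      ∀ j < n, Linked ψ G' (sideNhd j) (Complex.I ^ j) (Complex.I ^ (j + 1)) := by
  have hI' : ∀ j, ψ (Complex.I ^ j) ∉ G := fun j => by
    rw [Complex.I_pow_eq_pow_mod]
    exact hI _ (Nat.mod_lt _ (by norm_num))
  induction n with
  | zero => exact ⟨𝒜, G, E, h, Subset.rfl, ⟨∅, isCompact_empty, by simp⟩, by simp⟩
  | succ n ih =>
    obtain ⟨𝒜₁, G₁, E₁, h₁, hG₁, hK₁, hj⟩ := ih
    obtain ⟨𝒜₂, G₂, E₂, h₂, hG₂, ⟨K, hK, -, hK₂⟩, hl⟩ := h₁.link hψ (isOpen_sideNhd n)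
      (segment_subset_sideNhd n) (fun hx => hI' _ (hG₁ hx)) (fun hx => hI' _ (hG₁ hx))
    refine ⟨𝒜₂, G₂, E₂, h₂, hG₂.trans hG₁, sdiff_subset_image_trans hK₁ ⟨K, hK, hK₂⟩,
      fun j hj' => ?_⟩
    rcases Nat.lt_succ_iff_lt_or_eq.1 hj' with hlt | rfl
    · exact (hj j hlt).anti hG₂
    · exact hl

/-- The left side can be shrunk so that its connected subsets which meet a small disc stay in a
larger disc. -/
theorem trap [T2Space S] (h : IsState 𝒜 G E) (hψ : IsOpenEmbedding ψ) :
    ∃ 𝒜' G' E', IsState 𝒜' G' E' ∧ G' ⊆ G ∧ (∃ K, IsCompact K ∧ G \ G' ⊆ ψ '' K) ∧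
      ∀ C, IsPreconnected C → C ⊆ G' → (C ∩ ψ '' Metric.ball 0 (1 / 2)).Nonempty →
        C ⊆ ψ '' Metric.ball 0 2 := by
  obtain ⟨𝒜₁, G₁, E₁, h₁, hG₁, hK₁, hI⟩ := h.exclude_pow hψ 4
  obtain ⟨𝒜₂, G₂, E₂, h₂, hG₂, hK₂, hl⟩ := h₁.link_pow hψ hI 4
  refine ⟨𝒜₂, G₂, E₂, h₂, hG₂.trans hG₁, sdiff_subset_image_trans hK₁ hK₂, fun C hC hCG hCm => ?_⟩
  have hl' : ∀ j, ∃ Q : Set ℂ, j < 4 → IsPreconnected Q ∧ Complex.I ^ j ∈ Q ∧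
      Complex.I ^ (j + 1) ∈ Q ∧ Q ⊆ sideNhd j ∧ ∀ z ∈ Q, ψ z ∉ G₂ := fun j => by
    by_cases hj : j < 4
    · obtain ⟨Q, hQ⟩ := hl j hj
      exact ⟨Q, fun _ => hQ⟩
    · exact ⟨∅, fun h => absurd h hj⟩
  choose Q hQ using hl'
  set X : Set ℂ := ⋃ j ∈ Finset.range 4, closure (Q j) with hXdef
  have hX : IsClosed X := isClosed_biUnion_finset fun _ _ => isClosed_closure
  have hmem : ∀ z ∈ X, ∃ j < 4, z ∈ closure (Q j) := fun z hz => by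
    simpa [hXdef] using hz
  have hXG : ∀ z ∈ X, ψ z ∉ G₂ := fun z hz => by
    obtain ⟨j, hj, hz⟩ := hmem z hz
    have : closure (Q j) ⊆ (ψ ⁻¹' G₂)ᶜ := closure_minimal (hQ j hj).2.2.2.2
      (h₂.isOpen_left.preimage hψ.continuous).isClosed_compl
    exact this hz
  have hXr : ∀ z ∈ X, ‖z‖ ≤ 9 / 5 := fun z hz => by
    obtain ⟨j, hj, hz⟩ := hmem z hz
    have : closure (Q j) ⊆ Metric.closedBall 0 (9 / 5) := closure_minimal
      (((hQ j hj).2.2.2.1.trans inter_subset_right).trans Metric.ball_subset_closedBall)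
      Metric.isClosed_closedBall
    simpa using this hz
  have hXb : Metric.ball 0 (1 / 2) ⊆ Xᶜ := fun z hz hzX => by
    obtain ⟨j, hj, hzQ⟩ := hmem z hzX
    have : closure (Q j) ⊆ {z | 9 / 10 ≤ (z * ((1 - Complex.I) * (-Complex.I) ^ j)).re} :=
      closure_minimal (fun z hz => le_of_lt (α := ℝ) ((hQ j hj).2.2.2.1 hz).1)
        (isClosed_le continuous_const (by fun_prop))
    have h1 : 9 / 10 ≤ (z * ((1 - Complex.I) * (-Complex.I) ^ j)).re := this hzQ
    have h2 := (Complex.re_le_norm _).trans' h1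
    have h3 : ‖(1 : ℂ) - Complex.I‖ ≤ 3 / 2 := by
      rw [Complex.norm_def, Real.sqrt_le_left (by norm_num)]
      simp [Complex.normSq_apply]
      norm_num
    simp only [norm_mul, norm_pow, norm_neg, Complex.norm_I, one_pow, mul_one] at h2
    have h4 : ‖z‖ < 1 / 2 := by simpa using hz
    nlinarith [norm_nonneg z]
  set W := connectedComponentIn Xᶜ 0 with hW
  have h0X : (0 : ℂ) ∈ Xᶜ := hXb (Metric.mem_ball_self (by norm_num))
  have hbW : Metric.ball 0 (1 / 2) ⊆ W := (convex_ball _ _).isPreconnected.subset_connectedComponentIn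
    (Metric.mem_ball_self (by norm_num)) hXb
  have hWX : W ⊆ Xᶜ := connectedComponentIn_subset _ _
  have hWr : ∀ q ∈ W, ‖q‖ ≤ 9 / 5 := fun q hq =>
    norm_le_of_winding hX hXr Q (fun j hj => (hQ j hj).1)
      (fun j hj z hz => mem_biUnion (x := j) (by simpa using hj) (subset_closure hz))
      (fun j hj => (hQ j hj).2.1) (fun j hj => (hQ j hj).2.2.1)
      (fun j hj z hz => lt_trans (by norm_num) ((hQ j hj).2.2.2.1 hz).1)
      isPreconnected_connectedComponentIn (Set.disjoint_left.2 hWX) (mem_connectedComponentIn h0X) hq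
  have hWo : IsOpen W := hX.isOpen_compl.connectedComponentIn
  have hWc : IsCompact (closure W) := (isCompact_closedBall (0 : ℂ) (9 / 5)).of_isClosed_subset
    isClosed_closure (closure_minimal (fun z hz => by simpa using hWr z hz) Metric.isClosed_closedBall)
  have hsub : C ⊆ ψ '' W := by
    refine hC.subset_of_closure_inter_subset (hψ.isOpenMap _ hWo) (hCm.mono (by gcongr)) ?_
    rintro x ⟨hx, hxC⟩
    obtain ⟨z, hz, rfl⟩ := closure_minimal (image_mono subset_closure)
      (hWc.image hψ.continuous).isClosed hx
    by_cases hzW : z ∈ W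
    · exact ⟨z, hzW, rfl⟩
    · refine absurd (hCG hxC) (hXG z (frontier_connectedComponentIn_subset hX 0 ?_))
      rw [frontier, hWo.interior_eq]
      exact ⟨hz, hzW⟩
  refine hsub.trans (image_mono fun z hz => ?_)
  have := hWr z hz
  simp only [Metric.mem_ball, dist_zero_right]
  linarith

end IsState

section

variable {S : Type*} [TopologicalSpace S]

theorem IsPreconnected.subset_of_disjoint_frontier {C O : Set S} (hC : IsPreconnected C)
    (hO : IsOpen O) (hm : (C ∩ O).Nonempty) (hd : Disjoint C (frontier O)) : C ⊆ O := by
  refine hC.subset_of_closure_inter_subset hO hm ?_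
  rintro x ⟨hx, hxC⟩
  by_contra hxO
  exact Set.disjoint_left.1 hd hxC ⟨hx, by rwa [hO.interior_eq]⟩

namespace IsState

theorem trap_finset [T2Space S] {Z : Set S} (ψ : S → ℂ → S) (F : Finset S)
    (hψ : ∀ x ∈ F, IsOpenEmbedding (ψ x)) (hZ : ∀ x ∈ F, range (ψ x) ⊆ Z) :
    ∃ 𝒜 G E, IsState 𝒜 G E ∧ (∃ K ⊆ Z, IsCompact K ∧ Gᶜ ⊆ K) ∧
      ∀ x ∈ F, ∀ C, IsPreconnected C → C ⊆ G →
        (C ∩ ψ x '' Metric.ball 0 (1 / 2)).Nonempty → C ⊆ ψ x '' Metric.ball 0 2 := by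
  classical
  induction F using Finset.induction_on with
  | empty =>
    refine ⟨∅, univ, ∅, ?_, ⟨∅, empty_subset _, isCompact_empty, by simp⟩, by simp⟩
    constructor <;> simp
  | insert x F hxF ih =>
    obtain ⟨𝒜, G, E, h, ⟨K, hKZ, hK, hGK⟩, ht⟩ := ih
      (fun y hy => hψ y (Finset.mem_insert_of_mem hy))
      (fun y hy => hZ y (Finset.mem_insert_of_mem hy))
    have hx := hψ x (Finset.mem_insert_self _ _)
    obtain ⟨𝒜', G', E', h', hG', ⟨K', hK', hGK'⟩, ht'⟩ := h.trap hx
    refine ⟨𝒜', G', E', h', ⟨K ∪ ψ x '' K', union_subset hKZ ?_, hK.union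
      (hK'.image hx.continuous), fun y hy => ?_⟩, fun y hy C hC hCG hm => ?_⟩
    · exact (image_subset_range _ _).trans (hZ x (Finset.mem_insert_self _ _))
    · by_cases hyG : y ∈ G
      · exact Or.inr (hGK' ⟨hyG, hy⟩)
      · exact Or.inl (hGK hyG)
    · rcases Finset.mem_insert.1 hy with rfl | hy
      · exact ht' C hC hCG hm
      · exact ht y hy C hC (hCG.trans hG') hm

end IsState

/-- A zone without boundary points and with noncompact closure contains the left side of a state
whose closure is not compact. -/
theorem exists_isState_of_zone [T2Space S] [LocallyConnectedSpace S] [LocallyCompactSpace S]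
    {K : Set S} (hK : IsCompact K) {x : S}
    (hB : Disjoint (connectedComponentIn Kᶜ x) (Bd S))
    (hnc : ¬ IsCompact (closure (connectedComponentIn Kᶜ x))) :
    ∃ 𝒜 G E, IsState 𝒜 G E ∧ Disjoint (closure G) (Bd S) ∧ ¬ IsCompact (closure G) := by
  set Z := connectedComponentIn Kᶜ x with hZ
  have hZo : IsOpen Z := hK.isClosed.isOpen_compl.connectedComponentIn
  have hZfr : frontier Z ⊆ K := frontier_connectedComponentIn_subset hK.isClosed x
  have hZcl : ∀ y ∈ closure Z, y ∉ K → y ∈ Z := fun y hy hyK => by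
    by_contra hyZ
    exact hyK (hZfr ⟨hy, by rwa [hZo.interior_eq]⟩)
  obtain ⟨K₁, hK₁, hKK₁⟩ := exists_compact_superset hK
  set T := frontier K₁ ∩ closure Z with hT
  have hTc : IsCompact T := (hK₁.of_isClosed_subset isClosed_frontier
    hK₁.isClosed.frontier_subset).inter_right isClosed_closure
  have hTZ : T ⊆ Z := fun y hy => hZcl y hy.2 fun hyK => hy.1.2 (hKK₁ hyK)
  have hch : ∀ y, ∃ ψ : ℂ → S, y ∈ T → IsOpenEmbedding ψ ∧ ψ 0 = y ∧ range ψ ⊆ Z := fun y => by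
    by_cases hy : y ∈ T
    · obtain ⟨ψ, hψ⟩ := exists_chart (Set.disjoint_left.1 hB (hTZ hy)) (hZo.mem_nhds (hTZ hy))
      exact ⟨ψ, fun _ => hψ⟩
    · exact ⟨fun _ => y, fun h => absurd h hy⟩
  choose ψ hψ using hch
  obtain ⟨F, hFT, hF⟩ := hTc.elim_nhds_subcover (fun y => ψ y '' Metric.ball 0 (1 / 2))
    fun y hy => by
      have := (hψ y hy).1.isOpenMap.image_mem_nhds (Metric.ball_mem_nhds 0 (ε := 1 / 2) (by norm_num))
      rwa [(hψ y hy).2.1] at this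
  obtain ⟨𝒜, G, E, h, ⟨K₂, hK₂Z, hK₂, hGK₂⟩, ht⟩ := IsState.trap_finset ψ F
    (fun y hy => (hψ y (hFT y hy)).1) (fun y hy => (hψ y (hFT y hy)).2.2)
  set O := Z \ K₁ with hO
  have hOo : IsOpen O := hZo.sdiff hK₁.isClosed
  have hOcl : closure O ⊆ Z := by
    intro y hy
    refine hZcl y (closure_mono sdiff_subset hy) fun hyK => ?_
    have : y ∈ closure K₁ᶜ := closure_mono (fun z hz => hz.2) hy
    rw [closure_compl] at this
    exact this (hKK₁ hyK)
  have hOfr : frontier O ⊆ T := by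
    intro y hy
    have h1 : y ∈ closure K₁ᶜ := closure_mono (fun z hz => hz.2) hy.1
    rw [closure_compl] at h1
    refine ⟨⟨?_, h1⟩, closure_mono sdiff_subset hy.1⟩
    by_contra hyK
    have hyK : y ∉ K₁ := fun h => hyK (subset_closure h)
    exact hy.2 (by rw [hOo.interior_eq]; exact ⟨hOcl hy.1, hyK⟩)
  have hco : ∀ P : Set S → Prop, IsOpen {y | y ∈ G ∧ P (connectedComponentIn G y)} := fun P => by
    rw [isOpen_iff_mem_nhds]
    rintro y ⟨hy, hyP⟩
    refine Filter.mem_of_superset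
      ((h.isOpen_left.connectedComponentIn (x := y)).mem_nhds (mem_connectedComponentIn hy))
      fun z hz => ⟨connectedComponentIn_subset _ _ hz, ?_⟩
    rwa [← connectedComponentIn_eq hz]
  set G₁ := {y | y ∈ G ∧ connectedComponentIn G y ⊆ O} with hG₁
  set G₂ := {y | y ∈ G ∧ ¬ connectedComponentIn G y ⊆ O} with hG₂
  have hu : G₁ ∪ G₂ = G := by
    ext y
    simp only [hG₁, hG₂, mem_union, Set.mem_ofPred_eq]
    tauto
  have hG₁O : G₁ ⊆ O := fun y hy => hy.2 (mem_connectedComponentIn hy.1)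
  refine ⟨_, _, _, h.sub (hco fun C => C ⊆ O) (hco fun C => ¬ C ⊆ O)
    (Set.disjoint_left.2 fun y hy hy' => hy'.2 hy.2) hu,
    hB.mono_left ((closure_mono hG₁O).trans hOcl), fun hG₁c => hnc ?_⟩
  have hFc : IsCompact (⋃ y ∈ F, ψ y '' Metric.closedBall 0 2) := F.isCompact_biUnion fun y hy =>
    (isCompact_closedBall 0 2).image (hψ y (hFT y hy)).1.continuous
  have hbig := ((hK₁.union hK₂).union hG₁c).union hFc
  refine hbig.of_isClosed_subset isClosed_closure (closure_minimal (fun z hz => ?_) hbig.isClosed)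
  by_cases hz1 : z ∈ K₁
  · exact Or.inl (Or.inl (Or.inl hz1))
  by_cases hzG : z ∈ G
  swap
  · exact Or.inl (Or.inl (Or.inr (hGK₂ hzG)))
  by_cases hzO : connectedComponentIn G z ⊆ O
  · exact Or.inl (Or.inr (subset_closure ⟨hzG, hzO⟩))
  · right
    have hzc := mem_connectedComponentIn hzG
    have hnd : ¬ Disjoint (connectedComponentIn G z) (frontier O) := fun hd => hzO
      (isPreconnected_connectedComponentIn.subset_of_disjoint_frontier hOo ⟨z, hzc, hz, hz1⟩ hd)
    obtain ⟨w, hw, hwO⟩ := Set.not_disjoint_iff.1 hnd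
    obtain ⟨y, hy, hwy⟩ := mem_iUnion₂.1 (hF (hOfr hwO))
    refine mem_biUnion hy (image_mono Metric.ball_subset_closedBall ?_)
    exact ht y hy _ isPreconnected_connectedComponentIn (connectedComponentIn_subset _ _)
      ⟨w, hw, hwy⟩ hzc

end

theorem exists_last_mem_segment {F : Set ℂ} (hF : IsClosed F) {p w : ℂ} (hp : p ∈ F) (hw : w ∉ F) :
    ∃ z ∈ segment ℝ p w, z ∈ F ∧ z ≠ w ∧ segment ℝ z w ⊆ segment ℝ p w ∧
      ∀ m ∈ segment ℝ z w, m ≠ z → m ∉ F := by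
  have hseg : IsCompact (segment ℝ p w) := by
    rw [segment_eq_image]
    exact isCompact_Icc.image (by fun_prop)
  obtain ⟨z, ⟨hz, hzF⟩, hmin⟩ := (hseg.inter_right hF).exists_isMinOn
    ⟨p, left_mem_segment _ _ _, hp⟩ (f := fun m => dist m w) (by fun_prop)
  have hsub := (convex_segment p w).segment_subset hz (right_mem_segment ℝ p w)
  refine ⟨z, hz, hzF, fun h => hw (h ▸ hzF), hsub, fun m hm hmz hmF => hmz ?_⟩
  have h1 : dist z m + dist m w = dist z w := dist_add_dist_of_mem_segment hm
  have h2 : dist z w ≤ dist m w := hmin ⟨hsub hm, hmF⟩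
  have h3 : dist z m ≤ 0 := by linarith
  exact (dist_le_zero.1 h3).symm

namespace IsState

variable {S : Type*} [TopologicalSpace S] {𝒜 : Finset (Set S)} {G E : Set S}

theorem mem_closure_of_segment {ψ : ℂ → S} (hψ : IsOpenEmbedding ψ) {z w : ℂ} (hzw : z ≠ w)
    {G : Set S} (h : ∀ m ∈ segment ℝ z w, m ≠ z → m ≠ w → ψ m ∈ G) : ψ z ∈ closure G := by
  have h1 : z ∈ closure (openSegment ℝ z w \ {z, w}) := by
    have : openSegment ℝ z w \ {z, w} = openSegment ℝ z w := by
      rw [sdiff_eq_left]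
      rw [Set.disjoint_left]
      rintro m hm (rfl | rfl)
      · exact hzw ((left_mem_openSegment_iff (𝕜 := ℝ)).1 hm)
      · exact hzw ((right_mem_openSegment_iff (𝕜 := ℝ)).1 hm)
    rw [this, closure_openSegment]
    exact left_mem_segment _ _ _
  have h2 := image_closure_subset_closure_image hψ.continuous (mem_image_of_mem ψ h1)
  refine closure_mono ?_ h2
  rintro _ ⟨m, ⟨hm, hm'⟩, rfl⟩
  exact h m (openSegment_subset_segment _ _ _ hm) (fun h => hm' (Or.inl h)) fun h => hm' (Or.inr h)

theorem mem_curve_of_segment (h : IsState 𝒜 G E) {ψ : ℂ → S} (hψ : IsOpenEmbedding ψ) {z w : ℂ}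
    (hzw : z ≠ w) (hG : ∀ m ∈ segment ℝ z w, m ≠ z → m ≠ w → ψ m ∈ G) (hz : ψ z ∉ G) :
    ∃ a ∈ 𝒜, ψ z ∈ a := by
  rcases h.cover (ψ z) with h' | h' | h'
  · exact absurd h' hz
  · exact absurd h' (Set.disjoint_left.1 (h.disjoint.closure_left h.isOpen_right)
      (mem_closure_of_segment hψ hzw hG))
  · exact h'

/-- A point of a curve is the starting point of a segment that runs in the left side. -/
theorem exists_segment [T2Space S] (h : IsState 𝒜 G E) {a : Set S} (ha : a ∈ 𝒜) :
    ∃ ψ : ℂ → S, IsOpenEmbedding ψ ∧ ∃ z w : ℂ, z ≠ w ∧ ψ z ∈ a ∧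
      ∀ m ∈ segment ℝ z w, m ≠ z → ψ m ∈ G := by
  obtain ⟨U, hU, haU, hUc⟩ := h.exists_nhds ha
  obtain ⟨x, hx⟩ := (h.isLoop a ha).nonempty
  obtain ⟨ψ, hψ, h0, hψU⟩ := exists_chart
    (Set.disjoint_left.1 (h.disjoint_Bd a ha) hx) (hU.mem_nhds (haU hx))
  obtain ⟨-, ⟨w, rfl⟩, hw⟩ := mem_closure_iff.1 (h.subset_left a ha hx) (range ψ) hψ.isOpen_range
    ⟨0, h0⟩
  have hx0 : (0 : ℂ) ∈ (ψ ⁻¹' G)ᶜ := fun h' => by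
    rw [mem_preimage, h0] at h'
    exact Set.disjoint_left.1 (h.disjoint_left a ha) hx h'
  obtain ⟨z, -, hzG, hzw, -, hm⟩ := exists_last_mem_segment
    (h.isOpen_left.preimage hψ.continuous).isClosed_compl hx0 (w := w) (fun h' => h' hw)
  have hm' : ∀ m ∈ segment ℝ z w, m ≠ z → ψ m ∈ G := fun m h1 h2 => by
    have := hm m h1 h2
    simpa using this
  refine ⟨ψ, hψ, z, w, hzw, ?_, hm'⟩
  rcases hUc _ (hψU ⟨z, rfl⟩) with h' | h' | h'
  · exact absurd h' hzG
  · exact absurd h' (Set.disjoint_left.1 (h.disjoint.closure_left h.isOpen_right)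
      (mem_closure_of_segment hψ hzw fun m h1 h2 _ => hm' m h1 h2))
  · exact h'

end IsState

/-- A state whose left side is away from the boundary and not relatively compact. -/
structure IsGood {S : Type*} [TopologicalSpace S] (𝒜 : Finset (Set S)) (G E : Set S) : Prop where
  isState : IsState 𝒜 G E
  disjoint_Bd : Disjoint (closure G) (Bd S)
  not_isCompact : ¬ IsCompact (closure G)

namespace IsGood

variable {S : Type*} [TopologicalSpace S] {𝒜 : Finset (Set S)} {G E : Set S}

theorem mono [T2Space S] (h : IsGood 𝒜 G E) {𝒜' : Finset (Set S)} {G' E' K : Set S}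
    (h' : IsState 𝒜' G' E') (hG : G' ⊆ G) (hK : IsCompact K) (hGK : G \ G' ⊆ K) :
    IsGood 𝒜' G' E' := by
  refine ⟨h', h.disjoint_Bd.mono_left (closure_mono hG), fun hc => h.not_isCompact ?_⟩
  refine (hc.union hK).of_isClosed_subset isClosed_closure
    (closure_minimal (fun x hx => ?_) (hc.union hK).isClosed)
  by_cases hx' : x ∈ G'
  · exact Or.inl (subset_closure hx')
  · exact Or.inr (hGK ⟨hx, hx'⟩)

theorem isPreconnected_of_min [T2Space S] [PreconnectedSpace S] (h : IsGood 𝒜 G E)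
    (hmin : ∀ 𝒜' G' E', IsGood (S := S) 𝒜' G' E' → 𝒜.card ≤ 𝒜'.card) : IsPreconnected G := by
  classical
  have key : ∀ G₁ G₂ : Set S, IsOpen G₁ → IsOpen G₂ → Disjoint G₁ G₂ → G₁ ∪ G₂ = G →
      G₁.Nonempty → G₂.Nonempty → IsCompact (closure G₁) := by
    intro G₁ G₂ h₁ h₂ hd hG hn₁ hn₂
    by_contra hc
    have hgood : IsGood _ G₁ _ := ⟨h.isState.sub h₁ h₂ hd hG,
      h.disjoint_Bd.mono_left (closure_mono (hG ▸ subset_union_left)), hc⟩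
    have hcard := hmin _ _ _ hgood
    have hall := Finset.filter_eq_self.1
      (Finset.eq_of_subset_of_card_le (Finset.filter_subset _ _) hcard)
    rcases h.isState.eq_empty_of_no_adherent h₂ h₁ hd hG fun a ha => by
      rcases h.isState.adherent_one_side h₁ h₂ hd hG ha with h' | h'
      · exact h'.2
      · obtain ⟨x, hx⟩ := (h.isState.isLoop a ha).nonempty
        exact absurd (hall a ha hx) (Set.disjoint_left.1 h'.2 hx) with h' | h'
    · exact hn₂.ne_empty h'
    · obtain ⟨x, hx⟩ := hn₁
      exact Set.disjoint_left.1 hd hx (h' ▸ mem_univ x)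
  rw [IsPreconnected]
  by_contra hcon
  push Not at hcon
  obtain ⟨u, v, hu, hv, huv, hnu, hnv, hi⟩ := hcon
  have hd : Disjoint (G ∩ u) (G ∩ v) := by
    rw [Set.disjoint_left]
    rintro x ⟨hx, hxu⟩ ⟨-, hxv⟩
    have hi' : G ∩ (u ∩ v) = ∅ := by simpa [not_nonempty_iff_eq_empty] using hi
    exact (eq_empty_iff_forall_notMem.1 hi') x ⟨hx, hxu, hxv⟩
  have hG : G ∩ u ∪ G ∩ v = G := by rw [← inter_union_distrib_left, inter_eq_left.2 huv]
  have h₁ := h.isState.isOpen_left.inter hu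
  have h₂ := h.isState.isOpen_left.inter hv
  refine h.not_isCompact ?_
  rw [← hG, closure_union]
  exact (key _ _ h₁ h₂ hd hG hnu hnv).union (key _ _ h₂ h₁ hd.symm (by rwa [union_comm]) hnv hnu)

theorem nonempty [ConnectedSpace S] (h : IsGood 𝒜 G E) (hB : (Bd S).Nonempty) : 𝒜.Nonempty := by
  by_contra hne
  rw [Finset.not_nonempty_iff_eq_empty] at hne
  subst hne
  have hcl : IsClopen G := by
    refine ⟨?_, h.isState.isOpen_left⟩
    have : Gᶜ = E := by
      ext x
      constructor
      · intro hx
        rcases h.isState.cover x with h' | h' | ⟨a, ha, -⟩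
        · exact absurd h' hx
        · exact h'
        · simp at ha
      · exact fun hx hx' => Set.disjoint_left.1 h.isState.disjoint hx' hx
    rw [← isOpen_compl_iff, this]
    exact h.isState.isOpen_right
  rcases isClopen_iff.1 hcl with rfl | rfl
  · exact h.not_isCompact (by simp)
  · obtain ⟨x, hx⟩ := hB
    exact Set.disjoint_left.1 h.disjoint_Bd (subset_closure (mem_univ x)) hx

theorem isBoundaryIsolating [T2Space S] [ConnectedSpace S] {a : Set S} (h : IsGood {a} G E)
    (hB : (Bd S).Nonempty) : IsBoundaryIsolating a := by
  have ha : a ∈ ({a} : Finset (Set S)) := Finset.mem_singleton_self a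
  have hs := h.isState
  have hG : IsPreconnected G := hs.isPreconnected_of_singleton
  have hE : IsPreconnected E := hs.symm.isPreconnected_of_singleton
  have hcov : ∀ x, x ∈ G ∨ x ∈ E ∨ x ∈ a := fun x => by simpa using hs.cover x
  have hBE : Bd S ⊆ E := fun x hx => by
    rcases hcov x with h' | h' | h'
    · exact absurd hx (Set.disjoint_left.1 h.disjoint_Bd (subset_closure h'))
    · exact h'
    · exact absurd hx (Set.disjoint_left.1 (hs.disjoint_Bd a ha) h')
  have hGa := Set.disjoint_left.1 (hs.disjoint_left a ha)
  have hEa := Set.disjoint_left.1 (hs.disjoint_right a ha)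
  have hGE := Set.disjoint_left.1 hs.disjoint
  have comp : ∀ {G E : Set S}, IsOpen G → IsOpen E → IsPreconnected G → G ⊆ aᶜ → Disjoint G E →
      (∀ x, x ∈ G ∨ x ∈ E ∨ x ∈ a) → ∀ x ∈ G, connectedComponentIn aᶜ x = G := by
    intro G E hGo hEo hG hGa hGE hcov x hx
    refine Subset.antisymm ?_ (hG.subset_connectedComponentIn hx hGa)
    refine isPreconnected_connectedComponentIn.subset_left_of_subset_union hGo hEo hGE ?_
      ⟨x, mem_connectedComponentIn (hGa hx), hx⟩
    intro y hy
    rcases hcov y with h' | h' | h'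
    · exact Or.inl h'
    · exact Or.inr h'
    · exact absurd h' (connectedComponentIn_subset _ _ hy)
  have compG := comp hs.isOpen_left hs.isOpen_right hG (fun x hx hxa => hGa hxa hx) hs.disjoint hcov
  have compE := comp hs.isOpen_right hs.isOpen_left hE (fun x hx hxa => hEa hxa hx) hs.disjoint.symm
    fun x => by rcases hcov x with h | h | h <;> simp [h]
  obtain ⟨b, hb⟩ := hB
  have hGn : G.Nonempty := by
    rw [nonempty_iff_ne_empty]
    rintro rfl
    exact h.not_isCompact (by simp)
  obtain ⟨g, hg⟩ := hGn
  refine ⟨(hs.isLoop a ha).isSimpleClosedCurve, (hs.disjoint_Bd a ha).inter_eq, E, G, ?_, ?_,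
    ⟨b, hBE hb, hb⟩, (h.disjoint_Bd.mono_left subset_closure).inter_eq, fun hc => h.not_isCompact ?_⟩
  · rintro rfl
    exact hGE hg hg
  · intro C
    constructor
    · rintro ⟨x, hx, rfl⟩
      rcases hcov x with h' | h' | h'
      · exact Or.inr (compG x h')
      · exact Or.inl (compE x h')
      · exact absurd h' hx
    · rintro (rfl | rfl)
      · exact ⟨b, fun hba => hEa hba (hBE hb), (compE b (hBE hb)).symm⟩
      · exact ⟨g, fun hga => hGa hga hg, (compG g hg).symm⟩
  · exact hc.of_isClosed_subset isClosed_closure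
      (closure_minimal subset_union_left hc.isClosed)

end IsGood

open Classical in
/-- The curve `α` can be moved across `G`, away from `β` and the curves in `ℬ`, so that `x` no
longer lies on the left side. -/
def Swept {S : Type*} [TopologicalSpace S] (ℬ : Finset (Set S)) (G β : Set S) (x : S) : Prop :=
  ∃ c G' E' K, IsState (insert c ℬ) G' E' ∧ G' ⊆ G ∧ IsCompact K ∧ Disjoint K β ∧ G \ G' ⊆ K ∧ x ∉ G'

namespace IsGood

variable {S : Type*} [TopologicalSpace S] {𝒜 : Finset (Set S)} {G E : Set S}

open Classical in
theorem notMem_erase_of_min [T2Space S] (h : IsGood 𝒜 G E)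
    (hmin : ∀ 𝒜' G' E', IsGood (S := S) 𝒜' G' E' → 𝒜.card ≤ 𝒜'.card) {α c : Set S} (hα : α ∈ 𝒜)
    {G' E' K : Set S} (h' : IsState (insert c (𝒜.erase α)) G' E') (hG : G' ⊆ G) (hK : IsCompact K)
    (hGK : G \ G' ⊆ K) : c ∉ 𝒜.erase α := by
  intro hc
  have := hmin _ _ _ (h.mono h' hG hK hGK)
  rw [Finset.insert_eq_of_mem hc, Finset.card_erase_of_mem hα] at this
  have := Finset.card_pos.2 ⟨α, hα⟩
  omega

open Classical in
theorem swept_step [T2Space S] (h : IsGood 𝒜 G E)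
    (hmin : ∀ 𝒜' G' E', IsGood (S := S) 𝒜' G' E' → 𝒜.card ≤ 𝒜'.card) {α β : Set S} (hα : α ∈ 𝒜)
    (hβ : β ∈ 𝒜) (hαβ : α ≠ β) {ψ : ℂ → S} (hψ : IsOpenEmbedding ψ) {p w : ℂ}
    (hseg : ∀ m ∈ segment ℝ p w, ψ m ∈ G ∨ ψ m ∈ α)
    (hp : Swept (𝒜.erase α) G β (ψ p)) : Swept (𝒜.erase α) G β (ψ w) := by
  obtain ⟨c, G', E', K, h', hG', hK, hKβ, hGK, hpG⟩ := hp
  by_cases hwG : ψ w ∈ G'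
  swap
  · exact ⟨c, G', E', K, h', hG', hK, hKβ, hGK, hwG⟩
  have hcℬ := h.notMem_erase_of_min hmin hα h' hG' hK hGK
  have hβℬ : β ∈ 𝒜.erase α := Finset.mem_erase.2 ⟨hαβ.symm, hβ⟩
  have hGo := h'.isOpen_left.preimage hψ.continuous
  obtain ⟨z, hz, hzG, hzw, hsub, hzm⟩ := exists_last_mem_segment hGo.isClosed_compl
    (p := p) (w := w) hpG (fun h => h hwG)
  have hzm' : ∀ m ∈ segment ℝ z w, m ≠ z → ψ m ∈ G' := fun m h1 h2 => by simpa using hzm m h1 h2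
  have hzc : ψ z ∈ c := by
    obtain ⟨b, hb, hzb⟩ := h'.mem_curve_of_segment hψ hzw (fun m h1 h2 _ => hzm' m h1 h2) hzG
    rcases Finset.mem_insert.1 hb with rfl | hb
    · exact hzb
    · obtain ⟨hbα, hb⟩ := Finset.mem_erase.1 hb
      rcases hseg z hz with h1 | h1
      · exact absurd h1 (Set.disjoint_left.1 (h.isState.disjoint_left b hb) hzb)
      · exact absurd h1 (Set.disjoint_left.1 (h.isState.pairwise b hb α hα hbα) hzb)
  obtain ⟨r, hr, hrG⟩ := Metric.nhds_basis_closedBall.mem_iff.1 (hGo.mem_nhds hwG)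
  have hDG : ψ '' Metric.closedBall w r ⊆ G' := image_subset_iff.2 hrG
  obtain ⟨hD, h₂⟩ := h'.remove_disc hψ hr hDG
  set D := ψ '' Metric.sphere w r with hDdef
  have hzr : r < ‖z - w‖ := by
    by_contra! hle
    exact hzG (hrG (by simpa [dist_eq_norm] using hle))
  have hzw0 : 0 < ‖z - w‖ := hr.trans hzr
  -- the point of the circle on the segment
  set t : ℝ := r / ‖z - w‖ with ht
  have ht0 : 0 < t := by positivity
  have ht1 : t < 1 := (div_lt_one hzw0).2 hzr
  set q : ℂ := w + t * (z - w) with hq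
  have hpar : ∀ m ∈ segment ℝ z q, m ≠ q → ∃ s : ℝ, t < s ∧ s ≤ 1 ∧ m = w + s * (z - w) := by
    intro m hm hmq
    rw [segment_symm, segment_eq_image] at hm
    obtain ⟨u, ⟨hu0, hu1⟩, rfl⟩ := hm
    refine ⟨t + u * (1 - t), ?_, ?_, ?_⟩
    · have : 0 < u := by
        refine hu0.lt_of_ne ?_
        rintro rfl
        simp at hmq
      nlinarith
    · nlinarith
    · simp only [hq, Complex.real_smul]
      push_cast
      ring
  have hsegw : ∀ s : ℝ, 0 ≤ s → s ≤ 1 → w + s * (z - w) ∈ segment ℝ z w := by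
    intro s h0 h1
    rw [segment_symm, segment_eq_image]
    refine ⟨s, ⟨h0, h1⟩, ?_⟩
    simp only [Complex.real_smul]
    push_cast
    ring
  have hqD : ψ q ∈ D := by
    refine ⟨q, ?_, rfl⟩
    rw [mem_sphere_iff_norm, hq, add_sub_cancel_left, norm_mul, Complex.norm_real,
      Real.norm_of_nonneg ht0.le, ht, div_mul_cancel₀ _ hzw0.ne']
  have hqG : ψ q ∈ G' := hDG (image_mono Metric.sphere_subset_closedBall hqD)
  have hzq : z ≠ q := fun h => hzG (show ψ z ∈ G' from h ▸ hqG)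
  have hcD : c ≠ D := by
    rintro rfl
    exact hD (Finset.mem_insert_self _ _)
  have hβcl : IsClosed β := (h.isState.isLoop β hβ).isClosed
  have hsegβ : segment ℝ z q ⊆ ψ ⁻¹' βᶜ := by
    intro m hm hmβ
    have hmw : m ∈ segment ℝ p w := hsub ((convex_segment z w).segment_subset
      (left_mem_segment _ _ _) (hsegw t ht0.le ht1.le) hm)
    rcases hseg m hmw with h1 | h1
    · exact Set.disjoint_left.1 (h.isState.disjoint_left β hβ) hmβ h1
    · exact Set.disjoint_left.1 (h.isState.pairwise α hα β hβ hαβ) h1 hmβ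
  obtain ⟨R, hR, hRβ, c', E₃, h₃⟩ := h₂.merge_segment
    (Finset.mem_insert_of_mem (Finset.mem_insert_self _ _)) (Finset.mem_insert_self _ _) hcD hψ hzq
    (by
      intro m hm hmz hmq
      obtain ⟨s, hs, hs1, rfl⟩ := hpar m hm hmq
      have hs0 : 0 < s := ht0.trans hs
      refine ⟨hzm' _ (hsegw s hs0.le hs1) hmz, ?_⟩
      rw [hψ.injective.mem_set_image, Metric.mem_closedBall, dist_eq_norm, add_sub_cancel_left,
        norm_mul, Complex.norm_real, Real.norm_of_nonneg hs0.le, not_le]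
      rwa [ht, div_lt_iff₀ hzw0] at hs)
    hzc hqD (hβcl.isOpen_compl.preimage hψ.continuous) hsegβ
  have hcurves : ((insert D (insert c (𝒜.erase α))).erase c).erase D ∪ {c'} =
      insert c' (𝒜.erase α) := by
    have hDc : D ∉ 𝒜.erase α := fun h => hD (Finset.mem_insert_of_mem h)
    ext x
    simp only [Finset.mem_union, Finset.mem_erase, Finset.mem_insert, Finset.mem_singleton] at hDc hcℬ ⊢
    constructor
    · tauto
    · rintro (h | h)
      · exact Or.inr h
      · refine Or.inl ⟨?_, ?_, Or.inr (Or.inr h)⟩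
        · rintro rfl
          exact hDc h
        · rintro rfl
          exact hcℬ h
  rw [hcurves] at h₃
  refine ⟨c', _, E₃, K ∪ (ψ '' Metric.closedBall w r ∪ ψ '' R), h₃,
    (sdiff_subset.trans sdiff_subset).trans hG', hK.union
      (((isCompact_closedBall w r).image hψ.continuous).union (hR.image hψ.continuous)), ?_, ?_, ?_⟩
  · rw [disjoint_union_left, disjoint_union_left]
    refine ⟨hKβ, ?_, ?_⟩
    · exact (h'.disjoint_left β (Finset.mem_insert_of_mem hβℬ)).symm.mono_left hDG
    · rw [Set.disjoint_left]
      rintro _ ⟨m, hm, rfl⟩ hmβ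
      exact hRβ hm hmβ
  · rintro x ⟨hx, hx'⟩
    by_cases h1 : x ∈ G'
    · by_cases h2 : x ∈ ψ '' Metric.closedBall w r
      · exact Or.inr (Or.inl h2)
      · by_cases h3 : x ∈ ψ '' R
        · exact Or.inr (Or.inr h3)
        · exact absurd ⟨⟨h1, h2⟩, h3⟩ hx'
    · exact Or.inl (hGK ⟨hx, h1⟩)
  · exact fun hx => hx.1.2 ⟨w, Metric.mem_closedBall_self hr.le, rfl⟩

open Classical in
theorem not_swept [T2Space S] (h : IsGood 𝒜 G E)
    (hmin : ∀ 𝒜' G' E', IsGood (S := S) 𝒜' G' E' → 𝒜.card ≤ 𝒜'.card) {α β : Set S} (hα : α ∈ 𝒜)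
    (hβ : β ∈ 𝒜) (hαβ : α ≠ β) {ψ : ℂ → S} (hψ : IsOpenEmbedding ψ) {p w : ℂ}
    (hseg : ∀ m ∈ segment ℝ p w, m ≠ w → ψ m ∈ G) (hpw : p ≠ w) (hw : ψ w ∈ β) :
    ¬ Swept (𝒜.erase α) G β (ψ p) := by
  rintro ⟨c, G', E', K, h', hG', hK, hKβ, hGK, hpG⟩
  have hcℬ := h.notMem_erase_of_min hmin hα h' hG' hK hGK
  have hβℬ : β ∈ 𝒜.erase α := Finset.mem_erase.2 ⟨hαβ.symm, hβ⟩
  have hGo := h'.isOpen_left.preimage hψ.continuous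
  set F : Set ℂ := (ψ ⁻¹' G')ᶜ ∩ ψ ⁻¹' K with hF
  have hFc : IsClosed F := hGo.isClosed_compl.inter (hK.isClosed.preimage hψ.continuous)
  have hwF : w ∉ F := fun hwF => Set.disjoint_left.1 hKβ hwF.2 hw
  have hpF : p ∈ F := ⟨hpG, hGK ⟨hseg p (left_mem_segment _ _ _) hpw, hpG⟩⟩
  obtain ⟨z, hz, hzF, hzw, hsub, hzm⟩ := exists_last_mem_segment hFc hpF hwF
  have hzG : ψ z ∉ G' := hzF.1
  have hzm' : ∀ m ∈ segment ℝ z w, m ≠ z → m ≠ w → ψ m ∈ G' := fun m h1 h2 h3 => by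
    by_contra hm
    exact hzm m h1 h2 ⟨hm, hGK ⟨hseg m (hsub h1) h3, hm⟩⟩
  have hzc : ψ z ∈ c := by
    obtain ⟨b, hb, hzb⟩ := h'.mem_curve_of_segment hψ hzw hzm' hzG
    rcases Finset.mem_insert.1 hb with rfl | hb
    · exact hzb
    · exact absurd (hseg z hz hzw)
        (Set.disjoint_left.1 (h.isState.disjoint_left b (Finset.mem_of_mem_erase hb)) hzb)
  have hcβ : c ≠ β := by
    rintro rfl
    exact hcℬ hβℬ
  obtain ⟨R, hR, -, c', E₃, h₃⟩ := h'.merge_segment (Finset.mem_insert_self _ _)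
    (Finset.mem_insert_of_mem hβℬ) hcβ hψ hzw hzm' hzc hw isOpen_univ (subset_univ _)
  have hgood := h.mono h₃ (sdiff_subset.trans hG') (hK.union (hR.image hψ.continuous)) (by
    rintro x ⟨hx, hx'⟩
    by_cases h1 : x ∈ G'
    · by_cases h3 : x ∈ ψ '' R
      · exact Or.inr h3
      · exact absurd ⟨h1, h3⟩ hx'
    · exact Or.inl (hGK ⟨hx, h1⟩))
  have hle := hmin _ _ _ hgood
  rw [Finset.erase_insert hcℬ] at hle
  have h1 := Finset.card_union_le ((𝒜.erase α).erase β) {c'}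
  rw [Finset.card_singleton] at h1
  have h2 := Finset.card_erase_lt_of_mem hβℬ
  have h3 := Finset.card_erase_lt_of_mem hα
  omega

theorem card_le_one [T2Space S] [PreconnectedSpace S] (h : IsGood 𝒜 G E)
    (hmin : ∀ 𝒜' G' E', IsGood (S := S) 𝒜' G' E' → 𝒜.card ≤ 𝒜'.card) : 𝒜.card ≤ 1 := by
  classical
  rw [Finset.card_le_one]
  by_contra! hcon
  obtain ⟨α, hα, β, hβ, hαβ⟩ := hcon
  have hs := h.isState
  obtain ⟨ψ, hψ, z, w, hzw, hzα, hzG⟩ := hs.exists_segment hα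
  obtain ⟨φ, hφ, v, u, hvu, hvβ, hvG⟩ := hs.exists_segment hβ
  have hstart : Swept (𝒜.erase α) G β (ψ z) := by
    refine ⟨α, G, E, ∅, by rwa [Finset.insert_erase hα], Subset.rfl, isCompact_empty,
      empty_disjoint _, by simp, fun hz => Set.disjoint_left.1 (hs.disjoint_left α hα) hzα hz⟩
  have hw : Swept (𝒜.erase α) G β (ψ w) := by
    refine h.swept_step hmin hα hβ hαβ hψ (fun m hm => ?_) hstart
    by_cases hmz : m = z
    · exact Or.inr (hmz ▸ hzα)
    · exact Or.inl (hzG m hm hmz)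
  have hu : Swept (𝒜.erase α) G β (φ u) := by
    refine (h.isPreconnected_of_min hmin).rel_of_open_classes
      (fun x y => Swept (𝒜.erase α) G β x → Swept (𝒜.erase α) G β y)
      (fun x _ y _ z _ h1 h2 h3 => h2 (h1 h3)) ?_
      (hzG w (right_mem_segment _ _ _) hzw.symm) (hvG u (right_mem_segment _ _ _) hvu.symm) hw
    intro x hx
    obtain ⟨χ, hχ, rfl, hχG⟩ := exists_chart
      (Set.disjoint_left.1 h.disjoint_Bd (subset_closure hx)) (hs.isOpen_left.mem_nhds hx)
    filter_upwards [mem_nhdsWithin_of_mem_nhds (hχ.isOpen_range.mem_nhds ⟨0, rfl⟩)]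
    rintro _ ⟨y, rfl⟩
    exact ⟨h.swept_step hmin hα hβ hαβ hχ fun m _ => Or.inl (hχG ⟨m, rfl⟩),
      h.swept_step hmin hα hβ hαβ hχ fun m _ => Or.inl (hχG ⟨m, rfl⟩)⟩
  refine h.not_swept hmin hα hβ hαβ hφ (p := u) (w := v) ?_ hvu.symm hvβ hu
  intro m hm hmv
  exact hvG m (segment_symm ℝ v u ▸ hm) hmv

end IsGood

/-- In a surface with boundary and without boundary isolating curves, a complementary component of
a compact set that misses the boundary is relatively compact. -/
theorem isCompact_closure_of_no_boundaryIsolating {S : Type*} [TopologicalSpace S] [T2Space S]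
    [ConnectedSpace S] [LocallyConnectedSpace S] [LocallyCompactSpace S] (hB : (Bd S).Nonempty)
    (hbi : ¬ ∃ α : Set S, IsBoundaryIsolating α) {K : Set S} (hK : IsCompact K) {x : S}
    (hd : Disjoint (connectedComponentIn Kᶜ x) (Bd S)) :
    IsCompact (closure (connectedComponentIn Kᶜ x)) := by
  classical
  by_contra hnc
  obtain ⟨𝒜, G, E, h⟩ := exists_isState_of_zone hK hd hnc
  have hex : ∃ n, ∃ 𝒜 G E, IsGood (S := S) 𝒜 G E ∧ 𝒜.card = n :=
    ⟨_, 𝒜, G, E, ⟨h.1, h.2.1, h.2.2⟩, rfl⟩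
  obtain ⟨𝒜, G, E, hgood, hcard⟩ := Nat.find_spec hex
  have hmin : ∀ 𝒜' G' E', IsGood (S := S) 𝒜' G' E' → 𝒜.card ≤ 𝒜'.card := fun 𝒜' G' E' h' =>
    hcard ▸ Nat.find_min' hex ⟨𝒜', G', E', h', rfl⟩
  have h1 : 𝒜.card = 1 := le_antisymm (hgood.card_le_one hmin)
    (Finset.card_pos.2 (hgood.nonempty hB))
  obtain ⟨a, rfl⟩ := Finset.card_eq_one.1 h1
  exact hbi ⟨a, hgood.isBoundaryIsolating hB⟩

section

variable {S : Type*} [TopologicalSpace S]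

theorem exists_isOpen_isPreconnected_isCompact_closure [T2Space S] [LocallyConnectedSpace S]
    [LocallyCompactSpace S] {W : Set S} (hW : IsOpen W) (hWp : IsPreconnected W) {x y : S}
    (hx : x ∈ W) (hy : y ∈ W) : ∃ O, IsOpen O ∧ IsPreconnected O ∧ x ∈ O ∧ y ∈ O ∧
      IsCompact (closure O) ∧ closure O ⊆ W := by
  refine hWp.rel_of_open_classes (fun x y => ∃ O, IsOpen O ∧ IsPreconnected O ∧ x ∈ O ∧ y ∈ O ∧
      IsCompact (closure O) ∧ closure O ⊆ W) ?_ ?_ hx hy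
  · rintro x - y - z - ⟨O, h1, h2, h3, h4, h5, h6⟩ ⟨O', h1', h2', h3', h4', h5', h6'⟩
    refine ⟨O ∪ O', h1.union h1', h2.union y h4 h3' h2', Or.inl h3, Or.inr h4', ?_, ?_⟩
    · rw [closure_union]
      exact h5.union h5'
    · rw [closure_union]
      exact union_subset h6 h6'
  · intro x hx
    obtain ⟨N, hN, hxN, hNW⟩ := exists_compact_subset hW hx
    obtain ⟨V, hVN, hV, hxV, hVc⟩ := locallyConnectedSpace_iff_subsets_isOpen_isConnected.1
      inferInstance x _ (isOpen_interior.mem_nhds hxN)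
    have hcl : closure V ⊆ N := closure_minimal (hVN.trans interior_subset) hN.isClosed
    filter_upwards [mem_nhdsWithin_of_mem_nhds (hV.mem_nhds hxV)] with y hy
    have hc := hN.of_isClosed_subset isClosed_closure hcl
    exact ⟨⟨V, hV, hVc.isPreconnected, hxV, hy, hc, hcl.trans hNW⟩,
      V, hV, hVc.isPreconnected, hy, hxV, hc, hcl.trans hNW⟩

theorem exists_isCompact_isPreconnected_superset [T2Space S] [LocallyConnectedSpace S]
    [LocallyCompactSpace S] [PreconnectedSpace S] {A : Set S} (hA : IsCompact A) (a : S) :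
    ∃ K, IsCompact K ∧ IsPreconnected K ∧ A ⊆ K ∧ a ∈ K := by
  have hex : ∀ x, ∃ O, IsOpen O ∧ IsPreconnected O ∧ a ∈ O ∧ x ∈ O ∧ IsCompact (closure O) := by
    intro x
    obtain ⟨O, h1, h2, h3, h4, h5, -⟩ := exists_isOpen_isPreconnected_isCompact_closure isOpen_univ
      isPreconnected_univ (mem_univ a) (mem_univ x)
    exact ⟨O, h1, h2, h3, h4, h5⟩
  choose O h1 h2 h3 h4 h5 using hex
  obtain ⟨F, -, hF⟩ := hA.elim_nhds_subcover O fun x _ => (h1 x).mem_nhds (h4 x)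
  refine ⟨(⋃ x ∈ F, closure (O x)) ∪ {a}, (F.isCompact_biUnion fun x _ => h5 x).union
    isCompact_singleton, ?_, fun x hx => Or.inl ?_, Or.inr rfl⟩
  · have : (⋃ x ∈ F, closure (O x)) ∪ {a} = ⋃₀ (insert {a} ((fun x => closure (O x)) '' F)) := by
      rw [sUnion_insert, sUnion_image, union_comm]
      rfl
    rw [this]
    refine isPreconnected_sUnion a _ ?_ ?_
    · rintro _ (rfl | ⟨x, -, rfl⟩)
      · rfl
      · exact subset_closure (h3 x)
    · rintro _ (rfl | ⟨x, -, rfl⟩)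
      · exact isPreconnected_singleton
      · exact (h2 x).closure
  · obtain ⟨y, hy, hxy⟩ := mem_iUnion₂.1 (hF hx)
    exact mem_biUnion hy (subset_closure hxy)

/-- `K` together with the complementary components that miss `B`. -/
def fill (B K : Set S) : Set S := {x | x ∈ K ∨ Disjoint (connectedComponentIn Kᶜ x) B}

variable {B K : Set S}

theorem subset_fill : K ⊆ fill B K := fun _ hx => Or.inl hx

theorem connectedComponentIn_subset_fill {x : S} (hd : Disjoint (connectedComponentIn Kᶜ x) B) :
    connectedComponentIn Kᶜ x ⊆ fill B K := fun y hy => by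
  refine Or.inr ?_
  rwa [← connectedComponentIn_eq hy]

theorem connectedComponentIn_subset_compl_fill {x : S}
    (hd : ¬ Disjoint (connectedComponentIn Kᶜ x) B) :
    connectedComponentIn Kᶜ x ⊆ (fill B K)ᶜ := by
  rintro y hy (hyK | hyd)
  · exact connectedComponentIn_subset _ _ hy hyK
  · rw [← connectedComponentIn_eq hy] at hyd
    exact hd hyd

theorem connectedComponentIn_compl_fill_inter {x : S} (hx : x ∉ fill B K) :
    (connectedComponentIn (fill B K)ᶜ x ∩ B).Nonempty := by
  have hxK : x ∈ Kᶜ := fun h => hx (Or.inl h)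
  have hd : ¬ Disjoint (connectedComponentIn Kᶜ x) B := fun h => hx (Or.inr h)
  refine (Set.not_disjoint_iff_nonempty_inter.1 hd).mono (inter_subset_inter_left _ ?_)
  exact isPreconnected_connectedComponentIn.subset_connectedComponentIn
    (mem_connectedComponentIn hxK) (connectedComponentIn_subset_compl_fill hd)

theorem isClosed_fill [LocallyConnectedSpace S] (hK : IsClosed K) : IsClosed (fill B K) := by
  rw [← isOpen_compl_iff, isOpen_iff_mem_nhds]
  intro x hx
  have hxK : x ∈ Kᶜ := fun h => hx (Or.inl h)
  exact Filter.mem_of_superset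
    (hK.isOpen_compl.connectedComponentIn.mem_nhds (mem_connectedComponentIn hxK))
    (connectedComponentIn_subset_compl_fill fun h => hx (Or.inr h))

theorem frontier_fill_subset [LocallyConnectedSpace S] (hK : IsClosed K) :
    frontier (fill B K) ⊆ frontier K := by
  rintro x ⟨hx, hxi⟩
  rw [(isClosed_fill hK).closure_eq] at hx
  rcases em (x ∈ K) with hxK | hxK
  · exact ⟨subset_closure hxK, fun h => hxi (interior_mono subset_fill h)⟩
  · refine absurd (mem_interior.2 ⟨_, connectedComponentIn_subset_fill (hx.resolve_left hxK),
      hK.isOpen_compl.connectedComponentIn, mem_connectedComponentIn hxK⟩) hxi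

theorem frontier_connectedComponentIn_nonempty [PreconnectedSpace S] (hKn : K.Nonempty) {x : S} (hx : x ∉ K) :
    (frontier (connectedComponentIn Kᶜ x)).Nonempty := by
  rw [nonempty_iff_ne_empty]
  intro hfr
  have hcl := isClopen_iff_frontier_eq_empty.2 hfr
  rcases isClopen_iff.1 hcl with h | h
  · exact (h ▸ mem_connectedComponentIn (F := Kᶜ) hx : x ∈ (∅ : Set S))
  · obtain ⟨y, hy⟩ := hKn
    exact connectedComponentIn_subset Kᶜ x (h ▸ mem_univ y) hy

theorem isPreconnected_fill [LocallyConnectedSpace S] [PreconnectedSpace S]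
    (hK : IsClosed K) (hKn : K.Nonempty) (hKp : IsPreconnected K) : IsPreconnected (fill B K) := by
  obtain ⟨a, ha⟩ := hKn
  refine isPreconnected_of_forall a fun x hx => ?_
  by_cases hxK : x ∈ K
  · exact ⟨K, subset_fill, ha, hxK, hKp⟩
  obtain ⟨y, hy⟩ := frontier_connectedComponentIn_nonempty ⟨a, ha⟩ hxK
  have hyK := frontier_connectedComponentIn_subset hK x hy
  refine ⟨K ∪ closure (connectedComponentIn Kᶜ x), union_subset subset_fill ?_, Or.inl ha,
    Or.inr (subset_closure (mem_connectedComponentIn hxK)), hKp.union y hyK hy.1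
      isPreconnected_connectedComponentIn.closure⟩
  exact closure_minimal (connectedComponentIn_subset_fill (hx.resolve_left hxK)) (isClosed_fill hK)

theorem isCompact_fill [T2Space S] [LocallyConnectedSpace S] [LocallyCompactSpace S]
    [PreconnectedSpace S] (hK : IsCompact K) (hKn : K.Nonempty)
    (hA : ∀ x, Disjoint (connectedComponentIn Kᶜ x) B →
      IsCompact (closure (connectedComponentIn Kᶜ x))) : IsCompact (fill B K) := by
  obtain ⟨M, hM, hKM⟩ := exists_compact_superset hK
  have hfrM : IsCompact (frontier M ∩ fill B K) := (hM.of_isClosed_subset isClosed_frontier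
    hM.isClosed.frontier_subset).inter_right (isClosed_fill hK.isClosed)
  have hfrK : ∀ x ∈ frontier M, x ∈ Kᶜ := fun x hx hxK => hx.2 (hKM hxK)
  obtain ⟨F, hFs, hF⟩ := hfrM.elim_nhds_subcover (fun x => connectedComponentIn Kᶜ x) fun x hx =>
    hK.isClosed.isOpen_compl.connectedComponentIn.mem_nhds
      (mem_connectedComponentIn (hfrK x hx.1))
  have hbig : IsCompact (M ∪ ⋃ x ∈ F, closure (connectedComponentIn Kᶜ x)) :=
    hM.union (F.isCompact_biUnion fun x hx =>
      hA x ((hFs x hx).2.resolve_left (hfrK x (hFs x hx).1)))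
  refine hbig.of_isClosed_subset (isClosed_fill hK.isClosed) fun x hx => ?_
  by_cases hxM : x ∈ M
  · exact Or.inl hxM
  right
  have hxK : x ∉ K := fun h => hxM (interior_subset (hKM h))
  have hxc := mem_connectedComponentIn (F := Kᶜ) hxK
  have hnd : ¬ Disjoint (connectedComponentIn Kᶜ x) (frontier M) := by
    intro hd
    rw [← frontier_compl] at hd
    have hsub := isPreconnected_connectedComponentIn.subset_of_disjoint_frontier
      hM.isClosed.isOpen_compl ⟨x, hxc, hxM⟩ hd
    obtain ⟨y, hy⟩ := frontier_connectedComponentIn_nonempty hKn hxK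
    have h1 := closure_mono hsub hy.1
    rw [closure_compl] at h1
    exact h1 (hKM (frontier_connectedComponentIn_subset hK.isClosed x hy))
  obtain ⟨y, hy, hyM⟩ := Set.not_disjoint_iff.1 hnd
  obtain ⟨z, hz, hyz⟩ := mem_iUnion₂.1 (hF ⟨hyM, connectedComponentIn_subset_fill
    (hx.resolve_left hxK) hy⟩)
  refine mem_biUnion hz (subset_closure ?_)
  rwa [connectedComponentIn_eq hyz, ← connectedComponentIn_eq hy]

end

section

variable {S : Type*} [TopologicalSpace S] {B : Set S}

/-- A compact set is contained in the interior of a continuum whose complementary components meet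
`B`, and whose frontier is covered by connected sets that meet `B` and stay outside its interior. -/
theorem exists_isCompact_frontier_subset [T2Space S] [LocallyConnectedSpace S]
    [LocallyCompactSpace S] [PreconnectedSpace S]
    (hB : ∀ K : Set S, IsCompact K → ∀ x, Disjoint (connectedComponentIn Kᶜ x) B →
      IsCompact (closure (connectedComponentIn Kᶜ x))) {A : Set S} (hA : IsCompact A) (a : S) :
    ∃ K C, IsCompact K ∧ IsPreconnected K ∧ a ∈ interior K ∧ A ⊆ interior K ∧
      (∀ x ∈ Kᶜ, (connectedComponentIn Kᶜ x ∩ B).Nonempty) ∧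
      IsCompact C ∧ frontier K ⊆ C ∧ Disjoint C (interior K) ∧
      ∀ y ∈ C, ∃ D ⊆ C, IsPreconnected D ∧ y ∈ D ∧ (D ∩ B).Nonempty := by
  obtain ⟨A₁, hA₁, hA₁p, hAA₁, ha₁⟩ := exists_isCompact_isPreconnected_superset hA a
  set A₀ := fill B A₁ with hA₀def
  have hA₀ : IsCompact A₀ := isCompact_fill hA₁ ⟨a, ha₁⟩ (hB A₁ hA₁)
  have hA₀p : IsPreconnected A₀ := isPreconnected_fill hA₁.isClosed ⟨a, ha₁⟩ hA₁p
  have ha₀ : a ∈ A₀ := subset_fill ha₁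
  obtain ⟨M, hM, hAM⟩ := exists_compact_superset hA₀
  have hex : ∀ x, ∃ O, x ∈ frontier M → IsOpen O ∧ IsPreconnected O ∧ x ∈ O ∧ (O ∩ B).Nonempty ∧
      IsCompact (closure O) ∧ closure O ⊆ A₀ᶜ := by
    intro x
    by_cases hx : x ∈ frontier M
    swap
    · exact ⟨∅, fun h => absurd h hx⟩
    have hxA : x ∉ A₀ := fun h => hx.2 (hAM h)
    obtain ⟨b, hb, hbB⟩ := connectedComponentIn_compl_fill_inter hxA
    obtain ⟨O, h1, h2, h3, h4, h5, h6⟩ := exists_isOpen_isPreconnected_isCompact_closure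
      (hA₀.isClosed.isOpen_compl.connectedComponentIn (x := x)) isPreconnected_connectedComponentIn
      (mem_connectedComponentIn hxA) hb
    exact ⟨O, fun _ => ⟨h1, h2, h3, ⟨b, h4, hbB⟩, h5, h6.trans (connectedComponentIn_subset _ _)⟩⟩
  choose O hO using hex
  have hMfr : IsCompact (frontier M) := hM.of_isClosed_subset isClosed_frontier
    hM.isClosed.frontier_subset
  obtain ⟨F, hFs, hF⟩ := hMfr.elim_nhds_subcover O fun x hx =>
    (hO x hx).1.mem_nhds (hO x hx).2.2.1
  set V := ⋃ x ∈ F, O x with hV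
  set C := ⋃ x ∈ F, closure (O x) with hC
  have hVo : IsOpen V := isOpen_biUnion fun x hx => (hO x (hFs x hx)).1
  have hVC : V ⊆ C := iUnion₂_mono fun x _ => subset_closure
  have hCc : IsCompact C := F.isCompact_biUnion fun x hx => (hO x (hFs x hx)).2.2.2.2.1
  have hCA : Disjoint C A₀ := by
    rw [Set.disjoint_left]
    intro y hy hyA
    obtain ⟨x, hx, hyx⟩ := mem_iUnion₂.1 hy
    exact (hO x (hFs x hx)).2.2.2.2.2 hyx hyA
  set K' := M \ V with hK'
  have hK'c : IsCompact K' := hM.diff hVo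
  have hA₀K' : A₀ ⊆ K' := fun y hy =>
    ⟨interior_subset (hAM hy), fun h => Set.disjoint_left.1 hCA (hVC h) hy⟩
  set L := connectedComponentIn K' a with hL
  have hLp : IsPreconnected L := isPreconnected_connectedComponentIn
  have haL : a ∈ L := mem_connectedComponentIn (hA₀K' ha₀)
  have hLK' : L ⊆ K' := connectedComponentIn_subset _ _
  have hLc : IsCompact L := by
    refine hK'c.of_isClosed_subset (isClosed_of_closure_subset ?_) hLK'
    exact hLp.closure.subset_connectedComponentIn (subset_closure haL)
      (closure_minimal hLK' hK'c.isClosed)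
  have hA₀L : A₀ ⊆ L := hA₀p.subset_connectedComponentIn ha₀ hA₀K'
  have hint : ∀ y ∈ L, y ∈ interior M → y ∉ C → y ∈ interior L := by
    intro y hy hyM hyC
    obtain ⟨N, hN, hNo, hyN, hNc⟩ := locallyConnectedSpace_iff_subsets_isOpen_isConnected.1
      inferInstance y (interior M \ C) ((isOpen_interior.sdiff hCc.isClosed).mem_nhds ⟨hyM, hyC⟩)
    refine mem_interior.2 ⟨N, ?_, hNo, hyN⟩
    have hNK' : N ⊆ K' := fun z hz => ⟨interior_subset (hN hz).1, fun h => (hN hz).2 (hVC h)⟩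
    rw [hL, connectedComponentIn_eq hy]
    exact hNc.isPreconnected.subset_connectedComponentIn hyN hNK'
  have hA₀int : A₀ ⊆ interior (fill B L) := fun y hy => interior_mono subset_fill
    (hint y (hA₀L hy) (hAM hy) fun h => Set.disjoint_left.1 hCA h hy)
  have hVfill : ∀ x ∈ F, Disjoint (O x) (fill B L) := by
    intro x hx
    obtain ⟨h1, h2, h3, ⟨b, hb, hbB⟩, -, -⟩ := hO x (hFs x hx)
    rw [Set.disjoint_left]
    have hOL : O x ⊆ Lᶜ := fun y hy hyL => (hLK' hyL).2 (mem_biUnion hx hy)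
    rintro y hy (hyL | hyd)
    · exact hOL hy hyL
    · exact Set.disjoint_left.1 hyd (h2.subset_connectedComponentIn hy hOL hb) hbB
  refine ⟨fill B L, C, isCompact_fill hLc ⟨a, haL⟩ (hB L hLc),
    isPreconnected_fill hLc.isClosed ⟨a, haL⟩ hLp, hA₀int ha₀,
    (hAA₁.trans subset_fill).trans hA₀int, fun x hx => connectedComponentIn_compl_fill_inter hx,
    hCc, ?_, ?_, ?_⟩
  · intro y hy
    obtain ⟨hy1, hy2⟩ := frontier_fill_subset hLc.isClosed hy
    rw [hLc.isClosed.closure_eq] at hy1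
    by_contra hyC
    refine hy2 (hint y hy1 ?_ hyC)
    by_contra hyM
    exact (hLK' hy1).2 (hF ⟨subset_closure (hLK' hy1).1, hyM⟩)
  · rw [Set.disjoint_left]
    intro y hy hyi
    obtain ⟨x, hx, hyx⟩ := mem_iUnion₂.1 hy
    obtain ⟨z, hz, hzO⟩ := mem_closure_iff.1 hyx _ isOpen_interior hyi
    exact Set.disjoint_left.1 (hVfill x hx) hzO (interior_subset hz)
  · intro y hy
    obtain ⟨x, hx, hyx⟩ := mem_iUnion₂.1 hy
    refine ⟨closure (O x), subset_biUnion_of_mem (u := fun x => closure (O x)) hx,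
      (hO x (hFs x hx)).2.1.closure, hyx, ?_⟩
    exact (hO x (hFs x hx)).2.2.2.1.mono (inter_subset_inter_left _ subset_closure)

/-- Boundary bumping. -/
theorem connectedComponentIn_sdiff_interior_inter_frontier [T2Space S] {K L : Set S}
    (hK : IsClosed K) (hL : IsCompact L) (hLp : IsPreconnected L) (hKL : (interior K ∩ L).Nonempty)
    {x : S} (hx : x ∈ L \ interior K) :
    (connectedComponentIn (L \ interior K) x ∩ frontier K).Nonempty := by
  set P := L \ interior K with hP
  have hPc : IsCompact P := hL.diff isOpen_interior
  have : CompactSpace P := isCompact_iff_compactSpace.1 hPc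
  rw [← Set.not_disjoint_iff_nonempty_inter]
  intro hd
  rw [connectedComponentIn_eq_image hx] at hd
  set T : Set P := Subtype.val ⁻¹' frontier K with hT
  have hTc : IsClosed T := isClosed_frontier.preimage continuous_subtype_val
  have hdis : connectedComponent (⟨x, hx⟩ : P) ⊆ Tᶜ := fun y hy hyT =>
    Set.disjoint_left.1 hd ⟨y, hy, rfl⟩ hyT
  rw [connectedComponent_eq_iInter_isClopen] at hdis
  have : Nonempty { Z : Set P // IsClopen Z ∧ (⟨x, hx⟩ : P) ∈ Z } :=
    ⟨⟨univ, isClopen_univ, mem_univ _⟩⟩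
  obtain ⟨Q, hQ⟩ := exists_subset_nhds_of_isCompact'
    (V := fun Z : { Z : Set P // IsClopen Z ∧ (⟨x, hx⟩ : P) ∈ Z } => (Z : Set P))
    (fun Z Z' => ⟨⟨Z ∩ Z', Z.2.1.inter Z'.2.1, Z.2.2, Z'.2.2⟩, inter_subset_left,
      inter_subset_right⟩)
    (fun Z => Z.2.1.1.isCompact) (fun Z => Z.2.1.1)
    (fun y hy => hTc.isOpen_compl.mem_nhds (hdis hy))
  obtain ⟨W, hW, hWQ⟩ := isOpen_induced_iff.1 Q.2.1.2
  have hQc : IsClosed (Subtype.val '' (Q : Set P)) :=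
    (Q.2.1.1.isCompact.image continuous_subtype_val).isClosed
  have hQK : ∀ y : P, y ∈ (Q : Set P) → (y : S) ∉ K := fun y hy hyK =>
    hQ hy ⟨subset_closure hyK, y.2.2⟩
  obtain ⟨z, hzK, hzL⟩ := hKL
  obtain ⟨y, hyL, hyW, hyQ⟩ := hLp (W \ K) (Subtype.val '' (Q : Set P))ᶜ (hW.sdiff hK)
    hQc.isOpen_compl
    (fun y hy => by
      by_cases hyQ : y ∈ Subtype.val '' (Q : Set P)
      · obtain ⟨y, hyQ, rfl⟩ := hyQ
        exact Or.inl ⟨(hWQ.symm ▸ hyQ : y ∈ Subtype.val ⁻¹' W), hQK y hyQ⟩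
      · exact Or.inr hyQ)
    ⟨x, hx.1, (hWQ.symm ▸ Q.2.2 : (⟨x, hx⟩ : P) ∈ Subtype.val ⁻¹' W), hQK _ Q.2.2⟩
    ⟨z, hzL, fun ⟨w, _, hw⟩ => w.2.2 (hw ▸ hzK)⟩
  refine hyQ ⟨⟨y, hyL, fun h => hyW.2 (interior_subset h)⟩, ?_, rfl⟩
  rw [← hWQ]
  exact hyW.1

end

section

theorem locallyCompactSpace_halfPlane : LocallyCompactSpace {p : ℝ × ℝ // 0 ≤ p.2} :=
  (isClosed_le continuous_const continuous_snd).isClosedEmbedding_subtypeVal.locallyCompactSpace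

theorem locallyConnectedSpace_halfPlane : LocallyConnectedSpace {p : ℝ × ℝ // 0 ≤ p.2} := by
  refine locallyConnectedSpace_of_connected_bases
    (fun (x : {p : ℝ × ℝ // 0 ≤ p.2}) (r : ℝ) => Metric.ball x r) (fun _ r => 0 < r)
    (fun x => Metric.nhds_basis_ball) fun x r _ => ?_
  rw [← (IsEmbedding.subtypeVal (p := fun p : ℝ × ℝ => 0 ≤ p.2)).isInducing.isPreconnected_image]
  have h : Subtype.val '' Metric.ball x r = Metric.ball (x : ℝ × ℝ) r ∩ {p | 0 ≤ p.2} := by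
    ext p
    constructor
    · rintro ⟨q, hq, rfl⟩
      exact ⟨hq, q.2⟩
    · exact fun hp => ⟨⟨p, hp.2⟩, hp.1, rfl⟩
  rw [h]
  exact ((convex_ball _ _).inter
    (convex_halfSpace_ge (f := Prod.snd) ⟨fun _ _ => rfl, fun _ _ => rfl⟩ 0)).isPreconnected

variable {S : Type*} [TopologicalSpace S]

theorem IsSurface.exists_isOpenEmbedding (hS : IsSurface S) (x : S) :
    ∃ (V : Set {p : ℝ × ℝ // 0 ≤ p.2}) (φ : V → S),
      IsOpen V ∧ IsOpenEmbedding φ ∧ x ∈ range φ := by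
  obtain ⟨U, V, hU, hx, hV, ⟨e⟩⟩ := hS.locallyHalfPlane x
  exact ⟨V, Subtype.val ∘ e.symm, hV, hU.isOpenEmbedding_subtypeVal.comp e.symm.isOpenEmbedding,
    e ⟨x, hx⟩, by simp⟩

theorem IsSurface.locallyConnectedSpace (hS : IsSurface S) : LocallyConnectedSpace S := by
  rw [locallyConnectedSpace_iff_subsets_isOpen_isConnected]
  intro x N hN
  obtain ⟨V, φ, hV, hφ, y, rfl⟩ := hS.exists_isOpenEmbedding x
  have := locallyConnectedSpace_halfPlane
  have := hV.locallyConnectedSpace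
  obtain ⟨W, hWN, hW, hyW, hWc⟩ := locallyConnectedSpace_iff_subsets_isOpen_isConnected.1 this y
    (φ ⁻¹' N) (hφ.continuous.continuousAt hN)
  exact ⟨φ '' W, image_subset_iff.2 hWN, hφ.isOpenMap W hW, mem_image_of_mem φ hyW,
    hWc.image φ hφ.continuous.continuousOn⟩

theorem IsSurface.locallyCompactSpace (hS : IsSurface S) : LocallyCompactSpace S := by
  refine ⟨fun x N hN => ?_⟩
  obtain ⟨V, φ, hV, hφ, y, rfl⟩ := hS.exists_isOpenEmbedding x
  have := locallyCompactSpace_halfPlane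
  have := hV.locallyCompactSpace
  obtain ⟨W, hW, hWN, hWc⟩ := local_compact_nhds (hφ.continuous.continuousAt hN : φ ⁻¹' N ∈ 𝓝 y)
  exact ⟨φ '' W, hφ.isOpenMap.image_mem_nhds hW, image_subset_iff.2 hWN,
    hWc.image hφ.continuous⟩

end

/-- Let `S` be a noncompact surface with nonempty boundary and no
boundary isolating curve. Then there exists a compact exhaustion `K₀ ⊆ K₁ ⊆ ⋯` of `S`
(each `Kᵢ` compact, `Kᵢ ⊆ interior Kᵢ₊₁`, `⋃ᵢ Kᵢ = S`) such that for every `i`, every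
connected component of `S ∖ Kᵢ` intersects `∂S` and every connected component of
`Kᵢ₊₁ ∖ interior Kᵢ` intersects `∂S`. -/
theorem exists_exhaustion_every_piece_sees_boundary (S : Type*) [TopologicalSpace S]
    (hS : IsSurface S) (hnc : ¬ CompactSpace S) (hbd : (Bd S).Nonempty)
    (hbi : ¬ ∃ α : Set S, IsBoundaryIsolating α) :
    ∃ K : ℕ → Set S, (∀ i, IsCompact (K i)) ∧ (∀ i, K i ⊆ interior (K (i + 1))) ∧
      (⋃ i, K i) = univ ∧
      (∀ i, ∀ x ∈ (K i)ᶜ, (connectedComponentIn (K i)ᶜ x ∩ Bd S).Nonempty) ∧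
      (∀ i, ∀ x ∈ K (i + 1) \ interior (K i),
        (connectedComponentIn (K (i + 1) \ interior (K i)) x ∩ Bd S).Nonempty) := by
  have := hS.connected
  have := hS.t2
  have := hS.secondCountable
  have := hS.locallyConnectedSpace
  have := hS.locallyCompactSpace
  obtain ⟨a, -⟩ := id hbd
  choose Kf Cf hK hKp haK hAK hKB hC hKC hCK hCD using fun A : { A : Set S // IsCompact A } =>
    exists_isCompact_frontier_subset (B := Bd S)
      (fun K hK x hd => isCompact_closure_of_no_boundaryIsolating hbd hbi hK hd) A.2 a
  let A : ℕ → { A : Set S // IsCompact A } := fun n => Nat.rec ⟨{a}, isCompact_singleton⟩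
    (fun n A => ⟨Kf A ∪ Cf A ∪ compactCovering S n,
      ((hK A).union (hC A)).union (isCompact_compactCovering S n)⟩) n
  have hA : ∀ n, (A (n + 1) : Set S) = Kf (A n) ∪ Cf (A n) ∪ compactCovering S n := fun _ => rfl
  have hsub : ∀ n, Kf (A n) ∪ Cf (A n) ∪ compactCovering S n ⊆ interior (Kf (A (n + 1))) :=
    fun n => hA n ▸ hAK (A (n + 1))
  refine ⟨fun n => Kf (A n), fun n => hK _, fun n y hy => hsub n (Or.inl (Or.inl hy)), ?_,
    fun n => hKB _, fun n x hx => ?_⟩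
  · refine eq_univ_of_univ_subset ?_
    rw [← iUnion_compactCovering S]
    exact iUnion_subset fun n => Subset.trans (fun y hy => interior_subset (hsub n (Or.inr hy)))
      (subset_iUnion (fun n => Kf (A n)) (n + 1))
  · obtain ⟨y, hyx, hyK⟩ := connectedComponentIn_sdiff_interior_inter_frontier
      (hK (A n)).isClosed (hK (A (n + 1))) (hKp (A (n + 1)))
      ⟨a, haK (A n), interior_subset (haK (A (n + 1)))⟩ hx
    obtain ⟨D, hDC, hDp, hyD, hDB⟩ := hCD (A n) y (hKC _ hyK)
    refine hDB.mono (inter_subset_inter_left _ ?_)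
    rw [connectedComponentIn_eq hyx]
    exact hDp.subset_connectedComponentIn hyD fun z hz =>
      ⟨interior_subset (hsub n (Or.inl (Or.inr (hDC hz)))),
        Set.disjoint_left.1 (hCK (A n)) (hDC hz)⟩
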